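/- Let k be a field, λ a partition of n with charge κ ∈ ℤ in type C_∞, and S^λ the Specht module over R(β), β = Σ_{A∈[λ]} α_{res A}. Then the set {ψ_{w^T} m̄^λ : T a standard λ-tableau} (with ψ_{w^T} formed from any fixed reduced expression of w^T) is a k-basis of S^λ. Moreover, each ψ_{w^T} m̄^λ lies in e(res T)S^λ and is homogeneous of degree deg T − deg t^λ; consequently, for every ν ∈ I^β, the graded dimension of e(ν)S^λ is Σ q^{deg T − deg t^λ}, summed over standard λ-tableaux T with res T = ν. -/

import Mathlib

namespace QH

/-- Generators of the quiver Hecke algebra of type `C_∞` on `n` strands: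
idempotents `e(ν)` for sequences `ν ∈ I^n` (`I = ℤ_{≥0}`), polynomial generators
`x_1, …, x_n` and intertwiners `ψ_1, …, ψ_{n−1}` (1-based; out-of-range generators are
set to `0` by the relations below). -/
inductive Gen (n : ℕ) : Type
  | e : (Fin n → ℕ) → Gen n
  | x : ℕ → Gen n
  | p : ℕ → Gen n

variable (k : Type) [Field k] {n : ℕ}

/-- The free algebra on the generators. -/
abbrev FA (k : Type) [Field k] (n : ℕ) : Type := FreeAlgebra k (Gen n)

def E (ν : Fin n → ℕ) : FA k n := FreeAlgebra.ι k (Gen.e ν)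
def X (r : ℕ) : FA k n := FreeAlgebra.ι k (Gen.x r)
def P (r : ℕ) : FA k n := FreeAlgebra.ι k (Gen.p r)

/-- The entry of `ν` at the 1-based position `p` (junk value `0` out of range). -/
def seqAt (ν : Fin n → ℕ) (p : ℕ) : ℕ :=
  if h : 1 ≤ p ∧ p ≤ n then ν ⟨p - 1, by omega⟩ else 0

/-- `s_r ν`: the sequence `ν` with its entries at the (1-based) positions `r`, `r+1`
exchanged. -/
def swapAt (ν : Fin n → ℕ) (r : ℕ) : Fin n → ℕ := fun m =>
  if (m : ℕ) + 1 = r then seqAt ν (r + 1)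
  else if (m : ℕ) + 1 = r + 1 then seqAt ν r
  else ν m

/-- The finite set `I^β`: all sequences with the same content as `ν₀`. -/
def cls (ν₀ : Fin n → ℕ) : Finset (Fin n → ℕ) :=
  Finset.image (fun σ : Equiv.Perm (Fin n) => ν₀ ∘ σ) Finset.univ

/-- The polynomials `Q_{i,j}(u,v)` of type `C_∞`:
`Q_{0,1}(u,v) = u + v²`, `Q_{i,i+1}(u,v) = u + v` for `i ≠ 0`, `Q_{i,j} = 1` for
`|i − j| ≥ 2`, `Q_{i,i} = 0`, and `Q_{j,i}(u,v) = Q_{i,j}(v,u)`. -/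
def Qpol (i j : ℕ) (u v : FA k n) : FA k n :=
  if i = j then 0
  else if i = 0 ∧ j = 1 then u + v * v
  else if i = 1 ∧ j = 0 then u * u + v
  else if i + 1 = j ∨ j + 1 = i then u + v
  else 1

/-- The divided difference `(Q_{i,j}(u, v) − Q_{i,j}(w, v))/(u − w)` of type `C_∞`
(the `v`-dependence cancels), appearing in the braid relation. -/
def QDD (i j : ℕ) (u w : FA k n) : FA k n :=
  if i = j then 0
  else if i = 1 ∧ j = 0 then u + w
  else if i = 0 ∧ j = 1 then 1
  else if i + 1 = j ∨ j + 1 = i then 1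
  else 0

/-- The defining relations of the quiver Hecke algebra `R(β)` of type `C_∞`, where
`β = α_{ν₀ 1} + … + α_{ν₀ n}`. -/
inductive Rel (ν₀ : Fin n → ℕ) : FA k n → FA k n → Prop
  | idem (ν ν' : Fin n → ℕ) :
      Rel ν₀ (E k ν * E k ν') (if ν = ν' then E k ν else 0)
  | support (ν : Fin n → ℕ) (h : ν ∉ cls ν₀) : Rel ν₀ (E k ν) 0
  | total : Rel ν₀ (∑ ν ∈ cls ν₀, E k ν) 1
  | xzero (r : ℕ) (h : r = 0 ∨ n < r) : Rel ν₀ (X k r) 0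
  | pzero (r : ℕ) (h : r = 0 ∨ n ≤ r) : Rel ν₀ (P k r) 0
  | xe (r : ℕ) (ν : Fin n → ℕ) : Rel ν₀ (X k r * E k ν) (E k ν * X k r)
  | pe (r : ℕ) (h1 : 1 ≤ r) (h2 : r + 1 ≤ n) (ν : Fin n → ℕ) :
      Rel ν₀ (P k r * E k ν) (E k (swapAt ν r) * P k r)
  | xx (r s : ℕ) : Rel ν₀ (X k r * X k s) (X k s * X k r)
  | px (r s : ℕ) (h : s ≠ r) (h' : s ≠ r + 1) :
      Rel ν₀ (P k r * X k s) (X k s * P k r)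
  | pp (r s : ℕ) (h : r + 1 < s) : Rel ν₀ (P k r * P k s) (P k s * P k r)
  | xp (r : ℕ) (h1 : 1 ≤ r) (h2 : r + 1 ≤ n) (ν : Fin n → ℕ) :
      Rel ν₀ (X k r * P k r * E k ν)
        (P k r * X k (r + 1) * E k ν -
          (if seqAt ν r = seqAt ν (r + 1) then E k ν else 0))
  | px' (r : ℕ) (h1 : 1 ≤ r) (h2 : r + 1 ≤ n) (ν : Fin n → ℕ) :
      Rel ν₀ (X k (r + 1) * P k r * E k ν)
        (P k r * X k r * E k ν +
          (if seqAt ν r = seqAt ν (r + 1) then E k ν else 0))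
  | psq (r : ℕ) (h1 : 1 ≤ r) (h2 : r + 1 ≤ n) (ν : Fin n → ℕ) :
      Rel ν₀ (P k r * P k r * E k ν)
        (Qpol k (seqAt ν r) (seqAt ν (r + 1)) (X k r) (X k (r + 1)) * E k ν)
  | braid (r : ℕ) (h1 : 1 ≤ r) (h2 : r + 2 ≤ n) (ν : Fin n → ℕ) :
      Rel ν₀ ((P k (r + 1) * P k r * P k (r + 1) - P k r * P k (r + 1) * P k r) * E k ν)
        (if seqAt ν r = seqAt ν (r + 2)
         then QDD k (seqAt ν r) (seqAt ν (r + 1)) (X k r) (X k (r + 2)) * E k ν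
         else 0)

/-- The quiver Hecke algebra `R(β)` of type `C_∞` over `k`, for
`β = α_{ν₀ 1} + … + α_{ν₀ n}`. -/
abbrev Alg (ν₀ : Fin n → ℕ) : Type := RingQuot (Rel k ν₀)

/-- The quotient map. -/
def mk (ν₀ : Fin n → ℕ) : FA k n →ₐ[k] Alg k ν₀ := RingQuot.mkAlgHom k (Rel k ν₀)

def Ee (ν₀ ν : Fin n → ℕ) : Alg k ν₀ := mk k ν₀ (E k ν)
def Xe (ν₀ : Fin n → ℕ) (r : ℕ) : Alg k ν₀ := mk k ν₀ (X k r)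
def Pe (ν₀ : Fin n → ℕ) (r : ℕ) : Alg k ν₀ := mk k ν₀ (P k r)

/-- `ψ_L` for a word `L` in the simple transpositions (1-based letters). -/
def psiW (ν₀ : Fin n → ℕ) (L : List ℕ) : Alg k ν₀ := (L.map (Pe k ν₀)).prod

/-- The canonical reduced word for the block transposition `w[a,b]`:
`(s_b ⋯ s_{a+b−1})(s_{b−1} ⋯ s_{a+b−2}) ⋯ (s_1 ⋯ s_a)`. -/
def wordW (a b : ℕ) : List ℕ :=
  (List.range b).flatMap (fun m => (List.range a).map (fun i => b - m + i))

/-- `Ψ[a,b] := ψ_{w[a,b]}` (for the canonical reduced word; `w[a,b]` is fully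
commutative, so this is independent of the choice). -/
def PsiBr (ν₀ : Fin n → ℕ) (a b : ℕ) : Alg k ν₀ := psiW k ν₀ (wordW a b)

/-- `Ψ₂(c,a,b)`: the shift of `Ψ[a,b]` by `c`. -/
def PsiSh (ν₀ : Fin n → ℕ) (c a b : ℕ) : Alg k ν₀ :=
  psiW k ν₀ ((wordW a b).map (fun i => i + c))

end QH

/-! ### Partitions, tableaux and the combinatorics of type `C_∞` -/

/-- A node `(r, c)` of the Young diagram of a partition (1-based). -/
abbrev PNode : Type := ℕ × ℕ

/-- The simple transposition `sᵢ = (i, i+1)`. -/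
def sgen (i : ℕ) : Equiv.Perm ℕ := Equiv.swap i (i + 1)

/-- The Coxeter length of a permutation supported on `{1, …, n}`:
its number of inversions among `1, …, n`. -/
def invLen (n : ℕ) (w : Equiv.Perm ℕ) : ℕ :=
  ((Finset.Icc 1 n ×ˢ Finset.Icc 1 n).filter fun p => p.1 < p.2 ∧ w p.2 < w p.1).card

namespace PT

/-- `lam r` is the length `λ_r` of the `r`-th row (1-based) of a partition of `n`. -/
def IsPartitionOf (n : ℕ) (lam : ℕ → ℕ) : Prop :=
  (∀ r, 1 ≤ r → lam (r + 1) ≤ lam r) ∧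
  (∀ r, n < r → lam r = 0) ∧
  (∀ r, lam r ≤ n) ∧
  (∑ r ∈ Finset.Icc 1 n, lam r) = n

/-- The Young diagram `[λ]`. -/
def diag (lam : ℕ → ℕ) : Set PNode := {x | 1 ≤ x.1 ∧ 1 ≤ x.2 ∧ x.2 ≤ lam x.1}

/-- A `λ`-tableau: a bijection `[λ] → {1, …, n}`. -/
def IsTab (n : ℕ) (lam : ℕ → ℕ) (T : PNode → ℕ) : Prop :=
  Set.BijOn T (diag lam) (Set.Icc 1 n)

/-- Entries increase from left to right along rows. -/
def RowStrict (lam : ℕ → ℕ) (T : PNode → ℕ) : Prop :=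
  ∀ r c, (r, c) ∈ diag lam → (r, c + 1) ∈ diag lam → T (r, c) < T (r, c + 1)

/-- Entries increase down columns. -/
def ColStrict (lam : ℕ → ℕ) (T : PNode → ℕ) : Prop :=
  ∀ r c, (r, c) ∈ diag lam → (r + 1, c) ∈ diag lam → T (r, c) < T (r + 1, c)

/-- A standard `λ`-tableau. -/
def IsStd (n : ℕ) (lam : ℕ → ℕ) (T : PNode → ℕ) : Prop :=
  IsTab n lam T ∧ RowStrict lam T ∧ ColStrict lam T

/-- A standard `λ`-tableau, normalised to vanish off the diagram. -/
def IsStdN (n : ℕ) (lam : ℕ → ℕ) (T : PNode → ℕ) : Prop :=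
  IsStd n lam T ∧ ∀ x, x ∉ diag lam → T x = 0

/-- The initial tableau `t^λ`, filling `1, …, n` along successive rows. -/
def itab (lam : ℕ → ℕ) (x : PNode) : ℕ :=
  (∑ r' ∈ Finset.Ico 1 x.1, lam r') + x.2

/-- `(r, c)` is a Garnir node of `[λ]`. -/
def IsGarnir (lam : ℕ → ℕ) (r c : ℕ) : Prop :=
  (r, c) ∈ diag lam ∧ (r + 1, c) ∈ diag lam

/-- The type-`C_∞` residue of the node `(r, c)` for the charge `κ`. -/
def res (κ : ℤ) (x : PNode) : ℕ := (κ + (x.2 : ℤ) - (x.1 : ℤ)).natAbs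

/-- A word in the simple transpositions `s_1, …, s_{n-1}`. -/
def IsWord (n : ℕ) (L : List ℕ) : Prop := ∀ i ∈ L, 1 ≤ i ∧ i + 1 ≤ n

/-- The permutation given by a word. -/
def wordProd (L : List ℕ) : Equiv.Perm ℕ := (L.map sgen).prod

/-- `L` is a reduced word for the permutation `w^T` of the `λ`-tableau `T`. -/
def RedWordFor (n : ℕ) (lam : ℕ → ℕ) (T : PNode → ℕ) (L : List ℕ) : Prop :=
  IsWord n L ∧ (∀ x ∈ diag lam, wordProd L (itab lam x) = T x) ∧
  L.length = invLen n (wordProd L)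

end PT

/-! ### The Specht module -/

namespace SP

open QH PT

/-- The reduced word for `w^{g^A} = S₂(a, λ_r − c + 1, c)` (the Garnir tableau's
permutation), where `a = λ_1 + ⋯ + λ_{r−1} + c − 1`. -/
def garnirWord (lam : ℕ → ℕ) (r c : ℕ) : List ℕ :=
  (QH.wordW (lam r - c + 1) c).map
    (fun i => (∑ r' ∈ Finset.Ico 1 r, lam r') + (c - 1) + i)

variable (k : Type) [Field k] {n : ℕ}

/-- The defining relations of the permutation module `P^λ` as a cyclic module:
`e(ν) m^λ = δ_{ν, res t^λ} m^λ`, `x_i m^λ = 0` and `ψ_j m^λ = 0` for `j`, `j+1` in the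
same row of `t^λ`. -/
def pmSet (ν₀ : Fin n → ℕ) (nn : ℕ) (lam : ℕ → ℕ) : Set (Alg k ν₀) :=
  {a | a = 1 - Ee k ν₀ ν₀} ∪
  {a | ∃ i, 1 ≤ i ∧ i ≤ nn ∧ a = Xe k ν₀ i * Ee k ν₀ ν₀} ∪
  {a | ∃ r c, (r, c) ∈ PT.diag lam ∧ (r, c + 1) ∈ PT.diag lam ∧
        a = Pe k ν₀ (PT.itab lam (r, c)) * Ee k ν₀ ν₀}

/-- The Garnir elements `g_A = ψ_{w^{g^A}} m^λ`, over all Garnir nodes `A`. -/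
def gSet (ν₀ : Fin n → ℕ) (lam : ℕ → ℕ) : Set (Alg k ν₀) :=
  {a | ∃ r c, PT.IsGarnir lam r c ∧ a = psiW k ν₀ (garnirWord lam r c) * Ee k ν₀ ν₀}

/-- The left ideal presenting the Specht module `S^λ`. -/
def spechtIdeal (ν₀ : Fin n → ℕ) (nn : ℕ) (lam : ℕ → ℕ) :
    Submodule (Alg k ν₀) (Alg k ν₀) :=
  Submodule.span (Alg k ν₀) (pmSet k ν₀ nn lam ∪ gSet k ν₀ lam)

/-- The Specht module `S^λ` (the quotient of the permutation module `P^λ` by the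
Garnir relations), as a cyclic module over the quiver Hecke algebra. -/
abbrev Specht (ν₀ : Fin n → ℕ) (nn : ℕ) (lam : ℕ → ℕ) : Type :=
  Alg k ν₀ ⧸ spechtIdeal k ν₀ nn lam

/-- The generator `m̄^λ ∈ S^λ`. -/
def mbar (ν₀ : Fin n → ℕ) (nn : ℕ) (lam : ℕ → ℕ) : Specht k ν₀ nn lam :=
  Submodule.Quotient.mk (1 : Alg k ν₀)

end SP

/-! ### Degrees of standard tableaux in type `C_∞` -/

/-- The symmetric bilinear form `(α_i, α_j)` in type `C_∞`. -/
def BInf (i j : ℕ) : ℤ :=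
  if i = j then (if i = 0 then 4 else 2)
  else if min i j = 0 ∧ max i j = 1 then -2
  else if max i j = min i j + 1 then -1
  else 0

namespace PT

/-- The addable `i`-nodes of the diagram `S` lying in rows strictly below `A`. -/
def addBelow (resN : PNode → ℕ) (S : Set PNode) (i : ℕ) (A : PNode) : Set PNode :=
  {y | 1 ≤ y.1 ∧ 1 ≤ y.2 ∧ y ∉ S ∧ resN y = i ∧
       (y.1 = 1 ∨ (y.1 - 1, y.2) ∈ S) ∧ (y.2 = 1 ∨ (y.1, y.2 - 1) ∈ S) ∧ A.1 < y.1}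

/-- The removable `i`-nodes of the diagram `S` lying in rows strictly below `A`. -/
def remBelow (resN : PNode → ℕ) (S : Set PNode) (i : ℕ) (A : PNode) : Set PNode :=
  {y | y ∈ S ∧ resN y = i ∧ (y.1 + 1, y.2) ∉ S ∧ (y.1, y.2 + 1) ∉ S ∧ A.1 < y.1}

/-- `d_A` of a diagram `S`:
`d_i · (#{addable i-nodes below A} − #{removable i-nodes below A})`, `i = res A`. -/
noncomputable def dA (resN : PNode → ℕ) (S : Set PNode) (A : PNode) : ℤ :=
  (BInf (resN A) (resN A) / 2) *
    (((addBelow resN S (resN A) A).ncard : ℤ) - ((remBelow resN S (resN A) A).ncard : ℤ))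

/-- The Young diagram as a finset. -/
def diagF (n : ℕ) (lam : ℕ → ℕ) : Finset PNode :=
  ((Finset.Icc 1 n) ×ˢ (Finset.Icc 1 n)).filter (fun x => x.2 ≤ lam x.1)

/-- The degree of a standard tableau `T` (closed form of the recursion
`deg T = deg T↓(n−1) + d_A(λ)`, `A = T⁻¹(n)`). -/
noncomputable def degP (n : ℕ) (lam : ℕ → ℕ) (κ : ℤ) (T : PNode → ℕ) : ℤ :=
  ∑ x ∈ diagF n lam, dA (res κ) {y | y ∈ diag lam ∧ T y ≤ T x} x

end PT

open QH PT SP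

namespace SpechtBasis

section Operators

/-- The polynomials `Q_{i,j}(u,v)` evaluated in an arbitrary ring. -/
def quivPoly {A : Type*} [Ring A] (i j : ℕ) (u v : A) : A :=
  if i = j then 0
  else if i = 0 ∧ j = 1 then u + v * v
  else if i = 1 ∧ j = 0 then u * u + v
  else if i + 1 = j ∨ j + 1 = i then u + v
  else 1

/-- The divided difference in the braid relation, evaluated in an arbitrary ring. -/
def quivDiff {A : Type*} [Ring A] (i j : ℕ) (u w : A) : A :=
  if i = j then 0
  else if i = 1 ∧ j = 0 then u + w
  else if i = 0 ∧ j = 1 then 1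
  else if i + 1 = j ∨ j + 1 = i then 1
  else 0

theorem map_quivPoly {A B : Type*} [Ring A] [Ring B] (f : A →+* B) (i j : ℕ) (u v : A) :
    f (quivPoly i j u v) = quivPoly i j (f u) (f v) := by
  unfold quivPoly; split_ifs <;> simp

theorem map_quivDiff {A B : Type*} [Ring A] [Ring B] (f : A →+* B) (i j : ℕ) (u v : A) :
    f (quivDiff i j u v) = quivDiff i j (f u) (f v) := by
  unfold quivDiff; split_ifs <;> simp

/-- A family of elements of a ring satisfying the defining relations of the quiver Hecke
algebra of type `C_∞`. -/
structure HeckeOps {n : ℕ} (ν₀ : Fin n → ℕ) (A : Type*) [Ring A] where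
  e : (Fin n → ℕ) → A
  x : ℕ → A
  p : ℕ → A
  idem : ∀ ν ν', e ν * e ν' = if ν = ν' then e ν else 0
  support : ∀ ν, ν ∉ cls ν₀ → e ν = 0
  total : ∑ ν ∈ cls ν₀, e ν = 1
  xzero : ∀ r, r = 0 ∨ n < r → x r = 0
  pzero : ∀ r, r = 0 ∨ n ≤ r → p r = 0
  xe : ∀ r ν, x r * e ν = e ν * x r
  pe : ∀ r, 1 ≤ r → r + 1 ≤ n → ∀ ν, p r * e ν = e (swapAt ν r) * p r
  xx : ∀ r s, x r * x s = x s * x r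
  px : ∀ r s, s ≠ r → s ≠ r + 1 → p r * x s = x s * p r
  pp : ∀ r s, r + 1 < s → p r * p s = p s * p r
  xp : ∀ r, 1 ≤ r → r + 1 ≤ n → ∀ ν, x r * p r * e ν =
    p r * x (r + 1) * e ν - (if seqAt ν r = seqAt ν (r + 1) then e ν else 0)
  xp' : ∀ r, 1 ≤ r → r + 1 ≤ n → ∀ ν, x (r + 1) * p r * e ν =
    p r * x r * e ν + (if seqAt ν r = seqAt ν (r + 1) then e ν else 0)
  psq : ∀ r, 1 ≤ r → r + 1 ≤ n → ∀ ν, p r * p r * e ν =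
    quivPoly (seqAt ν r) (seqAt ν (r + 1)) (x r) (x (r + 1)) * e ν
  braid : ∀ r, 1 ≤ r → r + 2 ≤ n → ∀ ν,
    (p (r + 1) * p r * p (r + 1) - p r * p (r + 1) * p r) * e ν =
      if seqAt ν r = seqAt ν (r + 2)
      then quivDiff (seqAt ν r) (seqAt ν (r + 1)) (x r) (x (r + 2)) * e ν else 0

namespace HeckeOps

variable {n : ℕ} {ν₀ : Fin n → ℕ}

/-- The product of the operators `ψ` along a word. -/
def psi {A : Type*} [Ring A] (h : HeckeOps ν₀ A) (L : List ℕ) : A := (L.map h.p).prod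

@[simp] theorem psi_nil {A : Type*} [Ring A] (h : HeckeOps ν₀ A) : h.psi [] = 1 := rfl

@[simp] theorem psi_cons {A : Type*} [Ring A] (h : HeckeOps ν₀ A) (r : ℕ) (L : List ℕ) :
    h.psi (r :: L) = h.p r * h.psi L := by simp [psi]

/-- The image of a family of operators under a ring homomorphism. -/
def map {A B : Type*} [Ring A] [Ring B] (h : HeckeOps ν₀ A) (f : A →+* B) :
    HeckeOps ν₀ B where
  e ν := f (h.e ν)
  x r := f (h.x r)
  p r := f (h.p r)
  idem ν ν' := by rw [← map_mul, h.idem]; split_ifs <;> simp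
  support ν hν := by rw [h.support ν hν, map_zero]
  total := by rw [← map_sum, h.total, map_one]
  xzero r hr := by rw [h.xzero r hr, map_zero]
  pzero r hr := by rw [h.pzero r hr, map_zero]
  xe r ν := by rw [← map_mul, h.xe, map_mul]
  pe r h1 h2 ν := by rw [← map_mul, h.pe r h1 h2, map_mul]
  xx r s := by rw [← map_mul, h.xx, map_mul]
  px r s h1 h2 := by rw [← map_mul, h.px r s h1 h2, map_mul]
  pp r s h1 := by rw [← map_mul, h.pp r s h1, map_mul]
  xp r h1 h2 ν := by
    rw [← map_mul, ← map_mul, h.xp r h1 h2]; split_ifs <;> simp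
  xp' r h1 h2 ν := by
    rw [← map_mul, ← map_mul, h.xp' r h1 h2]; split_ifs <;> simp
  psq r h1 h2 ν := by
    rw [← map_mul, ← map_mul, h.psq r h1 h2, map_mul, map_quivPoly]
  braid r h1 h2 ν := by
    simp only [← map_mul, ← map_sub]
    rw [h.braid r h1 h2]
    split_ifs <;> simp [map_quivDiff]

theorem map_psi {A B : Type*} [Ring A] [Ring B] (h : HeckeOps ν₀ A) (f : A →+* B)
    (L : List ℕ) : (h.map f).psi L = f (h.psi L) := by
  induction L with
  | nil => simp
  | cons r L ih => rw [psi_cons, psi_cons, ih, map_mul]; rfl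

section Algebra

variable (k : Type) [Field k]

theorem Qpol_eq (i j : ℕ) (u v : FA k n) : Qpol k i j u v = quivPoly i j u v := rfl

theorem QDD_eq (i j : ℕ) (u v : FA k n) : QDD k i j u v = quivDiff i j u v := rfl

theorem mk_rel {a b : FA k n} (h : Rel k ν₀ a b) : QH.mk k ν₀ a = QH.mk k ν₀ b :=
  RingQuot.mkAlgHom_rel k h

theorem mk_quivPoly (i j : ℕ) (u v : FA k n) :
    QH.mk k ν₀ (quivPoly i j u v) = quivPoly i j (QH.mk k ν₀ u) (QH.mk k ν₀ v) :=
  map_quivPoly (QH.mk k ν₀).toRingHom i j u v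

theorem mk_quivDiff (i j : ℕ) (u v : FA k n) :
    QH.mk k ν₀ (quivDiff i j u v) = quivDiff i j (QH.mk k ν₀ u) (QH.mk k ν₀ v) :=
  map_quivDiff (QH.mk k ν₀).toRingHom i j u v

/-- The generators of the quiver Hecke algebra. -/
def ofAlg (ν₀ : Fin n → ℕ) : HeckeOps ν₀ (Alg k ν₀) where
  e := Ee k ν₀
  x := Xe k ν₀
  p := Pe k ν₀
  idem ν ν' := by
    have := mk_rel k (Rel.idem (k := k) (ν₀ := ν₀) ν ν')
    rw [apply_ite (QH.mk k ν₀)] at this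
    simpa [Ee] using this
  support ν hν := by simpa [Ee] using mk_rel k (Rel.support (k := k) (ν₀ := ν₀) ν hν)
  total := by simpa [Ee] using mk_rel k (Rel.total (k := k) (ν₀ := ν₀))
  xzero r hr := by simpa [Xe] using mk_rel k (Rel.xzero (k := k) (ν₀ := ν₀) r hr)
  pzero r hr := by simpa [Pe] using mk_rel k (Rel.pzero (k := k) (ν₀ := ν₀) r hr)
  xe r ν := by simpa [Xe, Ee] using mk_rel k (Rel.xe (k := k) (ν₀ := ν₀) r ν)
  pe r h1 h2 ν := by simpa [Pe, Ee] using mk_rel k (Rel.pe (k := k) (ν₀ := ν₀) r h1 h2 ν)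
  xx r s := by simpa [Xe] using mk_rel k (Rel.xx (k := k) (ν₀ := ν₀) r s)
  px r s h1 h2 := by simpa [Xe, Pe] using mk_rel k (Rel.px (k := k) (ν₀ := ν₀) r s h1 h2)
  pp r s h1 := by simpa [Pe] using mk_rel k (Rel.pp (k := k) (ν₀ := ν₀) r s h1)
  xp r h1 h2 ν := by
    have := mk_rel k (Rel.xp (k := k) (ν₀ := ν₀) r h1 h2 ν)
    rw [map_sub, apply_ite (QH.mk k ν₀)] at this
    simpa [Ee, Xe, Pe] using this
  xp' r h1 h2 ν := by
    have := mk_rel k (Rel.px' (k := k) (ν₀ := ν₀) r h1 h2 ν)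
    rw [map_add, apply_ite (QH.mk k ν₀)] at this
    simpa [Ee, Xe, Pe] using this
  psq r h1 h2 ν := by
    have := mk_rel k (Rel.psq (k := k) (ν₀ := ν₀) r h1 h2 ν)
    rw [Qpol_eq, map_mul, map_mul, map_mul, mk_quivPoly] at this
    exact this
  braid r h1 h2 ν := by
    have := mk_rel k (Rel.braid (k := k) (ν₀ := ν₀) r h1 h2 ν)
    rw [apply_ite (QH.mk k ν₀), QDD_eq, map_mul (QH.mk k ν₀) (quivDiff _ _ _ _), mk_quivDiff] at this
    simpa [Ee, Xe, Pe] using this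

/-- The images of the generators of the free algebra. -/
def genImage {A : Type*} [Ring A] (h : HeckeOps ν₀ A) : Gen n → A
  | Gen.e ν => h.e ν
  | Gen.x r => h.x r
  | Gen.p r => h.p r

variable {k}
variable {A : Type*} [Ring A] [Algebra k A]

/-- The algebra homomorphism from the free algebra. -/
def freeLift (h : HeckeOps ν₀ A) : FA k n →ₐ[k] A := FreeAlgebra.lift k h.genImage

@[simp] theorem freeLift_E (h : HeckeOps ν₀ A) (ν : Fin n → ℕ) :
    h.freeLift (E k ν) = h.e ν := by simp [freeLift, E, genImage]

@[simp] theorem freeLift_X (h : HeckeOps ν₀ A) (r : ℕ) :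
    h.freeLift (X k r : FA k n) = h.x r := by simp [freeLift, X, genImage]

@[simp] theorem freeLift_P (h : HeckeOps ν₀ A) (r : ℕ) :
    h.freeLift (P k r : FA k n) = h.p r := by simp [freeLift, P, genImage]

theorem freeLift_quivPoly (h : HeckeOps ν₀ A) (i j : ℕ) (u v : FA k n) :
    h.freeLift (quivPoly i j u v) = quivPoly i j (h.freeLift u) (h.freeLift v) :=
  map_quivPoly h.freeLift.toRingHom i j u v

theorem freeLift_quivDiff (h : HeckeOps ν₀ A) (i j : ℕ) (u v : FA k n) :
    h.freeLift (quivDiff i j u v) = quivDiff i j (h.freeLift u) (h.freeLift v) :=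
  map_quivDiff h.freeLift.toRingHom i j u v

theorem freeLift_rel (h : HeckeOps ν₀ A) {a b : FA k n} (hab : Rel k ν₀ a b) :
    h.freeLift a = h.freeLift b := by
  cases hab with
  | idem ν ν' => rw [apply_ite h.freeLift]; simpa using h.idem ν ν'
  | support ν hν => simpa using h.support ν hν
  | total => simpa using h.total
  | xzero r hr => simpa using h.xzero r hr
  | pzero r hr => simpa using h.pzero r hr
  | xe r ν => simpa using h.xe r ν
  | pe r h1 h2 ν => simpa using h.pe r h1 h2 ν
  | xx r s => simpa using h.xx r s
  | px r s h1 h2 => simpa using h.px r s h1 h2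
  | pp r s h1 => simpa using h.pp r s h1
  | xp r h1 h2 ν => rw [map_sub, apply_ite h.freeLift]; simpa using h.xp r h1 h2 ν
  | px' r h1 h2 ν => rw [map_add, apply_ite h.freeLift]; simpa using h.xp' r h1 h2 ν
  | psq r h1 h2 ν =>
    rw [Qpol_eq, map_mul h.freeLift (quivPoly _ _ _ _), freeLift_quivPoly]
    simpa using h.psq r h1 h2 ν
  | braid r h1 h2 ν =>
    rw [apply_ite h.freeLift, QDD_eq, map_mul h.freeLift (quivDiff _ _ _ _), freeLift_quivDiff]
    simpa using h.braid r h1 h2 ν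

/-- The algebra homomorphism from the quiver Hecke algebra determined by operators
satisfying its relations. -/
def lift (h : HeckeOps ν₀ A) : Alg k ν₀ →ₐ[k] A :=
  RingQuot.liftAlgHom k ⟨h.freeLift, fun _ _ hab => h.freeLift_rel hab⟩

theorem lift_mk (h : HeckeOps ν₀ A) (a : FA k n) :
    h.lift (QH.mk k ν₀ a) = h.freeLift a := by
  simp [lift, QH.mk]

@[simp] theorem lift_Ee (h : HeckeOps ν₀ A) (ν : Fin n → ℕ) :
    h.lift (Ee k ν₀ ν) = h.e ν := by rw [Ee, lift_mk, freeLift_E]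

@[simp] theorem lift_Xe (h : HeckeOps ν₀ A) (r : ℕ) :
    h.lift (Xe k ν₀ r) = h.x r := by rw [Xe, lift_mk, freeLift_X]

@[simp] theorem lift_Pe (h : HeckeOps ν₀ A) (r : ℕ) :
    h.lift (Pe k ν₀ r) = h.p r := by rw [Pe, lift_mk, freeLift_P]

theorem lift_psiW (h : HeckeOps ν₀ A) (L : List ℕ) :
    h.lift (psiW k ν₀ L) = h.psi L := by
  rw [psiW, map_list_prod, psi, List.map_map]
  congr 2
  funext r
  simp

/-- A subspace stable under the generators is stable under the algebra. -/
theorem smul_mem_of_generators {M : Type*} [AddCommGroup M] [Module k M] [Module (Alg k ν₀) M]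
    [IsScalarTower k (Alg k ν₀) M] (N : Submodule k M)
    (he : ∀ ν, ∀ v ∈ N, Ee k ν₀ ν • v ∈ N) (hx : ∀ r, ∀ v ∈ N, Xe k ν₀ r • v ∈ N)
    (hp : ∀ r, ∀ v ∈ N, Pe k ν₀ r • v ∈ N) (a : Alg k ν₀) {v : M} (hv : v ∈ N) :
    a • v ∈ N := by
  obtain ⟨a, rfl⟩ := RingQuot.mkAlgHom_surjective k (Rel k ν₀) a
  change QH.mk k ν₀ a • v ∈ N
  induction a using FreeAlgebra.induction generalizing v with
  | grade0 c =>
    rw [AlgHom.commutes, algebraMap_smul]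
    exact N.smul_mem c hv
  | grade1 g =>
    cases g with
    | e ν => exact he ν v hv
    | x r => exact hx r v hv
    | p r => exact hp r v hv
  | mul a b iha ihb => rw [map_mul, mul_smul]; exact iha (ihb hv)
  | add a b iha ihb => rw [map_add, add_smul]; exact N.add_mem (iha hv) (ihb hv)

end Algebra

end HeckeOps

end Operators

section Tableaux

variable {n : ℕ} {lam : ℕ → ℕ} {κ : ℤ}

theorem lam_anti (hP : IsPartitionOf n lam) {r s : ℕ} (hr : 1 ≤ r) (hrs : r ≤ s) :
    lam s ≤ lam r := by
  induction s, hrs using Nat.le_induction with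
  | base => exact le_rfl
  | succ s hs ih => exact (hP.1 s (hr.trans hs)).trans ih

theorem diag_of_le (hP : IsPartitionOf n lam) {x y : PNode} (hy : y ∈ diag lam)
    (h1 : 1 ≤ x.1) (h2 : 1 ≤ x.2) (h1' : x.1 ≤ y.1) (h2' : x.2 ≤ y.2) : x ∈ diag lam :=
  ⟨h1, h2, h2'.trans (hy.2.2.trans (lam_anti hP h1 h1'))⟩

theorem mem_diagF (hP : IsPartitionOf n lam) {x : PNode} :
    x ∈ diagF n lam ↔ x ∈ diag lam := by
  simp only [diagF, Finset.mem_filter, Finset.mem_product, Finset.mem_Icc, diag, Set.mem_ofPred_eq]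
  constructor
  · rintro ⟨⟨⟨h1, h2⟩, h3, h4⟩, h5⟩
    exact ⟨h1, h3, h5⟩
  · rintro ⟨h1, h2, h3⟩
    refine ⟨⟨⟨h1, ?_⟩, h2, h3.trans (hP.2.2.1 _)⟩, h3⟩
    by_contra! h
    have := hP.2.1 _ h
    omega

theorem itab_lt (x y : PNode) (hx : x ∈ diag lam) (hy : y ∈ diag lam)
    (h : x.1 < y.1 ∨ x.1 = y.1 ∧ x.2 < y.2) : itab lam x < itab lam y := by
  rcases h with h | ⟨h1, h2⟩
  · have hsub : (∑ r ∈ Finset.Ico 1 x.1, lam r) + lam x.1 ≤ ∑ r ∈ Finset.Ico 1 y.1, lam r := by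
      rw [← Finset.sum_Ico_succ_top hx.1]
      exact Finset.sum_le_sum_of_subset (Finset.Ico_subset_Ico le_rfl h)
    have := hx.2.2
    have := hy.2.1
    unfold itab
    omega
  · unfold itab
    rw [h1]
    omega

theorem itab_lt_iff {x y : PNode} (hx : x ∈ diag lam) (hy : y ∈ diag lam) :
    itab lam x < itab lam y ↔ x.1 < y.1 ∨ x.1 = y.1 ∧ x.2 < y.2 := by
  refine ⟨fun h => ?_, itab_lt x y hx hy⟩
  by_contra hc
  rcases eq_or_ne x y with rfl | hne
  · exact lt_irrefl _ h
  · have h' : y.1 < x.1 ∨ y.1 = x.1 ∧ y.2 < x.2 := by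
      by_contra hc'
      exact hne (Prod.ext (by omega) (by omega))
    exact lt_asymm h (itab_lt y x hy hx h')

theorem itab_injOn : Set.InjOn (itab lam) (diag lam) := by
  intro x hx y hy h
  have h1 := itab_lt_iff hx hy
  have h2 := itab_lt_iff hy hx
  have h3 : ¬ itab lam x < itab lam y := by omega
  have h4 : ¬ itab lam y < itab lam x := by omega
  rw [h1] at h3
  rw [h2] at h4
  exact Prod.ext (by omega) (by omega)

theorem card_diagF (hP : IsPartitionOf n lam) : (diagF n lam).card = n := by
  conv_rhs => rw [← hP.2.2.2]
  rw [diagF, Finset.card_filter, Finset.sum_product]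
  refine Finset.sum_congr rfl fun r _ => ?_
  rw [← Finset.card_filter]
  have : (Finset.Icc 1 n).filter (fun c => c ≤ lam r) = Finset.Icc 1 (lam r) := by
    ext c
    have := hP.2.2.1 r
    simp only [Finset.mem_filter, Finset.mem_Icc]
    omega
  rw [this, Nat.card_Icc]
  omega

theorem itab_isTab (hP : IsPartitionOf n lam) : IsTab n lam (itab lam) := by
  have hmaps : Set.MapsTo (itab lam) (diag lam) (Set.Icc 1 n) := by
    intro x hx
    refine ⟨hx.2.1.trans (Nat.le_add_left _ _), ?_⟩
    have h1 := (mem_diagF hP).2 hx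
    simp only [diagF, Finset.mem_filter, Finset.mem_product, Finset.mem_Icc] at h1
    have h2 : (∑ r ∈ Finset.Ico 1 x.1, lam r) + lam x.1 ≤ ∑ r ∈ Finset.Icc 1 n, lam r := by
      rw [← Finset.sum_Ico_succ_top hx.1]
      refine Finset.sum_le_sum_of_subset fun r hr => ?_
      simp only [Finset.mem_Ico, Finset.mem_Icc] at hr ⊢
      omega
    rw [hP.2.2.2] at h2
    have := hx.2.2
    unfold itab
    omega
  refine ⟨hmaps, itab_injOn, ?_⟩
  have := Finset.surjOn_of_injOn_of_card_le (s := diagF n lam) (t := Finset.Icc 1 n) (itab lam)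
    (fun x hx => by
      have := hmaps ((mem_diagF hP).1 hx)
      simpa using this)
    (fun x hx y hy h => itab_injOn ((mem_diagF hP).1 hx) ((mem_diagF hP).1 hy) h)
    (by rw [card_diagF hP, Nat.card_Icc]; omega)
  intro p hp
  obtain ⟨x, hx, hxp⟩ := this (by simpa using hp : p ∈ (Finset.Icc 1 n : Set ℕ))
  exact ⟨x, (mem_diagF hP).1 hx, hxp⟩

/-- A tableau, normalised to vanish off the diagram. -/
def IsTabN (n : ℕ) (lam : ℕ → ℕ) (T : PNode → ℕ) : Prop :=
  IsTab n lam T ∧ ∀ x, x ∉ diag lam → T x = 0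

theorem _root_.PT.IsStdN.isTabN {T : PNode → ℕ} (h : IsStdN n lam T) : IsTabN n lam T :=
  ⟨h.1.1, h.2⟩

theorem IsTabN.inj {T : PNode → ℕ} (h : IsTabN n lam T) {x y : PNode} (hx : x ∈ diag lam)
    (hy : y ∈ diag lam) (hxy : T x = T y) : x = y := h.1.injOn hx hy hxy

theorem IsTabN.exists_node {T : PNode → ℕ} (h : IsTabN n lam T) {p : ℕ} (h1 : 1 ≤ p)
    (h2 : p ≤ n) : ∃ x ∈ diag lam, T x = p := h.1.surjOn ⟨h1, h2⟩

open Classical in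
/-- The initial tableau, normalised to vanish off the diagram. -/
noncomputable def iniTab (lam : ℕ → ℕ) : PNode → ℕ :=
  fun x => if x ∈ diag lam then itab lam x else 0

theorem iniTab_of_mem {x : PNode} (hx : x ∈ diag lam) : iniTab lam x = itab lam x := if_pos hx

theorem iniTab_isTabN (hP : IsPartitionOf n lam) : IsTabN n lam (iniTab lam) :=
  ⟨(itab_isTab hP).congr fun _ hx => (iniTab_of_mem hx).symm, fun _ hx => if_neg hx⟩

theorem iniTab_isStdN (hP : IsPartitionOf n lam) : IsStdN n lam (iniTab lam) := by
  refine ⟨⟨(iniTab_isTabN hP).1, fun r c h1 h2 => ?_, fun r c h1 h2 => ?_⟩,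
    (iniTab_isTabN hP).2⟩
  · rw [iniTab_of_mem h1, iniTab_of_mem h2]
    exact itab_lt _ _ h1 h2 (Or.inr ⟨rfl, Nat.lt_succ_self c⟩)
  · rw [iniTab_of_mem h1, iniTab_of_mem h2]
    exact itab_lt _ _ h1 h2 (Or.inl (Nat.lt_succ_self r))

theorem sgen_apply (r p : ℕ) :
    sgen r p = if p = r then r + 1 else if p = r + 1 then r else p := by
  rw [sgen, Equiv.swap_apply_def]

/-- The action of the simple transposition `s_r` on a tableau. -/
def sw (r : ℕ) (T : PNode → ℕ) : PNode → ℕ := fun x => sgen r (T x)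

theorem sw_apply (r : ℕ) (T : PNode → ℕ) (x : PNode) :
    sw r T x = if T x = r then r + 1 else if T x = r + 1 then r else T x := sgen_apply r (T x)

@[simp] theorem sw_sw (r : ℕ) (T : PNode → ℕ) : sw r (sw r T) = T := by
  funext x
  simp [sw, sgen]

theorem sw_comm {r s : ℕ} (h : r + 1 < s) (T : PNode → ℕ) : sw r (sw s T) = sw s (sw r T) := by
  funext x
  simp only [sw_apply]
  split_ifs <;> omega

theorem sw_braid (r : ℕ) (T : PNode → ℕ) :
    sw r (sw (r + 1) (sw r T)) = sw (r + 1) (sw r (sw (r + 1) T)) := by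
  funext x
  simp only [sw_apply]
  split_ifs <;> omega

theorem IsTabN.sw {T : PNode → ℕ} (h : IsTabN n lam T) {r : ℕ} (h1 : 1 ≤ r) (h2 : r + 1 ≤ n) :
    IsTabN n lam (sw r T) := by
  refine ⟨⟨fun x hx => ?_, fun x hx y hy hxy => h.inj hx hy ((sgen r).injective hxy),
    fun p hp => ?_⟩, fun x hx => ?_⟩
  · have := h.1.mapsTo hx
    simp only [Set.mem_Icc, sw_apply] at this ⊢
    split_ifs <;> omega
  · have : sgen r p ∈ Set.Icc 1 n := by
      simp only [Set.mem_Icc, sgen_apply] at hp ⊢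
      split_ifs <;> omega
    obtain ⟨x, hx, hxp⟩ := h.1.surjOn this
    refine ⟨x, hx, ?_⟩
    simp [SpechtBasis.sw, hxp, sgen]
  · rw [sw_apply, h.2 x hx, if_neg (by omega), if_neg (by omega)]

/-- The tableau obtained by acting on the initial tableau by a word. -/
noncomputable def tab (lam : ℕ → ℕ) (L : List ℕ) : PNode → ℕ :=
  fun x => wordProd L (iniTab lam x)

@[simp] theorem tab_nil : tab lam [] = iniTab lam := rfl

theorem tab_cons (r : ℕ) (L : List ℕ) : tab lam (r :: L) = sw r (tab lam L) := by
  funext x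
  simp [tab, sw, wordProd]

theorem _root_.PT.IsWord.of_cons {r : ℕ} {L : List ℕ} (h : IsWord n (r :: L)) : IsWord n L :=
  fun i hi => h i (List.mem_cons_of_mem r hi)

theorem _root_.PT.IsWord.head {r : ℕ} {L : List ℕ} (h : IsWord n (r :: L)) : 1 ≤ r ∧ r + 1 ≤ n :=
  h r List.mem_cons_self

theorem _root_.PT.IsWord.cons {r : ℕ} {L : List ℕ} (h : IsWord n L) (h1 : 1 ≤ r) (h2 : r + 1 ≤ n) :
    IsWord n (r :: L) := by
  intro i hi
  rcases List.mem_cons.1 hi with rfl | hi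
  exacts [⟨h1, h2⟩, h i hi]

theorem tab_isTabN (hP : IsPartitionOf n lam) {L : List ℕ} (hL : IsWord n L) :
    IsTabN n lam (tab lam L) := by
  induction L with
  | nil => exact iniTab_isTabN hP
  | cons r L ih =>
    rw [tab_cons]
    exact (ih hL.of_cons).sw hL.head.1 hL.head.2

/-- The number of inversions of a tableau relative to the initial tableau. -/
def len (n : ℕ) (lam : ℕ → ℕ) (T : PNode → ℕ) : ℕ :=
  ((diagF n lam ×ˢ diagF n lam).filter
    fun p => itab lam p.1 < itab lam p.2 ∧ T p.2 < T p.1).card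

theorem len_iniTab (hP : IsPartitionOf n lam) : len n lam (iniTab lam) = 0 := by
  rw [len, Finset.card_eq_zero, Finset.filter_eq_empty_iff]
  rintro ⟨x, y⟩ hxy ⟨h1, h2⟩
  rw [Finset.mem_product] at hxy
  rw [iniTab_of_mem ((mem_diagF hP).1 hxy.1), iniTab_of_mem ((mem_diagF hP).1 hxy.2)] at h2
  exact lt_asymm h1 h2

theorem len_sw (hP : IsPartitionOf n lam) {T : PNode → ℕ} (h : IsTabN n lam T) {r : ℕ}
    {x y : PNode} (hx : x ∈ diag lam) (hy : y ∈ diag lam) (hTx : T x = r) (hTy : T y = r + 1)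
    (hxy : itab lam x < itab lam y) : len n lam (sw r T) = len n lam T + 1 := by
  have hnot : (x, y) ∉ (diagF n lam ×ˢ diagF n lam).filter
      fun p => itab lam p.1 < itab lam p.2 ∧ T p.2 < T p.1 := by
    simp [hTx, hTy]
  rw [len, len, ← Finset.card_insert_of_notMem hnot]
  congr 1
  ext ⟨u, v⟩
  simp only [Finset.mem_filter, Finset.mem_product, Finset.mem_insert, Prod.mk.injEq,
    mem_diagF hP]
  constructor
  · rintro ⟨⟨hu, hv⟩, huv, hlt⟩
    by_cases hc : T u = r ∧ T v = r + 1
    · exact Or.inl ⟨h.inj hu hx (hc.1.trans hTx.symm), h.inj hv hy (hc.2.trans hTy.symm)⟩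
    · refine Or.inr ⟨⟨hu, hv⟩, huv, ?_⟩
      simp only [sw_apply] at hlt
      split_ifs at hlt <;> omega
  · rintro (⟨rfl, rfl⟩ | ⟨⟨hu, hv⟩, huv, hlt⟩)
    · refine ⟨⟨hx, hy⟩, hxy, ?_⟩
      simp [sw_apply, hTx, hTy]
    · refine ⟨⟨hu, hv⟩, huv, ?_⟩
      have hc : ¬ (T u = r + 1 ∧ T v = r) := by
        rintro ⟨h1, h2⟩
        rw [h.inj hu hy (h1.trans hTy.symm), h.inj hv hx (h2.trans hTx.symm)] at huv
        exact lt_asymm huv hxy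
      simp only [sw_apply]
      split_ifs <;> omega

theorem len_sw_le (hP : IsPartitionOf n lam) {T : PNode → ℕ} (h : IsTabN n lam T) {r : ℕ}
    (h1 : 1 ≤ r) (h2 : r + 1 ≤ n) : len n lam (sw r T) ≤ len n lam T + 1 := by
  obtain ⟨x, hx, hTx⟩ := h.exists_node h1 (by omega)
  obtain ⟨y, hy, hTy⟩ := h.exists_node (p := r + 1) (by omega) h2
  rcases lt_trichotomy (itab lam x) (itab lam y) with hlt | heq | hgt
  · exact (len_sw hP h hx hy hTx hTy hlt).le
  · rw [itab_injOn hx hy heq] at hTx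
    omega
  · have := len_sw hP (h.sw h1 h2) hy hx (r := r) (by simp [sw_apply, hTy])
      (by simp [sw_apply, hTx]) hgt
    rw [sw_sw] at this
    omega

theorem len_tab_le (hP : IsPartitionOf n lam) {L : List ℕ} (hL : IsWord n L) :
    len n lam (tab lam L) ≤ L.length := by
  induction L with
  | nil => simp [len_iniTab hP]
  | cons r L ih =>
    rw [tab_cons, List.length_cons]
    exact (len_sw_le hP (tab_isTabN hP hL.of_cons) hL.head.1 hL.head.2).trans
      (Nat.add_le_add_right (ih hL.of_cons) 1)

theorem invLen_wordProd (hP : IsPartitionOf n lam) (L : List ℕ) :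
    invLen n (wordProd L) = len n lam (tab lam L) := by
  symm
  refine Finset.card_bij (fun p _ => (itab lam p.1, itab lam p.2)) ?_ ?_ ?_
  · rintro ⟨x, y⟩ hp
    simp only [Finset.mem_filter, Finset.mem_product, mem_diagF hP] at hp ⊢
    obtain ⟨⟨hx, hy⟩, h1, h2⟩ := hp
    simp only [tab, iniTab_of_mem hx, iniTab_of_mem hy] at h2
    exact ⟨⟨Finset.mem_Icc.2 ((itab_isTab hP).mapsTo hx),
      Finset.mem_Icc.2 ((itab_isTab hP).mapsTo hy)⟩, h1, h2⟩
  · rintro ⟨x, y⟩ hp ⟨x', y'⟩ hp' heq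
    simp only [Finset.mem_filter, Finset.mem_product, mem_diagF hP] at hp hp'
    simp only [Prod.mk.injEq] at heq ⊢
    exact ⟨itab_injOn hp.1.1 hp'.1.1 heq.1, itab_injOn hp.1.2 hp'.1.2 heq.2⟩
  · rintro ⟨i, j⟩ hij
    simp only [Finset.mem_filter, Finset.mem_product, Finset.mem_Icc] at hij
    obtain ⟨⟨hi, hj⟩, h1, h2⟩ := hij
    obtain ⟨x, hx, rfl⟩ := (itab_isTab hP).surjOn hi
    obtain ⟨y, hy, rfl⟩ := (itab_isTab hP).surjOn hj
    refine ⟨(x, y), ?_, rfl⟩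
    simp only [Finset.mem_filter, Finset.mem_product, mem_diagF hP]
    refine ⟨⟨hx, hy⟩, h1, ?_⟩
    simpa only [tab, iniTab_of_mem hx, iniTab_of_mem hy] using h2

/-- `r` is a descent of `T`: the node of `r+1` precedes that of `r` in the initial tableau. -/
def Desc (lam : ℕ → ℕ) (T : PNode → ℕ) (r : ℕ) : Prop :=
  ∃ x ∈ diag lam, ∃ y ∈ diag lam, T x = r + 1 ∧ T y = r ∧ itab lam x < itab lam y

theorem Desc.range {T : PNode → ℕ} (h : IsTabN n lam T) {r : ℕ} (hd : Desc lam T r) :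
    1 ≤ r ∧ r + 1 ≤ n := by
  obtain ⟨x, hx, y, hy, h1, h2, -⟩ := hd
  have := h.1.mapsTo hx
  have := h.1.mapsTo hy
  simp only [Set.mem_Icc] at *
  omega

theorem isStdN_sw {T : PNode → ℕ} (h : IsStdN n lam T) {r : ℕ} (h1 : 1 ≤ r) (h2 : r + 1 ≤ n)
    (hr : ∀ a b, (a, b) ∈ diag lam → (a, b + 1) ∈ diag lam → T (a, b) = r →
      T (a, b + 1) = r + 1 → False)
    (hc : ∀ a b, (a, b) ∈ diag lam → (a + 1, b) ∈ diag lam → T (a, b) = r →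
      T (a + 1, b) = r + 1 → False) : IsStdN n lam (sw r T) := by
  have ht := h.isTabN.sw h1 h2
  refine ⟨⟨ht.1, fun a b hab hab' => ?_, fun a b hab hab' => ?_⟩, ht.2⟩
  · have hlt := h.1.2.1 a b hab hab'
    have hn : ¬ (T (a, b) = r ∧ T (a, b + 1) = r + 1) := fun e => hr a b hab hab' e.1 e.2
    simp only [sw_apply]
    split_ifs <;> omega
  · have hlt := h.1.2.2 a b hab hab'
    have hn : ¬ (T (a, b) = r ∧ T (a + 1, b) = r + 1) := fun e => hc a b hab hab' e.1 e.2
    simp only [sw_apply]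
    split_ifs <;> omega

theorem Desc.isStdN_sw {T : PNode → ℕ} (h : IsStdN n lam T) {r : ℕ} (hd : Desc lam T r) :
    IsStdN n lam (sw r T) := by
  obtain ⟨h1, h2⟩ := hd.range h.isTabN
  obtain ⟨x, hx, y, hy, hTx, hTy, hlt⟩ := hd
  rw [itab_lt_iff hx hy] at hlt
  refine SpechtBasis.isStdN_sw h h1 h2 (fun a b hab hab' e1 e2 => ?_)
    fun a b hab hab' e1 e2 => ?_
  all_goals
    obtain rfl := h.isTabN.inj hab hy (e1.trans hTy.symm)
    obtain rfl := h.isTabN.inj hab' hx (e2.trans hTx.symm)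
    simp at hlt

theorem Desc.len_eq (hP : IsPartitionOf n lam) {T : PNode → ℕ} (h : IsTabN n lam T) {r : ℕ}
    (hd : Desc lam T r) : len n lam T = len n lam (sw r T) + 1 := by
  obtain ⟨h1, h2⟩ := hd.range h
  obtain ⟨x, hx, y, hy, hTx, hTy, hlt⟩ := hd
  have := len_sw hP (h.sw h1 h2) hx hy (r := r) (by simp [sw_apply, hTx])
    (by simp [sw_apply, hTy]) hlt
  rwa [sw_sw] at this

/-- `L` is a reduced word of the standard tableau `T`, all of whose suffixes give standard
tableaux. -/
inductive Red (n : ℕ) (lam : ℕ → ℕ) : List ℕ → (PNode → ℕ) → Prop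
  | nil : Red n lam [] (iniTab lam)
  | cons {r : ℕ} {L : List ℕ} {T : PNode → ℕ} (hT : IsStdN n lam T) (hd : Desc lam T r)
      (h : Red n lam L (sw r T)) : Red n lam (r :: L) T

theorem Red.isStdN (hP : IsPartitionOf n lam) {L : List ℕ} {T : PNode → ℕ}
    (h : Red n lam L T) : IsStdN n lam T := by
  cases h with
  | nil => exact iniTab_isStdN hP
  | cons hT hd h => exact hT

theorem Red.len_eq (hP : IsPartitionOf n lam) {L : List ℕ} {T : PNode → ℕ}
    (h : Red n lam L T) : len n lam T = L.length := by
  induction h with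
  | nil => simp [len_iniTab hP]
  | cons hT hd h ih => rw [hd.len_eq hP hT.isTabN, ih, List.length_cons]

theorem Red.isWord {L : List ℕ} {T : PNode → ℕ}
    (h : Red n lam L T) : IsWord n L := by
  induction h with
  | nil => intro i hi; simp at hi
  | cons hT hd h ih => exact ih.cons (hd.range hT.isTabN).1 (hd.range hT.isTabN).2

theorem Red.eq_tab {L : List ℕ} {T : PNode → ℕ} (h : Red n lam L T) : T = tab lam L := by
  induction h with
  | nil => rfl
  | cons hT hd h ih => rw [tab_cons, ← ih, sw_sw]

theorem red_of_len (hP : IsPartitionOf n lam) {L : List ℕ} (hL : IsWord n L)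
    (hs : IsStdN n lam (tab lam L)) (hlen : len n lam (tab lam L) = L.length) :
    Red n lam L (tab lam L) := by
  induction L with
  | nil => exact Red.nil
  | cons r L ih =>
    have ht := tab_isTabN hP hL.of_cons
    obtain ⟨h1, h2⟩ := hL.head
    obtain ⟨x, hx, hTx⟩ := ht.exists_node h1 (by omega)
    obtain ⟨y, hy, hTy⟩ := ht.exists_node (p := r + 1) (by omega) h2
    have hsw : sw r (tab lam (r :: L)) = tab lam L := by rw [tab_cons, sw_sw]
    have hle := len_tab_le hP hL.of_cons
    rcases lt_trichotomy (itab lam x) (itab lam y) with hlt | heq | hgt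
    · have hl := len_sw hP ht hx hy hTx hTy hlt
      rw [← tab_cons, hlen, List.length_cons] at hl
      have hd : Desc lam (tab lam (r :: L)) r :=
        ⟨x, hx, y, hy, by simp [tab_cons, sw_apply, hTx], by simp [tab_cons, sw_apply, hTy], hlt⟩
      refine Red.cons hs hd ?_
      have hs' := hd.isStdN_sw hs
      rw [hsw] at hs' ⊢
      exact ih hL.of_cons hs' (by omega)
    · rw [itab_injOn hx hy heq] at hTx
      omega
    · have hl := len_sw hP (tab_isTabN hP hL) hy hx (r := r) (by simp [tab_cons, sw_apply, hTy])
        (by simp [tab_cons, sw_apply, hTx]) hgt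
      rw [hsw, hlen, List.length_cons] at hl
      omega

theorem wordProd_zero {L : List ℕ} (hL : IsWord n L) : wordProd L 0 = 0 := by
  induction L with
  | nil => rfl
  | cons r L ih =>
    have : wordProd (r :: L) 0 = sgen r (wordProd L 0) := by simp [wordProd]
    rw [this, ih hL.of_cons, sgen_apply, if_neg (by have := hL.head; omega), if_neg (by omega)]

theorem eq_tab_of_redWordFor {T : PNode → ℕ} (hT : ∀ x, x ∉ diag lam → T x = 0) {L : List ℕ}
    (h : RedWordFor n lam T L) : T = tab lam L := by
  funext x
  by_cases hx : x ∈ diag lam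
  · rw [tab, iniTab_of_mem hx, h.2.1 x hx]
  · rw [hT x hx, tab, iniTab, if_neg hx, wordProd_zero h.1]

theorem red_of_redWordFor (hP : IsPartitionOf n lam) {T : PNode → ℕ} (hT : IsStdN n lam T)
    {L : List ℕ} (h : RedWordFor n lam T L) : Red n lam L T := by
  have heq := eq_tab_of_redWordFor hT.2 h
  have := red_of_len hP h.1 (heq ▸ hT) (by rw [← invLen_wordProd hP, h.2.2])
  rwa [← heq] at this

/-- The diagonal (shifted by the charge) of a node. -/
def dgn (κ : ℤ) (x : PNode) : ℤ := κ + (x.2 : ℤ) - (x.1 : ℤ)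

theorem res_eq (x : PNode) : res κ x = (dgn κ x).natAbs := rfl

theorem std_le_row (hP : IsPartitionOf n lam) {T : PNode → ℕ} (h : IsStdN n lam T) {a b c : ℕ}
    (hb : 1 ≤ b) (hbc : b ≤ c) (hc : (a, c) ∈ diag lam) : T (a, b) ≤ T (a, c) := by
  induction c, hbc using Nat.le_induction with
  | base => exact le_rfl
  | succ c hc' ih =>
    have hm : (a, c) ∈ diag lam := diag_of_le hP hc hc.1 (hb.trans hc') le_rfl (Nat.le_succ c)
    exact (ih hm).trans (h.1.2.1 a c hm hc).le

theorem std_le_col (hP : IsPartitionOf n lam) {T : PNode → ℕ} (h : IsStdN n lam T) {a b c : ℕ}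
    (hb : 1 ≤ b) (hbc : b ≤ c) (hc : (c, a) ∈ diag lam) : T (b, a) ≤ T (c, a) := by
  induction c, hbc using Nat.le_induction with
  | base => exact le_rfl
  | succ c hc' ih =>
    have hm : (c, a) ∈ diag lam := diag_of_le hP hc (hb.trans hc') hc.2.1 (Nat.le_succ c) le_rfl
    exact (ih hm).trans (h.1.2.2 c a hm hc).le

theorem std_le (hP : IsPartitionOf n lam) {T : PNode → ℕ} (h : IsStdN n lam T) {x y : PNode}
    (hx : x ∈ diag lam) (hy : y ∈ diag lam) (h1 : x.1 ≤ y.1) (h2 : x.2 ≤ y.2) : T x ≤ T y :=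
  (std_le_row hP h hx.2.1 h2 (diag_of_le hP hy hx.1 hy.2.1 h1 le_rfl)).trans
    (std_le_col hP h hx.1 h1 hy)

theorem std_lt (hP : IsPartitionOf n lam) {T : PNode → ℕ} (h : IsStdN n lam T) {x y : PNode}
    (hx : x ∈ diag lam) (hy : y ∈ diag lam) (h1 : x.1 ≤ y.1) (h2 : x.2 ≤ y.2) (hne : x ≠ y) :
    T x < T y :=
  (std_le hP h hx hy h1 h2).lt_of_ne fun he => hne (h.isTabN.inj hx hy he)

theorem le_of_dgn_close (hP : IsPartitionOf n lam) {T : PNode → ℕ} (h : IsStdN n lam T)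
    {x y : PNode} (hx : x ∈ diag lam) (hy : y ∈ diag lam) (hT : T x < T y)
    (h1 : dgn κ x ≤ dgn κ y + 1) (h2 : dgn κ y ≤ dgn κ x + 1) : x.1 ≤ y.1 ∧ x.2 ≤ y.2 := by
  by_contra hc
  have : y.1 ≤ x.1 ∧ y.2 ≤ x.2 := by
    unfold dgn at h1 h2
    omega
  have := std_le hP h hy hx this.1 this.2
  omega

theorem dgn_ne_of_succ (hP : IsPartitionOf n lam) {T : PNode → ℕ} (h : IsStdN n lam T)
    {x y : PNode} (hx : x ∈ diag lam) (hy : y ∈ diag lam) (hT : T x < T y) (hT' : T y ≤ T x + 2) :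
    dgn κ x ≠ dgn κ y := by
  intro he
  obtain ⟨h1, h2⟩ := le_of_dgn_close (κ := κ) hP h hx hy hT (by omega) (by omega)
  have hne : x.1 ≠ y.1 := by
    intro h3
    have : x.2 = y.2 := by unfold dgn at he; omega
    rw [Prod.ext h3 this] at hT
    exact lt_irrefl _ hT
  have h3 : x.1 + 1 ≤ y.1 := by omega
  have h4 : x.2 + 1 ≤ y.2 := by unfold dgn at he; omega
  have hx1 := hx.1
  have hx2 := hx.2.1
  have ha : (x.1, x.2 + 1) ∈ diag lam := diag_of_le hP hy hx.1 (by simp) h1 h4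
  have hb : (x.1 + 1, x.2) ∈ diag lam := diag_of_le hP hy (by simp) hx.2.1 h3 h2
  have hd : (x.1 + 1, x.2 + 1) ∈ diag lam := diag_of_le hP hy (by simp) (by simp) h3 h4
  have e1 := h.1.2.1 x.1 x.2 hx ha
  have e2 := h.1.2.2 x.1 x.2 hx hb
  have e3 := h.1.2.2 x.1 (x.2 + 1) ha hd
  have e4 := h.1.2.1 (x.1 + 1) x.2 hb hd
  have e5 : T (x.1, x.2 + 1) ≠ T (x.1 + 1, x.2) := fun e => by
    simpa using h.isTabN.inj ha hb e
  have e6 := std_le hP h hd hy h3 h4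
  simp only [Prod.mk.eta] at e1 e2
  omega

theorem adj_of_dgn (hP : IsPartitionOf n lam) {T : PNode → ℕ} (h : IsStdN n lam T)
    {x y : PNode} (hx : x ∈ diag lam) (hy : y ∈ diag lam) (hT : T y = T x + 1)
    (h1 : dgn κ x ≤ dgn κ y + 1) (h2 : dgn κ y ≤ dgn κ x + 1) :
    (y = (x.1, x.2 + 1) ∧ dgn κ y = dgn κ x + 1) ∨
      (y = (x.1 + 1, x.2) ∧ dgn κ y = dgn κ x - 1) := by
  have hne := dgn_ne_of_succ (κ := κ) hP h hx hy (by omega) (by omega)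
  obtain ⟨h3, h4⟩ := le_of_dgn_close hP h hx hy (by omega) h1 h2
  have hx1 := hx.1
  have hx2 := hx.2.1
  rcases (by omega : dgn κ y = dgn κ x + 1 ∨ dgn κ y = dgn κ x - 1) with hd | hd
  · left
    refine ⟨?_, hd⟩
    have h5 : x.2 + 1 ≤ y.2 := by unfold dgn at hd; omega
    have ha : (x.1, x.2 + 1) ∈ diag lam := diag_of_le hP hy hx.1 (by simp) h3 h5
    have e1 := h.1.2.1 x.1 x.2 hx ha
    have e2 := std_le hP h ha hy h3 h5
    simp only [Prod.mk.eta] at e1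
    exact h.isTabN.inj hy ha (by omega)
  · right
    refine ⟨?_, hd⟩
    have h5 : x.1 + 1 ≤ y.1 := by unfold dgn at hd; omega
    have ha : (x.1 + 1, x.2) ∈ diag lam := diag_of_le hP hy (by simp) hx.2.1 h5 h4
    have e1 := h.1.2.2 x.1 x.2 hx ha
    have e2 := std_le hP h ha hy h5 h4
    simp only [Prod.mk.eta] at e1
    exact h.isTabN.inj hy ha (by omega)

theorem isStdN_sw_of_dgn {T : PNode → ℕ} (h : IsStdN n lam T)
    {x y : PNode} (hx : x ∈ diag lam) (hy : y ∈ diag lam) {r : ℕ} (hTx : T x = r)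
    (hTy : T y = r + 1) (h1 : dgn κ y ≠ dgn κ x + 1) (h2 : dgn κ y ≠ dgn κ x - 1) :
    IsStdN n lam (sw r T) := by
  have hx1 := h.1.1.mapsTo hx
  have hy1 := h.1.1.mapsTo hy
  simp only [Set.mem_Icc] at hx1 hy1
  refine isStdN_sw h (by omega) (by omega) (fun a b hab hab' e1 e2 => ?_)
    fun a b hab hab' e1 e2 => ?_
  · obtain rfl := h.isTabN.inj hab hx (e1.trans hTx.symm)
    obtain rfl := h.isTabN.inj hab' hy (e2.trans hTy.symm)
    exact h1 (by simp only [dgn]; push_cast; ring)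
  · obtain rfl := h.isTabN.inj hab hx (e1.trans hTx.symm)
    obtain rfl := h.isTabN.inj hab' hy (e2.trans hTy.symm)
    exact h2 (by simp only [dgn]; push_cast; ring)

/-- `μ` is the residue sequence of `T`. -/
def IsRes (κ : ℤ) (lam : ℕ → ℕ) (μ : Fin n → ℕ) (T : PNode → ℕ) : Prop :=
  ∀ x ∈ diag lam, seqAt μ (T x) = res κ x

theorem seqAt_swapAt (μ : Fin n → ℕ) {r : ℕ} (h1 : 1 ≤ r) (h2 : r + 1 ≤ n) (p : ℕ) :
    seqAt (swapAt μ r) p = seqAt μ (sgen r p) := by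
  rw [sgen_apply]
  by_cases hp : 1 ≤ p ∧ p ≤ n
  · rw [seqAt, dif_pos hp, swapAt]
    simp only
    by_cases e1 : p = r
    · rw [if_pos (by omega), if_pos e1]
    · rw [if_neg (by omega), if_neg e1]
      by_cases e2 : p = r + 1
      · rw [if_pos (by omega), if_pos e2]
      · rw [if_neg (by omega), if_neg e2, seqAt, dif_pos hp]
  · rw [if_neg (by omega), if_neg (by omega), seqAt, seqAt, dif_neg hp, dif_neg hp]

theorem seq_ext {μ μ' : Fin n → ℕ} (h : ∀ p, 1 ≤ p → p ≤ n → seqAt μ p = seqAt μ' p) :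
    μ = μ' := by
  funext i
  have := h (i + 1) (by omega) (by omega)
  simpa [seqAt, Nat.succ_le_iff] using this

theorem swapAt_swapAt (μ : Fin n → ℕ) {r : ℕ} (h1 : 1 ≤ r) (h2 : r + 1 ≤ n) :
    swapAt (swapAt μ r) r = μ := by
  refine seq_ext fun p _ _ => ?_
  rw [seqAt_swapAt _ h1 h2, seqAt_swapAt _ h1 h2]
  simp [sgen]

theorem isRes_sw {μ : Fin n → ℕ} {T : PNode → ℕ} {r : ℕ} (h1 : 1 ≤ r) (h2 : r + 1 ≤ n) :
    IsRes κ lam μ (sw r T) ↔ IsRes κ lam (swapAt μ r) T := by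
  simp only [IsRes, seqAt_swapAt μ h1 h2, sw]

theorem IsRes.swapAt {μ : Fin n → ℕ} {T : PNode → ℕ} {r : ℕ} (h1 : 1 ≤ r) (h2 : r + 1 ≤ n)
    (h : IsRes κ lam μ T) : IsRes κ lam (swapAt μ r) (sw r T) := by
  rw [isRes_sw h1 h2, swapAt_swapAt μ h1 h2]
  exact h

theorem IsRes.unique {μ μ' : Fin n → ℕ} {T : PNode → ℕ} (hT : IsTabN n lam T)
    (h : IsRes κ lam μ T) (h' : IsRes κ lam μ' T) : μ = μ' := by
  refine seq_ext fun p h1 h2 => ?_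
  obtain ⟨x, hx, rfl⟩ := hT.exists_node h1 h2
  rw [h x hx, h' x hx]

theorem isRes_iniTab {μ : Fin n → ℕ} :
    IsRes κ lam μ (iniTab lam) ↔ ∀ x ∈ diag lam, seqAt μ (itab lam x) = res κ x :=
  forall₂_congr fun x hx => by rw [iniTab_of_mem hx]

theorem mem_cls_self (ν₀ : Fin n → ℕ) : ν₀ ∈ cls ν₀ :=
  Finset.mem_image.2 ⟨1, Finset.mem_univ _, rfl⟩

theorem swapAt_eq (μ : Fin n → ℕ) {r : ℕ} (h1 : 1 ≤ r) (h2 : r + 1 ≤ n) :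
    swapAt μ r = μ ∘ Equiv.swap (⟨r - 1, by omega⟩ : Fin n) ⟨r, by omega⟩ := by
  funext i
  simp only [swapAt, Function.comp, Equiv.swap_apply_def, Fin.ext_iff]
  by_cases e1 : (i : ℕ) + 1 = r
  · rw [if_pos e1, if_pos (by omega : (i : ℕ) = r - 1), seqAt, dif_pos ⟨by omega, h2⟩]
    rfl
  · rw [if_neg e1, if_neg (by omega : ¬ (i : ℕ) = r - 1)]
    by_cases e2 : (i : ℕ) = r
    · simp [e2, seqAt, h1, (by omega : r ≤ n)]
    · simp [e2]

theorem swapAt_mem_cls {ν₀ μ : Fin n → ℕ} (h : μ ∈ cls ν₀) {r : ℕ} (h1 : 1 ≤ r)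
    (h2 : r + 1 ≤ n) : swapAt μ r ∈ cls ν₀ := by
  obtain ⟨σ, -, rfl⟩ := Finset.mem_image.1 h
  rw [swapAt_eq _ h1 h2]
  exact Finset.mem_image.2 ⟨(Equiv.swap (⟨r - 1, by omega⟩ : Fin n) ⟨r, by omega⟩).trans σ,
    Finset.mem_univ _, rfl⟩

theorem exists_isRes_tab {ν₀ : Fin n → ℕ} (h0 : IsRes κ lam ν₀ (iniTab lam)) {L : List ℕ}
    (hL : IsWord n L) : ∃ μ ∈ cls ν₀, IsRes κ lam μ (tab lam L) := by
  induction L with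
  | nil => exact ⟨ν₀, mem_cls_self ν₀, h0⟩
  | cons r L ih =>
    obtain ⟨μ, h1, h2⟩ := ih hL.of_cons
    rw [tab_cons]
    exact ⟨swapAt μ r, swapAt_mem_cls h1 hL.head.1 hL.head.2, h2.swapAt hL.head.1 hL.head.2⟩

/-- A tableau is determined by the relative order of its entries. -/
theorem IsTabN.ext_of_lt (hP : IsPartitionOf n lam) {T U : PNode → ℕ} (hT : IsTabN n lam T)
    (hU : IsTabN n lam U)
    (h : ∀ x ∈ diag lam, ∀ y ∈ diag lam, T y ≤ T x ↔ U y ≤ U x) : T = U := by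
  have key : ∀ {V : PNode → ℕ}, IsTabN n lam V → ∀ x ∈ diag lam,
      V x = ((diagF n lam).filter fun y => V y ≤ V x).card := by
    intro V hV x hx
    have : ((diagF n lam).filter fun y => V y ≤ V x).image V = Finset.Icc 1 (V x) := by
      ext p
      simp only [Finset.mem_image, Finset.mem_filter, Finset.mem_Icc, mem_diagF hP]
      constructor
      · rintro ⟨y, ⟨hy, hle⟩, rfl⟩
        exact ⟨(hV.1.mapsTo hy).1, hle⟩
      · rintro ⟨h1, h2⟩
        obtain ⟨y, hy, rfl⟩ := hV.exists_node h1 (h2.trans (hV.1.mapsTo hx).2)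
        exact ⟨y, ⟨hy, h2⟩, rfl⟩
    rw [← Finset.card_image_of_injOn (f := V), this, Nat.card_Icc]
    · omega
    · intro y hy z hz hyz
      simp only [Finset.coe_filter, Set.mem_ofPred_eq, mem_diagF hP] at hy hz
      exact hV.inj hy.1 hz.1 hyz
  funext x
  by_cases hx : x ∈ diag lam
  · rw [key hT x hx, key hU x hx]
    congr 1
    refine Finset.filter_congr fun y hy => h x hx y ((mem_diagF hP).1 hy)
  · rw [hT.2 x hx, hU.2 x hx]

end Tableaux

section Garnir

variable {n : ℕ} {lam : ℕ → ℕ} {κ : ℤ}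

theorem IsTabN.eq_of_rel {T U : PNode → ℕ} (hP : IsPartitionOf n lam) (hT : IsTabN n lam T)
    (hU : IsTabN n lam U) (R : PNode → PNode → Prop)
    (hR : ∀ x ∈ diag lam, ∀ y ∈ diag lam, x ≠ y → R x y ∨ R y x)
    (hRT : ∀ x ∈ diag lam, ∀ y ∈ diag lam, R x y → T x < T y)
    (hRU : ∀ x ∈ diag lam, ∀ y ∈ diag lam, R x y → U x < U y) : T = U := by
  refine hT.ext_of_lt hP hU fun x hx y hy => ?_
  rcases eq_or_ne x y with rfl | hne
  · simp
  · rcases hR x hx y hy hne with h | h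
    · have h1 := hRT x hx y hy h
      have h2 := hRU x hx y hy h
      omega
    · have h1 := hRT y hy x hx h
      have h2 := hRU y hy x hx h
      omega

theorem wordProd_cons (r : ℕ) (L : List ℕ) (p : ℕ) :
    wordProd (r :: L) p = sgen r (wordProd L p) := by simp [wordProd]

theorem wordProd_append (L L' : List ℕ) (p : ℕ) :
    wordProd (L ++ L') p = wordProd L (wordProd L' p) := by simp [wordProd]

theorem wordProd_block (q a p : ℕ) :
    wordProd ((List.range a).map fun i => q + i) p =
      if p = q + a then q else if q ≤ p ∧ p < q + a then p + 1 else p := by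
  induction a generalizing p with
  | zero =>
    simp only [List.range_zero, List.map_nil, wordProd, List.prod_nil, Equiv.Perm.coe_one, id]
    split_ifs <;> omega
  | succ a ih =>
    rw [List.range_succ, List.map_append, wordProd_append, List.map_singleton, wordProd_cons, ih]
    simp only [wordProd, List.map_nil, List.prod_nil, Equiv.Perm.coe_one, id, sgen_apply]
    split_ifs <;> omega

theorem wordW_succ (a b : ℕ) :
    wordW a (b + 1) = (List.range a).map (fun i => b + 1 + i) ++ wordW a b := by
  rw [wordW, wordW, List.range_succ_eq_map, List.flatMap_cons, List.flatMap_map]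
  simp

theorem length_wordW (a b : ℕ) : (wordW a b).length = a * b := by
  induction b with
  | zero => simp [wordW]
  | succ b ih => rw [wordW_succ, List.length_append, ih]; simp; ring

theorem mem_wordW {a b i : ℕ} (h : i ∈ wordW a b) : 1 ≤ i ∧ i + 1 ≤ a + b := by
  simp only [wordW, List.mem_flatMap, List.mem_map, List.mem_range] at h
  obtain ⟨m, hm, j, hj, rfl⟩ := h
  omega

theorem wordProd_shift (off a b p : ℕ) :
    wordProd ((wordW a b).map fun i => off + i) p =
      if off < p ∧ p ≤ off + a then p + b
      else if off + a < p ∧ p ≤ off + a + b then p - a else p := by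
  induction b generalizing p with
  | zero =>
    simp only [wordW, List.range_zero, List.flatMap_nil, List.map_nil, wordProd, List.prod_nil,
      Equiv.Perm.coe_one, id]
    split_ifs <;> omega
  | succ b ih =>
    rw [wordW_succ, List.map_append, wordProd_append, ih, List.map_map]
    have : ((fun i => off + i) ∘ fun i => b + 1 + i) = fun i => (off + b + 1) + i := by
      funext i
      simp only [Function.comp]
      omega
    rw [this, wordProd_block]
    split_ifs <;> omega

/-- The number of boxes before the Garnir belt of `(r, c)`. -/
def goff (lam : ℕ → ℕ) (r c : ℕ) : ℕ := (∑ r' ∈ Finset.Ico 1 r, lam r') + (c - 1)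

theorem garnirWord_eq (lam : ℕ → ℕ) (r c : ℕ) :
    garnirWord lam r c = (wordW (lam r - c + 1) c).map fun i => goff lam r c + i := rfl

theorem garnir_pos {r c : ℕ} (h : IsGarnir lam r c) : 1 ≤ c := h.1.2.1

theorem garnir_le {r c : ℕ} (h : IsGarnir lam r c) : c ≤ lam r := h.1.2.2

theorem itab_garnir_node {r c : ℕ} (hc : 1 ≤ c) : itab lam (r, c) = goff lam r c + 1 := by
  simp only [itab, goff]
  omega

theorem itab_garnir_below {r c d : ℕ} (h : IsGarnir lam r c) :
    itab lam (r + 1, d) = goff lam r c + (lam r - c + 1) + d := by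
  have h1 : 1 ≤ r := h.1.1
  have h2 := garnir_pos h
  have h3 := garnir_le h
  simp only [itab, goff, Finset.sum_Ico_succ_top h1]
  omega

theorem itab_garnir_last {r c : ℕ} (h : IsGarnir lam r c) :
    itab lam (r, lam r) = goff lam r c + (lam r - c + 1) := by
  have h2 := garnir_pos h
  have h3 := garnir_le h
  simp only [itab, goff]
  omega

theorem garnir_last_mem {r c : ℕ} (h : IsGarnir lam r c) : (r, lam r) ∈ diag lam :=
  ⟨h.1.1, (garnir_pos h).trans (garnir_le h), le_rfl⟩

theorem garnir_row {r c : ℕ} (h : IsGarnir lam r c) {z : PNode} (hz : z ∈ diag lam)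
    (h1 : goff lam r c < itab lam z) (h2 : itab lam z ≤ goff lam r c + (lam r - c + 1)) :
    z.1 = r ∧ c ≤ z.2 := by
  rw [← itab_garnir_last h] at h2
  have h3 := (itab_lt_iff (garnir_last_mem h) hz).not.1 (not_lt.2 h2)
  have h4 := (itab_lt_iff hz h.1).not.1 (by rw [itab_garnir_node (garnir_pos h)]; omega)
  simp only at h3 h4
  omega

theorem garnir_row_below {r c : ℕ} (h : IsGarnir lam r c) {z : PNode} (hz : z ∈ diag lam)
    (h1 : goff lam r c + (lam r - c + 1) < itab lam z)
    (h2 : itab lam z ≤ goff lam r c + (lam r - c + 1) + c) :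
    z.1 = r + 1 ∧ z.2 ≤ c := by
  rw [← itab_garnir_below h] at h2
  rw [← itab_garnir_last h] at h1
  have h3 := (itab_lt_iff h.2 hz).not.1 (not_lt.2 h2)
  have h4 := (itab_lt_iff (garnir_last_mem h) hz).1 h1
  simp only at h3 h4
  have h5 := hz.2.2
  rcases h4 with h4 | ⟨h4, h6⟩
  · omega
  · rw [← h4] at h5
    omega

theorem garnirWord_isWord (hP : IsPartitionOf n lam) {r c : ℕ} (h : IsGarnir lam r c) :
    IsWord n (garnirWord lam r c) := by
  intro i hi
  rw [garnirWord_eq, List.mem_map] at hi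
  obtain ⟨j, hj, rfl⟩ := hi
  have h1 := mem_wordW hj
  have h2 := ((itab_isTab hP).mapsTo h.2).2
  rw [itab_garnir_below h] at h2
  omega

theorem tab_garnirWord (r c : ℕ) {x : PNode} (hx : x ∈ diag lam) :
    tab lam (garnirWord lam r c) x =
      if goff lam r c < itab lam x ∧ itab lam x ≤ goff lam r c + (lam r - c + 1)
      then itab lam x + c
      else if goff lam r c + (lam r - c + 1) < itab lam x ∧
        itab lam x ≤ goff lam r c + (lam r - c + 1) + c
      then itab lam x - (lam r - c + 1) else itab lam x := by
  rw [tab, iniTab_of_mem hx, garnirWord_eq, wordProd_shift]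

theorem garnirWord_cons {r c : ℕ} (hc : 1 ≤ c) :
    garnirWord lam r c = (goff lam r c + c) :: (garnirWord lam r c).tail := by
  obtain ⟨b, rfl⟩ := Nat.exists_eq_add_of_le' hc
  rw [garnirWord_eq, wordW_succ, List.range_succ_eq_map]
  simp

theorem le_len_tab_garnirWord (hP : IsPartitionOf n lam) {r c : ℕ} (h : IsGarnir lam r c) :
    (lam r - c + 1) * c ≤ len n lam (tab lam (garnirWord lam r c)) := by
  have h3 := garnir_le h
  have : (lam r - c + 1) * c = (Finset.Ico c (lam r + 1) ×ˢ Finset.Icc 1 c).card := by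
    rw [Finset.card_product, Nat.card_Ico, Nat.card_Icc, Nat.sub_add_comm h3]
    simp
  rw [this]
  refine Finset.card_le_card_of_injOn (fun p => ((r, p.1), (r + 1, p.2))) ?_ ?_
  · rintro ⟨i, j⟩ hij
    simp only [Finset.coe_product, Set.mem_prod, Finset.coe_Ico, Set.mem_Ico, Finset.coe_Icc,
      Set.mem_Icc] at hij
    have hc := garnir_pos h
    have hx : (r, i) ∈ diag lam := ⟨h.1.1, by omega, by simp only; omega⟩
    have hy : (r + 1, j) ∈ diag lam := ⟨by simp, hij.2.1, hij.2.2.trans h.2.2.2⟩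
    simp only [Finset.coe_filter, Finset.mem_product, mem_diagF hP, Set.mem_ofPred_eq]
    refine ⟨⟨hx, hy⟩, itab_lt _ _ hx hy (Or.inl (Nat.lt_succ_self r)), ?_⟩
    rw [tab_garnirWord r c hx, tab_garnirWord r c hy, itab_garnir_below h]
    have : itab lam (r, i) = goff lam r c + 1 + (i - c) := by
      simp only [itab, goff]
      omega
    rw [this]
    split_ifs <;> omega
  · rintro ⟨i, j⟩ _ ⟨i', j'⟩ _ heq
    simp only [Prod.mk.injEq, true_and] at heq ⊢
    exact heq

theorem len_garnir_tail (hP : IsPartitionOf n lam) {r c : ℕ} (h : IsGarnir lam r c) :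
    len n lam (tab lam (garnirWord lam r c).tail) = (garnirWord lam r c).tail.length := by
  have hw := garnirWord_isWord hP h
  have h1 := le_len_tab_garnirWord hP h
  have h4 : (garnirWord lam r c).length = (lam r - c + 1) * c := by
    rw [garnirWord_eq, List.length_map, length_wordW]
  rw [← h4] at h1
  rw [garnirWord_cons (lam := lam) (r := r) (garnir_pos h)] at hw h1
  rw [tab_cons] at h1
  have h2 := len_sw_le hP (tab_isTabN hP hw.of_cons) hw.head.1 hw.head.2
  have h3 := len_tab_le hP hw.of_cons
  rw [List.length_cons] at h1
  omega

theorem itab_lt_of_no_desc {T : PNode → ℕ} (hT : IsTabN n lam T) {p q : ℕ}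
    (hd : ∀ i, p ≤ i → i < q → ¬ Desc lam T i) {x y : PNode} (hx : x ∈ diag lam)
    (hy : y ∈ diag lam) (h1 : p ≤ T x) (h2 : T x < T y) (h3 : T y ≤ q) :
    itab lam x < itab lam y := by
  obtain ⟨m, hm⟩ : ∃ m, T y = m := ⟨_, rfl⟩
  rw [hm] at h2 h3
  induction m, (h2 : T x + 1 ≤ m) using Nat.le_induction generalizing y with
  | base =>
    by_contra hc
    refine hd (T x) h1 (by omega) ⟨y, hy, x, hx, hm, rfl, ?_⟩
    refine (not_lt.1 hc).lt_of_ne fun he => ?_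
    rw [itab_injOn hy hx he] at hm
    omega
  | succ m hxm ih =>
    have hyn := (hT.1.mapsTo hy).2
    obtain ⟨z, hz, hTz⟩ := hT.exists_node (p := m) (by omega) (by omega)
    refine (ih hz (by omega) hTz).trans ?_
    by_contra hc
    refine hd m (by omega) (by omega) ⟨y, hy, z, hz, hm, hTz, ?_⟩
    refine (not_lt.1 hc).lt_of_ne fun he => ?_
    rw [itab_injOn hy hz he] at hm
    omega

/-- The block of the predecessor of a Garnir tableau containing the node with initial entry `p`. -/
def garnirKey (off l c p : ℕ) : ℕ :=
  if p = off + 1 then 1 else if p = off + l + c then 2 else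
    if p ≤ off ∨ (off + l < p ∧ p < off + l + c) then 0 else 3

/-- The entries of the predecessor of a Garnir tableau. -/
def garnirVal (off l c p : ℕ) : ℕ :=
  if p = off + 1 then off + c else if p = off + l + c then off + c + 1 else
    if p ≤ off then p else if p ≤ off + l then p + c else if p < off + l + c then p - l else p

theorem garnir_zone {off l c : ℕ} (hl : 1 ≤ l) (hc : 1 ≤ c) (p : ℕ) :
    p = off + 1 ∧ garnirKey off l c p = 1 ∧ garnirVal off l c p = off + c ∨
    p = off + l + c ∧ garnirKey off l c p = 2 ∧ garnirVal off l c p = off + c + 1 ∨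
    p ≤ off ∧ garnirKey off l c p = 0 ∧ garnirVal off l c p = p ∨
    (off + 1 < p ∧ p ≤ off + l) ∧ garnirKey off l c p = 3 ∧ garnirVal off l c p = p + c ∨
    (off + l < p ∧ p < off + l + c) ∧ garnirKey off l c p = 0 ∧ garnirVal off l c p = p - l ∨
    off + l + c < p ∧ garnirKey off l c p = 3 ∧ garnirVal off l c p = p := by
  unfold garnirKey garnirVal
  split_ifs <;> omega

theorem garnirVal_lt {off l c : ℕ} (hl : 1 ≤ l) (hc : 1 ≤ c) {p q : ℕ}
    (h : garnirKey off l c p < garnirKey off l c q ∨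
      garnirKey off l c p = garnirKey off l c q ∧ p < q) :
    garnirVal off l c p < garnirVal off l c q := by
  have h1 := garnir_zone (off := off) hl hc p
  have h2 := garnir_zone (off := off) hl hc q
  omega

/-- A standard tableau all of whose descents touch a vertical domino `{A, B}` in a way that
prevents braiding is the predecessor of the Garnir tableau of `A`. -/
theorem eq_garnir_pred (hP : IsPartitionOf n lam) {T : PNode → ℕ} (hT : IsStdN n lam T)
    {a c r : ℕ} (hg : IsGarnir lam a c) (hA : T (a, c) = r) (hB : T (a + 1, c) = r + 1)
    (hdesc : ∀ i, Desc lam T i →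
      (i + 1 = r ∧ ∀ C ∈ diag lam, T C = i → itab lam C < itab lam (a + 1, c)) ∨
      (i = r + 1 ∧ ∀ C ∈ diag lam, T C = i + 1 → itab lam (a, c) < itab lam C)) :
    T = tab lam (garnirWord lam a c).tail ∧ r = goff lam a c + c := by
  have hw := garnirWord_isWord hP hg
  have hcons := garnirWord_cons (lam := lam) (r := a) (garnir_pos hg)
  have hw' := hw
  rw [hcons] at hw'
  set off := goff lam a c with hoff
  set l := lam a - c + 1 with hl
  have hc := garnir_pos hg
  have hl1 : 1 ≤ l := by omega
  have hA' : itab lam (a, c) = off + 1 := itab_garnir_node hc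
  have hB' : itab lam (a + 1, c) = off + l + c := itab_garnir_below hg
  have hTN := hT.isTabN
  have hU : ∀ x ∈ diag lam, tab lam (garnirWord lam a c).tail x =
      sgen (off + c) (tab lam (garnirWord lam a c) x) := by
    intro x _
    conv_rhs => rw [hcons, tab_cons]
    simp [sw, sgen]
  have hrange : ∀ x ∈ diag lam, 1 ≤ T x ∧ T x ≤ n := fun x hx => hTN.1.mapsTo hx
  have hr1 := hrange _ hg.1
  have hr2 := hrange _ hg.2
  rw [hA] at hr1
  rw [hB] at hr2
  have low : ∀ x ∈ diag lam, ∀ y ∈ diag lam, T x < T y → T y < r →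
      itab lam x < itab lam y := fun x hx y hy h1 h2 =>
    itab_lt_of_no_desc hTN (p := 1) (q := r - 1) (fun i _ hi hd => by
      rcases hdesc i hd with h | h <;> omega) hx hy (hrange x hx).1 h1 (by omega)
  have high : ∀ x ∈ diag lam, ∀ y ∈ diag lam, T x < T y → r + 1 < T x →
      itab lam x < itab lam y := fun x hx y hy h1 h2 =>
    itab_lt_of_no_desc hTN (p := r + 2) (q := n) (fun i hi _ hd => by
      rcases hdesc i hd with h | h <;> omega) hx hy h2 h1 (hrange y hy).2
  have nA : ∀ x ∈ diag lam, T x = r → itab lam x = off + 1 := fun x hx h => by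
    rw [hTN.inj hx hg.1 (h.trans hA.symm), hA']
  have nB : ∀ x ∈ diag lam, T x = r + 1 → itab lam x = off + l + c := fun x hx h => by
    rw [hTN.inj hx hg.2 (h.trans hB.symm), hB']
  have c0 : ∀ x ∈ diag lam, itab lam x ≤ off → T x < r := by
    intro x hx hxo
    by_contra hlt
    have h1 := nA x hx
    have h2 := nB x hx
    have hx' := hrange x hx
    obtain ⟨z, hz, hTz⟩ := hTN.exists_node (p := r + 2) (by omega) (by omega)
    have hzx : itab lam z ≤ itab lam x := by
      rcases eq_or_ne z x with rfl | hne
      · exact le_rfl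
      · refine (high z hz x hx ?_ (by omega)).le
        have : T z ≠ T x := fun h => hne (hTN.inj hz hx h)
        omega
    have hd : Desc lam T (r + 1) := ⟨z, hz, _, hg.2, hTz, hB, by omega⟩
    rcases hdesc _ hd with h | h
    · omega
    · have := h.2 z hz hTz
      omega
  have c0' : ∀ x ∈ diag lam, off + l < itab lam x → itab lam x < off + l + c → T x < r := by
    intro x hx h1 h2
    have h3 := garnir_row_below hg hx h1 (by omega)
    have hne : x ≠ (a + 1, c) := by rintro rfl; omega
    have h4 := std_lt hP hT hx hg.2 (by simp only; omega) h3.2 hne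
    have := nA x hx
    omega
  have c3 : ∀ x ∈ diag lam, off + 1 < itab lam x → itab lam x ≤ off + l → r + 1 < T x := by
    intro x hx h1 h2
    have h3 := garnir_row hg hx (by omega) h2
    have hne : (a, c) ≠ x := by rintro rfl; omega
    have h4 := std_lt hP hT hg.1 hx (by simp only; omega) h3.2 hne
    have := nB x hx
    omega
  have c3' : ∀ x ∈ diag lam, off + l + c < itab lam x → r + 1 < T x := by
    intro x hx hxo
    by_contra hlt
    have h1 := nA x hx
    have h2 := nB x hx
    have hx' := hrange x hx
    obtain ⟨z, hz, hTz⟩ := hTN.exists_node (p := r - 1) (by omega) (by omega)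
    have hzx : itab lam x ≤ itab lam z := by
      rcases eq_or_ne x z with rfl | hne
      · exact le_rfl
      · refine (low x hx z hz ?_ (by omega)).le
        have : T x ≠ T z := fun h => hne (hTN.inj hx hz h)
        omega
    have hd : Desc lam T (r - 1) := ⟨_, hg.1, z, hz, by omega, hTz, by omega⟩
    rcases hdesc _ hd with h | h
    · have := h.2 z hz hTz
      omega
    · omega
  let K : PNode → ℕ := fun x => garnirKey off l c (itab lam x)
  have k0 : ∀ x ∈ diag lam, K x = 0 → T x < r := by
    intro x hx hk
    simp only [K, garnirKey] at hk
    split_ifs at hk with h1 h2 h3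
    rcases h3 with h3 | h3
    exacts [c0 x hx h3, c0' x hx h3.1 h3.2]
  have k1 : ∀ x ∈ diag lam, K x = 1 → T x = r := by
    intro x hx hk
    simp only [K, garnirKey] at hk
    split_ifs at hk with h1 h2 h3 <;> try omega
    rw [itab_injOn hx hg.1 (h1.trans hA'.symm), hA]
  have k2 : ∀ x ∈ diag lam, K x = 2 → T x = r + 1 := by
    intro x hx hk
    simp only [K, garnirKey] at hk
    split_ifs at hk with h1 h2 h3 <;> try omega
    rw [itab_injOn hx hg.2 (h2.trans hB'.symm), hB]
  have k3 : ∀ x ∈ diag lam, K x = 3 → r + 1 < T x := by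
    intro x hx hk
    simp only [K, garnirKey] at hk
    split_ifs at hk with h1 h2 h3 <;> try omega
    rcases le_or_gt (itab lam x) (off + l) with h4 | h4
    exacts [c3 x hx (by omega) h4, c3' x hx (by omega)]
  have kle : ∀ x, K x = 0 ∨ K x = 1 ∨ K x = 2 ∨ K x = 3 := by
    intro x
    simp only [K, garnirKey]
    split_ifs <;> simp
  have hval : ∀ x ∈ diag lam, tab lam (garnirWord lam a c).tail x =
      garnirVal off l c (itab lam x) := by
    intro x hx
    rw [hU x hx, tab_garnirWord a c hx, sgen_apply, garnirVal]
    simp only [← hoff, ← hl]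
    generalize itab lam x = p
    clear_value off l
    split_ifs <;> omega
  have hfin : T = tab lam (garnirWord lam a c).tail := by
    refine hTN.eq_of_rel hP (tab_isTabN hP hw'.of_cons)
      (fun x y => K x < K y ∨ K x = K y ∧ itab lam x < itab lam y) ?_ ?_ ?_
    · intro x hx y hy hne
      have : itab lam x ≠ itab lam y := fun h => hne (itab_injOn hx hy h)
      omega
    · intro x hx y hy hxy
      have x0 := k0 x hx
      have x1 := k1 x hx
      have x2 := k2 x hx
      have x3 := k3 x hx
      have y0 := k0 y hy
      have y1 := k1 y hy
      have y2 := k2 y hy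
      have y3 := k3 y hy
      have kx := kle x
      have ky := kle y
      have lo := low y hy x hx
      have hi := high y hy x hx
      rcases hxy with hxy | ⟨hk, hxy⟩
      · omega
      · have hne : T x ≠ T y := fun h => by
          rw [hTN.inj hx hy h] at hxy
          exact lt_irrefl _ hxy
        have : K x ≠ 1 := fun h => hne ((x1 h).trans (y1 (hk ▸ h)).symm)
        have : K x ≠ 2 := fun h => hne ((x2 h).trans (y2 (hk ▸ h)).symm)
        by_contra hlt
        rcases kx with h | h | h | h
        · have := lo (by omega) (by omega)
          omega
        · omega
        · omega
        · have := hi (by omega) (by omega)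
          omega
    · intro x hx y hy hxy
      rw [hval x hx, hval y hy]
      exact garnirVal_lt hl1 hc hxy
  refine ⟨hfin, ?_⟩
  rw [← hA, hfin, hval _ hg.1, hA', garnirVal, if_pos rfl]

end Garnir

section Spanning

variable {n : ℕ} {lam : ℕ → ℕ} {κ : ℤ} {ν₀ : Fin n → ℕ}
variable {O : Type*} [CommRing O] {M : Type*} [AddCommGroup M] [Module O M]

theorem sw_left {T : PNode → ℕ} {x : PNode} {r : ℕ} (h : T x = r) : sw r T x = r + 1 := by
  rw [sw_apply, if_pos h]

theorem sw_right {T : PNode → ℕ} {x : PNode} {r : ℕ} (h : T x = r + 1) : sw r T x = r := by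
  rw [sw_apply, if_neg (by omega), if_pos h]

theorem sw_ne {T : PNode → ℕ} {x : PNode} {r p : ℕ} (h : T x = p) (h1 : p ≠ r)
    (h2 : p ≠ r + 1) : sw r T x = p := by
  rw [sw_apply, if_neg (by omega), if_neg (by omega), h]

theorem quivDiff_eq_zero {A : Type*} [Ring A] {i j : ℕ} (h1 : i + 1 ≠ j) (h2 : j + 1 ≠ i)
    (u w : A) : quivDiff i j u w = 0 := by
  unfold quivDiff
  split_ifs <;> first | rfl | omega

namespace HeckeOps

variable (h : HeckeOps ν₀ (Module.End O M))

theorem p_apply {v : M} {μ : Fin n → ℕ} (hv : h.e μ v = v) {r : ℕ} (h1 : 1 ≤ r)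
    (h2 : r + 1 ≤ n) : h.e (swapAt μ r) (h.p r v) = h.p r v := by
  have := LinearMap.congr_fun (h.pe r h1 h2 μ) v
  simpa only [Module.End.mul_apply, hv] using this.symm

theorem xp_apply {v : M} {μ : Fin n → ℕ} (hv : h.e μ v = v) {r : ℕ} (h1 : 1 ≤ r)
    (h2 : r + 1 ≤ n) : h.x r (h.p r v) = h.p r (h.x (r + 1) v) -
      if seqAt μ r = seqAt μ (r + 1) then v else 0 := by
  have := LinearMap.congr_fun (h.xp r h1 h2 μ) v
  split_ifs at this ⊢ <;>
  simpa only [Module.End.mul_apply, LinearMap.sub_apply, hv, LinearMap.zero_apply] using this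

theorem xp'_apply {v : M} {μ : Fin n → ℕ} (hv : h.e μ v = v) {r : ℕ} (h1 : 1 ≤ r)
    (h2 : r + 1 ≤ n) : h.x (r + 1) (h.p r v) = h.p r (h.x r v) +
      if seqAt μ r = seqAt μ (r + 1) then v else 0 := by
  have := LinearMap.congr_fun (h.xp' r h1 h2 μ) v
  split_ifs at this ⊢ <;>
  simpa only [Module.End.mul_apply, LinearMap.add_apply, hv, LinearMap.zero_apply] using this

theorem psq_apply {v : M} {μ : Fin n → ℕ} (hv : h.e μ v = v) {r : ℕ} (h1 : 1 ≤ r)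
    (h2 : r + 1 ≤ n) : h.p r (h.p r v) =
      quivPoly (seqAt μ r) (seqAt μ (r + 1)) (h.x r) (h.x (r + 1)) v := by
  have := LinearMap.congr_fun (h.psq r h1 h2 μ) v
  simpa only [Module.End.mul_apply, hv] using this

theorem braid_apply {v : M} {μ : Fin n → ℕ} (hv : h.e μ v = v) {r : ℕ} (h1 : 1 ≤ r)
    (h2 : r + 2 ≤ n) : h.p (r + 1) (h.p r (h.p (r + 1) v)) = h.p r (h.p (r + 1) (h.p r v)) +
      if seqAt μ r = seqAt μ (r + 2)
      then quivDiff (seqAt μ r) (seqAt μ (r + 1)) (h.x r) (h.x (r + 2)) v else 0 := by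
  have := LinearMap.congr_fun (h.braid r h1 h2 μ) v
  rw [← sub_eq_iff_eq_add']
  split_ifs at this ⊢ <;>
  simpa only [Module.End.mul_apply, LinearMap.sub_apply, hv, LinearMap.zero_apply] using this

end HeckeOps

/-- The vector `m` satisfies the defining relations of the generator of the Specht module, up
to a twist of the action of the polynomial generators. -/
structure SpechtVec (h : HeckeOps ν₀ (Module.End O M)) (lam : ℕ → ℕ) (m : M) : Prop where
  e_eq : h.e ν₀ m = m
  x_mem : ∀ r, ∃ a : O, h.x r m = a • m
  row : ∀ a b, (a, b) ∈ diag lam → (a, b + 1) ∈ diag lam → h.p (itab lam (a, b)) m = 0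
  garnir : ∀ a b, IsGarnir lam a b → h.psi (garnirWord lam a b) m = 0

variable {h : HeckeOps ν₀ (Module.End O M)} {m : M}

theorem SpechtVec.psi_cons (r : ℕ) (L : List ℕ) :
    h.psi (r :: L) m = h.p r (h.psi L m) := by
  rw [HeckeOps.psi_cons, Module.End.mul_apply]

theorem e_psi (he : h.e ν₀ m = m) (h0 : IsRes κ lam ν₀ (iniTab lam))
    (hP : IsPartitionOf n lam) {L : List ℕ} (hL : IsWord n L) {μ : Fin n → ℕ}
    (hμ : IsRes κ lam μ (tab lam L)) : h.e μ (h.psi L m) = h.psi L m := by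
  induction L generalizing μ with
  | nil =>
    rw [hμ.unique (iniTab_isTabN hP) h0]
    simpa using he
  | cons r L ih =>
    obtain ⟨h1, h2⟩ := hL.head
    rw [tab_cons, isRes_sw h1 h2] at hμ
    have := h.p_apply (ih hL.of_cons hμ) h1 h2
    rwa [swapAt_swapAt _ h1 h2, ← SpechtVec.psi_cons] at this

theorem exists_e_psi (he : h.e ν₀ m = m) (h0 : IsRes κ lam ν₀ (iniTab lam))
    (hP : IsPartitionOf n lam) {L : List ℕ} {T : PNode → ℕ} (hL : Red n lam L T) :
    ∃ μ, IsRes κ lam μ T ∧ h.e μ (h.psi L m) = h.psi L m := by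
  obtain ⟨μ, -, hμ⟩ := exists_isRes_tab h0 hL.isWord
  exact ⟨μ, hL.eq_tab ▸ hμ, e_psi he h0 hP hL.isWord hμ⟩

theorem Desc.exists_red (hex : ∀ T, IsStdN n lam T → ∃ L, Red n lam L T) {T : PNode → ℕ}
    (hT : IsStdN n lam T) {r : ℕ} (hd : Desc lam T r) :
    ∃ L, Red n lam L (sw r T) ∧ Red n lam (r :: L) T := by
  obtain ⟨L, hL⟩ := hex _ (hd.isStdN_sw hT)
  exact ⟨L, hL, Red.cons hT hd hL⟩

/-- Vectors of the spanning set do not depend on the reduced word. -/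
theorem psi_eq_of_red (hP : IsPartitionOf n lam)
    (hex : ∀ T, IsStdN n lam T → ∃ L, Red n lam L T) (hm : SpechtVec h lam m) (h0 : IsRes κ lam ν₀ (iniTab lam))
    {L L' : List ℕ} {T : PNode → ℕ} (hL : Red n lam L T) (hL' : Red n lam L' T) :
    h.psi L m = h.psi L' m := by
  induction hl : L.length using Nat.strong_induction_on generalizing L L' T with
  | _ l ih =>
  subst hl
  have hlen := (hL.len_eq hP).symm.trans (hL'.len_eq hP)
  have far : ∀ {r s : ℕ} {L₁ L₂ : List ℕ} {T : PNode → ℕ}, r + 1 < s → Red n lam (r :: L₁) T →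
      Red n lam (s :: L₂) T → L₁.length < L.length → L₂.length < L.length →
      h.psi (r :: L₁) m = h.psi (s :: L₂) m := by
    intro r s L₁ L₂ T hrs hr hs hl1 hl2
    cases hr with
    | cons hT hdr hr =>
    cases hs with
    | cons _ hds hs =>
    have hds' : Desc lam (sw r T) s := by
      obtain ⟨x, hx, y, hy, h1, h2, h3⟩ := hds
      exact ⟨x, hx, y, hy, sw_ne h1 (by omega) (by omega), sw_ne h2 (by omega) (by omega), h3⟩
    have hdr' : Desc lam (sw s T) r := by
      obtain ⟨x, hx, y, hy, h1, h2, h3⟩ := hdr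
      exact ⟨x, hx, y, hy, sw_ne h1 (by omega) (by omega), sw_ne h2 (by omega) (by omega), h3⟩
    obtain ⟨L₃, h3, h3'⟩ := hds'.exists_red hex (hr.isStdN hP)
    rw [← sw_comm hrs] at h3
    have h4 := Red.cons (hs.isStdN hP) hdr' h3
    rw [SpechtVec.psi_cons, SpechtVec.psi_cons, ih _ hl1 hr h3' rfl, ih _ hl2 hs h4 rfl,
      SpechtVec.psi_cons, SpechtVec.psi_cons, ← Module.End.mul_apply, h.pp r s hrs]
    rfl
  have near : ∀ {r : ℕ} {L₁ L₂ : List ℕ} {T : PNode → ℕ}, Red n lam (r :: L₁) T →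
      Red n lam ((r + 1) :: L₂) T → L₁.length < L.length → L₂.length < L.length →
      h.psi (r :: L₁) m = h.psi ((r + 1) :: L₂) m := by
    intro r L₁ L₂ T hr hs hl1 hl2
    cases hr with
    | cons hT hdr hr =>
    cases hs with
    | cons _ hds hs =>
    have hr1 := hdr.range hT.isTabN
    have hr2 := hds.range hT.isTabN
    obtain ⟨B, hB, A, hA, hTB, hTA, hBA⟩ := hdr
    obtain ⟨C, hC, B', hB', hTC, hTB', hCB⟩ := hds
    obtain rfl := hT.isTabN.inj hB hB' (hTB.trans hTB'.symm)
    have d1 : Desc lam (sw r T) (r + 1) := ⟨C, hC, A, hA,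
      sw_ne hTC (by omega) (by omega), sw_left hTA, hCB.trans hBA⟩
    obtain ⟨-, h1, -⟩ := d1.exists_red hex (hr.isStdN hP)
    have d2 : Desc lam (sw (r + 1) (sw r T)) r := ⟨C, hC, B, hB,
      sw_right (sw_ne hTC (by omega) (by omega)),
      sw_ne (sw_right hTB) (by omega) (by omega), hCB⟩
    obtain ⟨L₃, h3, h3'⟩ := d2.exists_red hex (d1.isStdN_sw (hr.isStdN hP))
    have h4 := Red.cons (hr.isStdN hP) d1 h3'
    have d3 : Desc lam (sw (r + 1) T) r := ⟨C, hC, A, hA,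
      sw_right hTC, sw_ne hTA (by omega) (by omega), hCB.trans hBA⟩
    have d4 : Desc lam (sw r (sw (r + 1) T)) (r + 1) := ⟨B, hB, A, hA,
      sw_ne (sw_left hTB) (by omega) (by omega),
      sw_left (sw_ne hTA (by omega) (by omega)), hBA⟩
    rw [sw_braid] at h3
    have h5 := Red.cons (hs.isStdN hP) d3 (Red.cons (d3.isStdN_sw (hs.isStdN hP)) d4 h3)
    rw [SpechtVec.psi_cons, SpechtVec.psi_cons, ih _ hl1 hr h4 rfl, ih _ hl2 hs h5 rfl]
    simp only [SpechtVec.psi_cons]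
    obtain ⟨μ, hμ, he⟩ := exists_e_psi hm.e_eq h0 hP h3
    rw [h.braid_apply he hr1.1 hr2.2, left_eq_add]
    split_ifs with hμr
    swap
    · rfl
    have eA : sw (r + 1) (sw r (sw (r + 1) T)) A = r + 2 :=
      sw_left (sw_left (sw_ne hTA (by omega) (by omega)))
    have eB : sw (r + 1) (sw r (sw (r + 1) T)) B = r + 1 :=
      sw_right (sw_ne (sw_left hTB) (by omega) (by omega))
    have eC : sw (r + 1) (sw r (sw (r + 1) T)) C = r :=
      sw_ne (sw_right (sw_right hTC)) (by omega) (by omega)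
    have rA := hμ A hA
    have rB := hμ B hB
    have rC := hμ C hC
    rw [eA, res_eq] at rA
    rw [eB, res_eq] at rB
    rw [eC, res_eq] at rC
    have key : ∀ {x y : PNode}, x ∈ diag lam → y ∈ diag lam → T x < T y →
        itab lam y < itab lam x → dgn κ y + 1 < dgn κ x ∨ dgn κ x + 1 < dgn κ y := by
      intro x y hx hy hT' hi
      by_contra hc
      have := le_of_dgn_close (κ := κ) hP hT hx hy hT' (by omega) (by omega)
      rw [itab_lt_iff hy hx] at hi
      omega
    have kAB := key hA hB (by omega) hBA
    have kBC := key hB hC (by omega) hCB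
    have kAC := key hA hC (by omega) (hCB.trans hBA)
    rw [quivDiff_eq_zero, LinearMap.zero_apply]
    · omega
    · omega
  cases L with
  | nil =>
    cases L' with
    | nil => rfl
    | cons s L₂ => simp at hlen
  | cons r L₁ =>
    cases L' with
    | nil => simp at hlen
    | cons s L₂ =>
      have hl1 : L₁.length < (r :: L₁).length := by simp
      have hl2 : L₂.length < (r :: L₁).length := by rw [hlen]; simp
      rcases lt_trichotomy r s with hrs | rfl | hrs
      · rcases Nat.lt_or_ge (r + 1) s with h1 | h1
        · exact far h1 hL hL' hl1 hl2
        · obtain rfl : s = r + 1 := by omega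
          exact near hL hL' hl1 hl2
      · cases hL with
        | cons hT hd hL =>
        cases hL' with
        | cons _ _ hL' =>
        rw [SpechtVec.psi_cons, SpechtVec.psi_cons, ih _ hl1 hL hL' rfl]
      · rcases Nat.lt_or_ge (s + 1) r with h1 | h1
        · exact (far h1 hL' hL hl2 hl1).symm
        · obtain rfl : r = s + 1 := by omega
          exact (near hL' hL hl2 hl1).symm

end Spanning

section Stability

variable {n : ℕ} {lam : ℕ → ℕ} {κ : ℤ} {ν₀ : Fin n → ℕ}
variable {O : Type*} [CommRing O] {M : Type*} [AddCommGroup M] [Module O M]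
variable {h : HeckeOps ν₀ (Module.End O M)} {m : M}

/-- The span of the vectors `ψ_{w^T} m` with `w^T` of length at most `l`. -/
def redSpan (h : HeckeOps ν₀ (Module.End O M)) (lam : ℕ → ℕ) (m : M) (l : ℕ) : Submodule O M :=
  Submodule.span O {v | ∃ L U, Red n lam L U ∧ L.length ≤ l ∧ v = h.psi L m}

theorem redSpan_mono {l l' : ℕ} (hl : l ≤ l') : redSpan h lam m l ≤ redSpan h lam m l' :=
  Submodule.span_mono fun _ ⟨L, U, h1, h2, h3⟩ => ⟨L, U, h1, h2.trans hl, h3⟩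

theorem psi_mem_redSpan {L : List ℕ} {T : PNode → ℕ} (hL : Red n lam L T) {l : ℕ}
    (hl : L.length ≤ l) : h.psi L m ∈ redSpan h lam m l :=
  Submodule.subset_span ⟨L, T, hL, hl, rfl⟩

theorem redSpan_le {l : ℕ} {N : Submodule O M} (f : Module.End O M)
    (hf : ∀ L T, Red n lam L T → L.length ≤ l → f (h.psi L m) ∈ N) {v : M}
    (hv : v ∈ redSpan h lam m l) : f v ∈ N := by
  have : redSpan h lam m l ≤ N.comap f := Submodule.span_le.2 (by
    rintro _ ⟨L, T, h1, h2, rfl⟩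
    exact hf L T h1 h2)
  exact this hv

theorem quivPoly_mem {N : Submodule O M} {f g : Module.End O M} (hf : ∀ v ∈ N, f v ∈ N)
    (hg : ∀ v ∈ N, g v ∈ N) (i j : ℕ) {v : M} (hv : v ∈ N) : quivPoly i j f g v ∈ N := by
  unfold quivPoly
  split_ifs
  · exact N.zero_mem
  · exact N.add_mem (hf _ hv) (hg _ (hg _ hv))
  · exact N.add_mem (hf _ (hf _ hv)) (hg _ hv)
  · exact N.add_mem (hf _ hv) (hg _ hv)
  · exact hv

theorem quivDiff_mem {N : Submodule O M} {f g : Module.End O M} (hf : ∀ v ∈ N, f v ∈ N)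
    (hg : ∀ v ∈ N, g v ∈ N) (i j : ℕ) {v : M} (hv : v ∈ N) : quivDiff i j f g v ∈ N := by
  unfold quivDiff
  split_ifs
  · exact N.zero_mem
  · exact N.add_mem (hf _ hv) (hg _ hv)
  · exact hv
  · exact hv
  · exact N.zero_mem

/-- How the generators act on the filtration of the span by length. -/
structure LengthStable (h : HeckeOps ν₀ (Module.End O M)) (lam : ℕ → ℕ) (m : M) (κ : ℤ)
    (l : ℕ) : Prop where
  x_mem : ∀ r, ∀ v ∈ redSpan h lam m l, h.x r v ∈ redSpan h lam m l
  p_mem : ∀ r, ∀ v ∈ redSpan h lam m l, h.p r v ∈ redSpan h lam m (l + 1)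
  p_adj : ∀ L T, Red n lam L T → L.length ≤ l → ∀ x ∈ diag lam, ∀ y ∈ diag lam,
    T y = T x + 1 → dgn κ y = dgn κ x + 1 ∨ dgn κ y = dgn κ x - 1 →
    h.p (T x) (h.psi L m) ∈ redSpan h lam m l

theorem x_mem_redSpan (hP : IsPartitionOf n lam)
    (hm : SpechtVec h lam m) (h0 : IsRes κ lam ν₀ (iniTab lam))
    {l : ℕ} (ih : ∀ l' < l, LengthStable h lam m κ l') (r : ℕ) {v : M}
    (hv : v ∈ redSpan h lam m l) : h.x r v ∈ redSpan h lam m l := by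
  refine redSpan_le (h.x r) (fun L T hL hl => ?_) hv
  cases hL with
  | nil =>
    obtain ⟨a, ha⟩ := hm.x_mem r
    have : h.psi [] m = m := by simp
    rw [this, ha]
    refine Submodule.smul_mem _ _ ?_
    rw [← this]
    exact psi_mem_redSpan Red.nil hl
  | @cons i L _ hT hd hL =>
    obtain ⟨h1, h2⟩ := hd.range hT.isTabN
    rw [List.length_cons] at hl
    obtain ⟨l, rfl⟩ : ∃ l', l = l' + 1 := ⟨l - 1, by omega⟩
    have ih := ih l (by omega)
    have hv' : h.psi L m ∈ redSpan h lam m l := psi_mem_redSpan hL (by omega)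
    have hle : redSpan h lam m l ≤ redSpan h lam m (l + 1) := redSpan_mono (by omega)
    obtain ⟨μ, hμ, he⟩ := exists_e_psi hm.e_eq h0 hP hL
    rw [SpechtVec.psi_cons]
    rcases eq_or_ne r i with rfl | hri
    · rw [h.xp_apply he h1 h2]
      refine Submodule.sub_mem _ (ih.p_mem _ _ (ih.x_mem _ _ hv')) ?_
      split_ifs
      exacts [hle hv', Submodule.zero_mem _]
    rcases eq_or_ne r (i + 1) with rfl | hri'
    · rw [h.xp'_apply he h1 h2]
      refine Submodule.add_mem _ (ih.p_mem _ _ (ih.x_mem _ _ hv')) ?_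
      split_ifs
      exacts [hle hv', Submodule.zero_mem _]
    · rw [← Module.End.mul_apply, ← h.px _ _ hri hri', Module.End.mul_apply]
      exact ih.p_mem _ _ (ih.x_mem _ _ hv')

theorem p_adj_redSpan (hP : IsPartitionOf n lam) (hex : ∀ T, IsStdN n lam T → ∃ L, Red n lam L T)
    (hm : SpechtVec h lam m) (h0 : IsRes κ lam ν₀ (iniTab lam))
    {l : ℕ} (ih : ∀ l' < l, LengthStable h lam m κ l') {L : List ℕ} {T : PNode → ℕ}
    (hL : Red n lam L T) (hl : L.length ≤ l) {x y : PNode} (hx : x ∈ diag lam)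
    (hy : y ∈ diag lam) (hxy : T y = T x + 1)
    (hd : dgn κ y = dgn κ x + 1 ∨ dgn κ y = dgn κ x - 1) :
    h.p (T x) (h.psi L m) ∈ redSpan h lam m l := by
  have hT := hL.isStdN hP
  obtain ⟨r, hr⟩ : ∃ r, T x = r := ⟨_, rfl⟩
  rw [hr] at hxy ⊢
  have hixy : itab lam x < itab lam y := by
    rw [itab_lt_iff hx hy]
    have := le_of_dgn_close (κ := κ) hP hT hx hy (by omega) (by omega) (by omega)
    have hne : x ≠ y := by rintro rfl; omega
    have : ¬ (x.1 = y.1 ∧ x.2 = y.2) := fun hc => hne (Prod.ext hc.1 hc.2)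
    omega
  have hlen : ∀ {i : ℕ} {L' : List ℕ}, Red n lam (i :: L') T →
      ∃ l', l = l' + 1 ∧ L'.length ≤ l' := by
    intro i L' h'
    have := (hL.len_eq hP).symm.trans (h'.len_eq hP)
    rw [List.length_cons] at this
    exact ⟨l - 1, by omega, by omega⟩
  by_cases hfar : ∃ i, Desc lam T i ∧ (i + 1 < r ∨ r + 1 < i)
  · obtain ⟨i, hi, hir⟩ := hfar
    obtain ⟨L', h1, h2⟩ := hi.exists_red hex hT
    obtain ⟨l, rfl, hl'⟩ := hlen h2
    rw [psi_eq_of_red hP hex hm h0 hL h2, SpechtVec.psi_cons]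
    have e1 : h.p r (h.p i (h.psi L' m)) = h.p i (h.p r (h.psi L' m)) := by
      have hc : h.p r * h.p i = h.p i * h.p r := by
        rcases hir with hir | hir
        · rw [h.pp _ _ hir]
        · rw [h.pp _ _ hir]
      exact LinearMap.congr_fun hc _
    rw [e1]
    have ih := ih l (by omega)
    have e2 : sw i T x = r := sw_ne hr (by omega) (by omega)
    have e3 : sw i T y = r + 1 := sw_ne hxy (by omega) (by omega)
    have := ih.p_adj L' _ h1 hl' x hx y hy (by omega) hd
    rw [e2] at this
    exact ih.p_mem _ _ this
  by_cases hlow : ∃ C ∈ diag lam, T C + 1 = r ∧ itab lam y < itab lam C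
  · obtain ⟨C, hC, hCr, hiC⟩ := hlow
    obtain ⟨s, rfl⟩ : ∃ s, r = s + 1 := ⟨T C, hCr.symm⟩
    have hTC : T C = s := by omega
    have d1 : Desc lam T s := ⟨x, hx, C, hC, hr, hTC, hixy.trans hiC⟩
    have hs := d1.range hT.isTabN
    have d2 : Desc lam (sw s T) (s + 1) := ⟨y, hy, C, hC, sw_ne hxy (by omega) (by omega),
      sw_left hTC, hiC⟩
    obtain ⟨L', h1, h2⟩ := d2.exists_red hex (d1.isStdN_sw hT)
    have h3 := Red.cons hT d1 h2
    obtain ⟨l, rfl, hl'⟩ := hlen h3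
    rw [List.length_cons] at hl'
    obtain ⟨l, rfl⟩ : ∃ l', l = l' + 1 := ⟨l - 1, by omega⟩
    have hl2 : L'.length ≤ l := by omega
    have ih0 := ih l (by omega)
    have ih1 := ih (l + 1) (by omega)
    rw [psi_eq_of_red hP hex hm h0 hL h3, SpechtVec.psi_cons, SpechtVec.psi_cons]
    obtain ⟨μ, hμ, he⟩ := exists_e_psi hm.e_eq h0 hP h1
    have hs2 := d2.range (d1.isStdN_sw hT).isTabN
    rw [h.braid_apply he hs.1 hs2.2]
    have hv' : h.psi L' m ∈ redSpan h lam m l := psi_mem_redSpan h1 hl2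
    have hle : redSpan h lam m l ≤ redSpan h lam m (l + 1 + 1) := redSpan_mono (by omega)
    refine Submodule.add_mem _ ?_ ?_
    · refine ih1.p_mem _ _ (ih0.p_mem _ _ ?_)
      have e2 : sw (s + 1) (sw s T) x = s := sw_ne (sw_right hr) (by omega) (by omega)
      have e3 : sw (s + 1) (sw s T) y = s + 1 := sw_right (sw_ne hxy (by omega) (by omega))
      have := ih0.p_adj L' _ h1 hl2 x hx y hy (by omega) hd
      rwa [e2] at this
    · split_ifs
      · exact hle (quivDiff_mem (ih0.x_mem _) (ih0.x_mem _) _ _ hv')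
      · exact Submodule.zero_mem _
  by_cases hhigh : ∃ C ∈ diag lam, T C = r + 2 ∧ itab lam C < itab lam x
  · obtain ⟨C, hC, hTC, hiC⟩ := hhigh
    have d1 : Desc lam T (r + 1) := ⟨C, hC, y, hy, hTC, hxy, hiC.trans hixy⟩
    have hs := d1.range hT.isTabN
    have d2 : Desc lam (sw (r + 1) T) r := ⟨C, hC, x, hx, sw_right hTC,
      sw_ne hr (by omega) (by omega), hiC⟩
    obtain ⟨L', h1, h2⟩ := d2.exists_red hex (d1.isStdN_sw hT)
    have h3 := Red.cons hT d1 h2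
    obtain ⟨l, rfl, hl'⟩ := hlen h3
    rw [List.length_cons] at hl'
    obtain ⟨l, rfl⟩ : ∃ l', l = l' + 1 := ⟨l - 1, by omega⟩
    have hl2 : L'.length ≤ l := by omega
    have ih0 := ih l (by omega)
    have ih1 := ih (l + 1) (by omega)
    rw [psi_eq_of_red hP hex hm h0 hL h3, SpechtVec.psi_cons, SpechtVec.psi_cons]
    obtain ⟨μ, hμ, he⟩ := exists_e_psi hm.e_eq h0 hP h1
    have hs2 := d2.range (d1.isStdN_sw hT).isTabN
    rw [eq_sub_of_add_eq (h.braid_apply he hs2.1 hs.2).symm]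
    have hv' : h.psi L' m ∈ redSpan h lam m l := psi_mem_redSpan h1 hl2
    have hle : redSpan h lam m l ≤ redSpan h lam m (l + 1 + 1) := redSpan_mono (by omega)
    refine Submodule.sub_mem _ ?_ ?_
    · refine ih1.p_mem _ _ (ih0.p_mem _ _ ?_)
      have e2 : sw r (sw (r + 1) T) x = r + 1 := sw_left (sw_ne hr (by omega) (by omega))
      have e3 : sw r (sw (r + 1) T) y = r + 2 := sw_ne (sw_left hxy) (by omega) (by omega)
      have := ih0.p_adj L' _ h1 hl2 x hx y hy (by omega) hd
      rwa [e2] at this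
    · split_ifs
      · exact hle (quivDiff_mem (ih0.x_mem _) (ih0.x_mem _) _ _ hv')
      · exact Submodule.zero_mem _
  have hdesc : ∀ i, Desc lam T i →
      (i + 1 = r ∧ ∀ C ∈ diag lam, T C = i → itab lam C < itab lam y) ∨
      (i = r + 1 ∧ ∀ C ∈ diag lam, T C = i + 1 → itab lam x < itab lam C) := by
    intro i hi
    have hnf : ¬ (i + 1 < r ∨ r + 1 < i) := fun hc => hfar ⟨i, hi, hc⟩
    have hir : i ≠ r := by
      rintro rfl
      obtain ⟨a, ha, b, hb, e1, e2, e3⟩ := hi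
      obtain rfl := hT.isTabN.inj ha hy (e1.trans hxy.symm)
      obtain rfl := hT.isTabN.inj hb hx (e2.trans hr.symm)
      omega
    rcases (by omega : i + 1 = r ∨ i = r + 1) with h1 | h1
    · refine Or.inl ⟨h1, fun C hC hTC => ?_⟩
      refine lt_of_le_of_ne (not_lt.1 fun hc => hlow ⟨C, hC, by omega, hc⟩) fun hc => ?_
      obtain rfl := itab_injOn hC hy hc
      omega
    · refine Or.inr ⟨h1, fun C hC hTC => ?_⟩
      refine lt_of_le_of_ne (not_lt.1 fun hc => hhigh ⟨C, hC, by omega, hc⟩) fun hc => ?_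
      obtain rfl := itab_injOn hx hC hc
      omega
  suffices hz : h.p r (h.psi L m) = 0 by rw [hz]; exact Submodule.zero_mem _
  rcases adj_of_dgn (κ := κ) hP hT hx hy (by omega) (by omega) (by omega) with
    ⟨hyx, -⟩ | ⟨hyx, -⟩
  · have hno : ∀ i, ¬ Desc lam T i := by
      intro i hi
      have hiy : itab lam y = itab lam x + 1 := by rw [hyx]; unfold itab; simp only; omega
      rcases hdesc i hi with ⟨h1, h2⟩ | ⟨h1, h2⟩
      · obtain ⟨a, ha, b, hb, e1, e2, e3⟩ := hi
        obtain rfl := hT.isTabN.inj ha hx (by omega)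
        have := h2 b hb e2
        omega
      · obtain ⟨a, ha, b, hb, e1, e2, e3⟩ := hi
        obtain rfl := hT.isTabN.inj hb hy (by omega)
        have := h2 a ha e1
        omega
    cases hL with
    | cons _ hd' _ => exact absurd hd' (hno _)
    | nil =>
      have := hm.row x.1 x.2 hx (hyx ▸ hy)
      rw [← hr, iniTab_of_mem hx]
      simpa using this
  · obtain ⟨a, c⟩ := x
    obtain rfl : y = (a + 1, c) := hyx
    have hg : IsGarnir lam a c := ⟨hx, hy⟩
    obtain ⟨e1, e2⟩ := eq_garnir_pred hP hT hg hr hxy hdesc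
    have hw := garnirWord_isWord hP hg
    have hcons := garnirWord_cons (lam := lam) (r := a) (garnir_pos hg)
    have h1 : Red n lam (garnirWord lam a c).tail (tab lam (garnirWord lam a c).tail) := by
      refine red_of_len hP ?_ (e1 ▸ hT) (len_garnir_tail hP hg)
      rw [hcons] at hw
      exact hw.of_cons
    rw [← e1] at h1
    rw [psi_eq_of_red hP hex hm h0 hL h1, ← SpechtVec.psi_cons, e2, ← hcons]
    exact hm.garnir a c hg

theorem lengthStable (hP : IsPartitionOf n lam) (hex : ∀ T, IsStdN n lam T → ∃ L, Red n lam L T)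
    (hm : SpechtVec h lam m) (h0 : IsRes κ lam ν₀ (iniTab lam)) (l : ℕ) :
    LengthStable h lam m κ l := by
  induction l using Nat.strong_induction_on with
  | _ l ih =>
  refine ⟨fun r v hv => x_mem_redSpan hP hm h0 ih r hv, fun r v hv => ?_,
    fun L T hL hl x hx y hy hxy hd => p_adj_redSpan hP hex hm h0 ih hL hl hx hy hxy hd⟩
  have hle : redSpan h lam m l ≤ redSpan h lam m (l + 1) := redSpan_mono (by omega)
  refine redSpan_le (h.p r) (fun L T hL hl => ?_) hv
  have hT := hL.isStdN hP
  by_cases hr : r = 0 ∨ n ≤ r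
  · rw [h.pzero r hr]
    exact Submodule.zero_mem _
  obtain ⟨x, hx, hxr⟩ := hT.isTabN.exists_node (p := r) (by omega) (by omega)
  obtain ⟨y, hy, hyr⟩ := hT.isTabN.exists_node (p := r + 1) (by omega) (by omega)
  by_cases hd : dgn κ y = dgn κ x + 1 ∨ dgn κ y = dgn κ x - 1
  · have := p_adj_redSpan hP hex hm h0 ih hL hl hx hy (by omega) hd
    rw [hxr] at this
    exact hle this
  have hne : itab lam x ≠ itab lam y := fun hc => by
    obtain rfl := itab_injOn hx hy hc
    omega
  rcases lt_or_gt_of_ne hne with hi | hi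
  · have hs := isStdN_sw_of_dgn (κ := κ) hT hx hy hxr hyr (by tauto) (by tauto)
    have hD : Desc lam (sw r T) r := ⟨x, hx, y, hy, sw_left hxr, sw_right hyr, hi⟩
    have hL' : Red n lam L (sw r (sw r T)) := by rwa [sw_sw]
    rw [← SpechtVec.psi_cons]
    exact psi_mem_redSpan (Red.cons hs hD hL') (by rw [List.length_cons]; omega)
  · have hD : Desc lam T r := ⟨y, hy, x, hx, hyr, hxr, hi⟩
    obtain ⟨L', h1, h2⟩ := hD.exists_red hex hT
    have hlen := (hL.len_eq hP).symm.trans (h2.len_eq hP)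
    rw [List.length_cons] at hlen
    obtain ⟨μ, hμ, he⟩ := exists_e_psi hm.e_eq h0 hP h1
    rw [psi_eq_of_red hP hex hm h0 hL h2, SpechtVec.psi_cons, h.psq_apply he (by omega) (by omega)]
    have ih := ih L'.length (by omega)
    exact redSpan_mono (by omega) (quivPoly_mem (ih.x_mem _) (ih.x_mem _) _ _
      (psi_mem_redSpan h1 le_rfl))

/-- The span of the vectors `ψ_{w^T} m`, `T` standard. -/
def stdSpan (h : HeckeOps ν₀ (Module.End O M)) (lam : ℕ → ℕ) (m : M) : Submodule O M :=
  Submodule.span O {v | ∃ L U, Red n lam L U ∧ v = h.psi L m}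

theorem redSpan_le_stdSpan (l : ℕ) : redSpan h lam m l ≤ stdSpan h lam m :=
  Submodule.span_mono fun _ ⟨L, U, h1, _, h3⟩ => ⟨L, U, h1, h3⟩

theorem stdSpan_stable (f : Module.End O M)
    (hf : ∀ L T, Red n lam L T → f (h.psi L m) ∈ stdSpan h lam m) {v : M}
    (hv : v ∈ stdSpan h lam m) : f v ∈ stdSpan h lam m := by
  have : stdSpan h lam m ≤ (stdSpan h lam m).comap f := Submodule.span_le.2 (by
    rintro _ ⟨L, T, h1, rfl⟩
    exact hf L T h1)
  exact this hv

theorem e_mem_stdSpan (hP : IsPartitionOf n lam)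
    (hm : SpechtVec h lam m) (h0 : IsRes κ lam ν₀ (iniTab lam)) (μ : Fin n → ℕ) {v : M}
    (hv : v ∈ stdSpan h lam m) : h.e μ v ∈ stdSpan h lam m := by
  refine stdSpan_stable (h.e μ) (fun L T hL => ?_) hv
  obtain ⟨μ', -, he⟩ := exists_e_psi hm.e_eq h0 hP hL
  rw [← he, ← Module.End.mul_apply, h.idem]
  split_ifs with hμ
  · rw [hμ, he]
    exact Submodule.subset_span ⟨L, T, hL, rfl⟩
  · exact Submodule.zero_mem _

theorem x_mem_stdSpan (hP : IsPartitionOf n lam)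
    (hex : ∀ T, IsStdN n lam T → ∃ L, Red n lam L T)
    (hm : SpechtVec h lam m) (h0 : IsRes κ lam ν₀ (iniTab lam)) (r : ℕ) {v : M}
    (hv : v ∈ stdSpan h lam m) : h.x r v ∈ stdSpan h lam m :=
  stdSpan_stable (h.x r) (fun L _ hL => redSpan_le_stdSpan L.length
    ((lengthStable hP hex hm h0 _).x_mem r _ (psi_mem_redSpan hL le_rfl))) hv

theorem p_mem_stdSpan (hP : IsPartitionOf n lam)
    (hex : ∀ T, IsStdN n lam T → ∃ L, Red n lam L T)
    (hm : SpechtVec h lam m) (h0 : IsRes κ lam ν₀ (iniTab lam)) (r : ℕ) {v : M}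
    (hv : v ∈ stdSpan h lam m) : h.p r v ∈ stdSpan h lam m :=
  stdSpan_stable (h.p r) (fun L _ hL => redSpan_le_stdSpan (L.length + 1)
    ((lengthStable hP hex hm h0 _).p_mem r _ (psi_mem_redSpan hL le_rfl))) hv

end Stability

section Contents

/-- The scalar by which a polynomial generator acts on a node of diagonal `d` in the
seminormal model. -/
def cVal {R : Type*} [CommRing R] (z : R) (d : ℤ) : R :=
  if d = 0 then -(z * z) else if 0 < d then (-1) ^ (d.natAbs + 1) * z else (-1) ^ d.natAbs * z

theorem map_cVal {R S : Type*} [CommRing R] [CommRing S] (f : R →+* S) (z : R) (d : ℤ) :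
    f (cVal z d) = cVal (f z) d := by
  unfold cVal
  split_ifs <;> simp

theorem cVal_zero_left {R : Type*} [CommRing R] (d : ℤ) : cVal (0 : R) d = 0 := by
  simp [cVal]

theorem cVal_zero {R : Type*} [CommRing R] (z : R) : cVal z 0 = -(z * z) := if_pos rfl

theorem cVal_of_pos {R : Type*} [CommRing R] (z : R) (i : ℕ) :
    cVal z ((i : ℤ) + 1) = (-1) ^ i * z := by
  rw [cVal, if_neg (by omega), if_pos (by omega),
    show ((i : ℤ) + 1).natAbs = i + 1 by omega, pow_succ, pow_succ]
  ring

theorem cVal_of_neg {R : Type*} [CommRing R] (z : R) (i : ℕ) :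
    cVal z (-((i : ℤ) + 1)) = -((-1) ^ i * z) := by
  rw [cVal, if_neg (by omega), if_neg (by omega),
    show (-((i : ℤ) + 1)).natAbs = i + 1 by omega, pow_succ]
  ring

theorem int_cases (d : ℤ) : d = 0 ∨ ∃ i : ℕ, d = (i : ℤ) + 1 ∨ d = -((i : ℤ) + 1) := by
  rcases lt_trichotomy d 0 with h | h | h
  · exact Or.inr ⟨d.natAbs - 1, Or.inr (by omega)⟩
  · exact Or.inl h
  · exact Or.inr ⟨d.natAbs - 1, Or.inl (by omega)⟩

theorem quivPoly_symm {R : Type*} [CommRing R] (i j : ℕ) (u v : R) :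
    quivPoly i j u v = quivPoly j i v u := by
  unfold quivPoly
  split_ifs <;> first | omega | ring

theorem quivPoly_sub {R : Type*} [CommRing R] (i j : ℕ) (u v w : R) :
    quivPoly i j u v - quivPoly i j w v = quivDiff i j u w * (u - w) := by
  unfold quivPoly quivDiff
  split_ifs <;> first | omega | ring

theorem quivPoly_cVal_succ {R : Type*} [CommRing R] (z : R) (d : ℤ) :
    quivPoly d.natAbs (d + 1).natAbs (cVal z d) (cVal z (d + 1)) = 0 := by
  rcases int_cases d with rfl | ⟨i, rfl | rfl⟩
  · have := cVal_of_pos z 0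
    norm_num at this
    simp [quivPoly, this, cVal_zero]
  · have h2 := cVal_of_pos z (i + 1)
    push_cast at h2
    rw [h2, cVal_of_pos, quivPoly, if_neg (by omega), if_neg (by omega), if_neg (by omega),
      if_pos (by omega), pow_succ]
    ring
  · rcases i with _ | i
    · have := cVal_of_neg z 0
      norm_num at this
      simp [quivPoly, this, cVal_zero]
    · have h2 := cVal_of_neg z (i + 1)
      rw [show -(((i + 1 : ℕ) : ℤ) + 1) + 1 = -((i : ℤ) + 1) by push_cast; ring,
        h2, cVal_of_neg, quivPoly, if_neg (by omega), if_neg (by omega), if_neg (by omega),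
        if_pos (by omega), pow_succ]
      ring

theorem quivPoly_cVal_adj {R : Type*} [CommRing R] (z : R) {d e : ℤ} (h : d = e + 1 ∨ d = e - 1) :
    quivPoly d.natAbs e.natAbs (cVal z d) (cVal z e) = 0 := by
  rcases h with rfl | rfl
  · rw [quivPoly_symm, quivPoly_cVal_succ]
  · have := quivPoly_cVal_succ z (e - 1)
    rwa [sub_add_cancel] at this

variable {F : Type*} [Field F] {z : F}

theorem cVal_ne (hz : z ≠ 0) (h2 : (2 : F) ≠ 0) {d e : ℤ} (hde : d ≠ e)
    (h : d.natAbs = e.natAbs) : cVal z d ≠ cVal z e := by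
  have key : ∀ i : ℕ, cVal z ((i : ℤ) + 1) ≠ cVal z (-((i : ℤ) + 1)) := by
    intro i
    rw [cVal_of_pos, cVal_of_neg]
    intro hc
    have : 2 * ((-1) ^ i * z) = 0 := by linear_combination hc
    simp [h2, hz] at this
  obtain rfl : d = -e := by omega
  rcases int_cases e with rfl | ⟨i, rfl | rfl⟩
  · simp at hde
  · exact (key i).symm
  · rw [neg_neg]; exact key i

theorem quivPoly_cVal_ne (hz : z ≠ 0) (h2 : (2 : F) ≠ 0) {d e : ℤ} (h : d.natAbs ≠ e.natAbs)
    (h3 : d ≠ e + 1) (h4 : d ≠ e - 1) :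
    quivPoly d.natAbs e.natAbs (cVal z d) (cVal z e) ≠ 0 := by
  have h2' : ∀ i : ℕ, (2 : F) * ((-1) ^ i * z) ≠ 0 := by
    intro i
    simp [h2, hz]
  have key : ∀ d e : ℤ, d ≠ e + 1 → d ≠ e - 1 → e.natAbs = d.natAbs + 1 →
      cVal z d + cVal z e ≠ 0 := by
    intro d e h3 h4 h5
    rcases int_cases d with rfl | ⟨i, rfl | rfl⟩
    · omega
    · obtain rfl : e = -(((i + 1 : ℕ) : ℤ) + 1) := by omega
      rw [cVal_of_pos, cVal_of_neg, pow_succ]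
      intro hc
      exact h2' i (by linear_combination hc)
    · obtain rfl : e = ((i + 1 : ℕ) : ℤ) + 1 := by omega
      rw [cVal_of_pos, cVal_of_neg, pow_succ]
      intro hc
      exact h2' i (by linear_combination -hc)
  rw [quivPoly, if_neg h, if_neg (by omega), if_neg (by omega)]
  split_ifs with hadj
  · rcases hadj with hadj | hadj
    · exact key d e h3 h4 hadj.symm
    · rw [add_comm]
      exact key e d (by omega) (by omega) hadj.symm
  · exact one_ne_zero

/-- The diagonal coefficient of an intertwiner in the seminormal model. -/
def aVal (z : F) (d e : ℤ) : F :=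
  if d.natAbs = e.natAbs then (cVal z e - cVal z d)⁻¹ else 0

/-- The off-diagonal coefficient of an intertwiner in the seminormal model. -/
def bVal (z : F) (d e : ℤ) : F :=
  if d.natAbs = e.natAbs then (cVal z d - cVal z e)⁻¹
  else if d.natAbs < e.natAbs ∧ d ≠ e + 1 ∧ d ≠ e - 1 then 1
  else quivPoly d.natAbs e.natAbs (cVal z d) (cVal z e)

theorem aVal_symm (z : F) (d e : ℤ) : aVal z e d = -aVal z d e := by
  unfold aVal
  by_cases h : d.natAbs = e.natAbs
  · rw [if_pos h, if_pos h.symm, ← neg_sub (cVal z e), inv_neg]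
  · rw [if_neg h, if_neg (Ne.symm h), neg_zero]

theorem aVal_of_ne (z : F) {d e : ℤ} (h : d.natAbs ≠ e.natAbs) : aVal z d e = 0 := if_neg h

theorem bVal_adj (z : F) {d e : ℤ} (h : d = e + 1 ∨ d = e - 1) : bVal z d e = 0 := by
  rw [bVal, if_neg (by omega), if_neg (by omega), quivPoly_cVal_adj z h]

theorem bVal_ne_zero (hz : z ≠ 0) (h2 : (2 : F) ≠ 0) {d e : ℤ} (hde : d ≠ e)
    (h3 : d ≠ e + 1) (h4 : d ≠ e - 1) : bVal z d e ≠ 0 := by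
  unfold bVal
  split_ifs with h5 h6
  · exact inv_ne_zero (sub_ne_zero.2 (cVal_ne hz h2 hde h5))
  · exact one_ne_zero
  · exact quivPoly_cVal_ne hz h2 h5 h3 h4

theorem bVal_mul_symm (z : F) {d e : ℤ} (h : d.natAbs ≠ e.natAbs) :
    bVal z d e * bVal z e d = quivPoly d.natAbs e.natAbs (cVal z d) (cVal z e) := by
  by_cases hadj : d = e + 1 ∨ d = e - 1
  · rw [bVal_adj z hadj, zero_mul, quivPoly_cVal_adj z hadj]
  rw [bVal, bVal, if_neg h, if_neg h.symm]
  rcases lt_or_gt_of_ne h with hlt | hlt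
  · rw [if_pos (by omega), if_neg (by omega), one_mul, quivPoly_symm]
  · rw [if_neg (by omega), if_pos (by omega), mul_one]

theorem sq_add_bVal_mul (z : F) (d e : ℤ) :
    aVal z d e * aVal z d e + bVal z d e * bVal z e d =
      quivPoly d.natAbs e.natAbs (cVal z d) (cVal z e) := by
  by_cases h : d.natAbs = e.natAbs
  · rw [aVal, bVal, bVal, if_pos h, if_pos h, if_pos h.symm, quivPoly, if_pos h,
      ← neg_sub (cVal z e), inv_neg]
    ring
  · rw [aVal_of_ne z h, bVal_mul_symm z h, mul_zero, zero_add]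

theorem aVal_mul_sub (hz : z ≠ 0) (h2 : (2 : F) ≠ 0) {d e : ℤ} (hde : d ≠ e) :
    aVal z d e * (cVal z e - cVal z d) = if d.natAbs = e.natAbs then 1 else 0 := by
  unfold aVal
  split_ifs with h
  · exact inv_mul_cancel₀ (sub_ne_zero.2 (cVal_ne hz h2 hde h).symm)
  · rw [zero_mul]

theorem aVal_mul_aVal (z : F) {d e f : ℤ} (h1 : d ≠ e) (h2 : e ≠ f) (h3 : d ≠ f) :
    aVal z d e * aVal z e f = aVal z d f * (aVal z d e + aVal z e f) := by
  by_cases ha : d.natAbs = e.natAbs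
  · rw [aVal_of_ne z (d := e) (e := f) (by omega), aVal_of_ne z (d := d) (e := f) (by omega)]
    ring
  by_cases hb : e.natAbs = f.natAbs
  · rw [aVal_of_ne z ha, aVal_of_ne z (d := d) (e := f) (by omega)]
    ring
  · rw [aVal_of_ne z ha, aVal_of_ne z hb]
    ring

theorem aVal_braid (hz : z ≠ 0) (h2 : (2 : F) ≠ 0) {d e f : ℤ} (hde : d ≠ e) (hef : e ≠ f)
    (hdf : d ≠ f) :
    aVal z e f * aVal z e f * aVal z d e - aVal z d e * aVal z d e * aVal z e f +
      (bVal z e f * bVal z f e - bVal z d e * bVal z e d) * aVal z d f =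
    if d.natAbs = f.natAbs then quivDiff d.natAbs e.natAbs (cVal z d) (cVal z f) else 0 := by
  have h0 : aVal z d e * aVal z e f = 0 := by
    unfold aVal
    split_ifs <;> first | omega | simp
  have : aVal z e f * aVal z e f * aVal z d e - aVal z d e * aVal z d e * aVal z e f = 0 := by
    linear_combination (aVal z e f - aVal z d e) * h0
  rw [this, zero_add]
  split_ifs with h
  · have hd : e.natAbs ≠ f.natAbs := by omega
    rw [bVal_mul_symm z hd, bVal_mul_symm z (by omega), quivPoly_symm e.natAbs, ← h,
      ← neg_sub, quivPoly_sub]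
    have := aVal_mul_sub hz h2 hdf
    rw [if_pos h] at this
    linear_combination quivDiff d.natAbs e.natAbs (cVal z d) (cVal z f) * this
  · rw [aVal_of_ne z h, mul_zero]

end Contents

section Seminormal

variable {n : ℕ} {lam : ℕ → ℕ} {κ : ℤ} {ν₀ : Fin n → ℕ}

/-- Standard tableaux. -/
abbrev StdTab (n : ℕ) (lam : ℕ → ℕ) : Type := {T : PNode → ℕ // IsStdN n lam T}

open Classical in
/-- The diagonal of some node satisfying `P`. -/
noncomputable def diagOf (κ : ℤ) (P : PNode → Prop) : ℤ :=
  if h : ∃ x, P x then dgn κ h.choose else 0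

/-- The diagonal of the node of the tableau `T` with entry `p`. -/
noncomputable def dg (κ : ℤ) (lam : ℕ → ℕ) (T : PNode → ℕ) (p : ℕ) : ℤ :=
  diagOf κ fun x => x ∈ diag lam ∧ T x = p

theorem dg_eq {T : PNode → ℕ} (hT : IsTabN n lam T) {x : PNode} (hx : x ∈ diag lam) :
    dg κ lam T (T x) = dgn κ x := by
  have h : ∃ y, y ∈ diag lam ∧ T y = T x := ⟨x, hx, rfl⟩
  rw [dg, diagOf, dif_pos h, hT.inj h.choose_spec.1 hx h.choose_spec.2]

theorem dg_sw (r : ℕ) (T : PNode → ℕ) (p : ℕ) : dg κ lam (sw r T) p = dg κ lam T (sgen r p) := by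
  refine congrArg (diagOf κ) (funext fun x => propext (and_congr_right fun _ => ?_))
  rw [sw]
  constructor
  · rintro rfl
    simp [sgen]
  · intro hx
    rw [hx]
    simp [sgen]

theorem dg_sw_left (r : ℕ) (T : PNode → ℕ) : dg κ lam (sw r T) r = dg κ lam T (r + 1) := by
  rw [dg_sw, sgen_apply, if_pos rfl]

theorem dg_sw_right (r : ℕ) (T : PNode → ℕ) : dg κ lam (sw r T) (r + 1) = dg κ lam T r := by
  rw [dg_sw, sgen_apply, if_neg (by omega), if_pos rfl]

theorem dg_sw_ne {r p : ℕ} (T : PNode → ℕ) (h1 : p ≠ r) (h2 : p ≠ r + 1) :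
    dg κ lam (sw r T) p = dg κ lam T p := by
  rw [dg_sw, sgen_apply, if_neg h1, if_neg h2]

theorem IsRes.seqAt_eq {μ : Fin n → ℕ} {T : PNode → ℕ} (hμ : IsRes κ lam μ T)
    (hT : IsTabN n lam T) {p : ℕ} (h1 : 1 ≤ p) (h2 : p ≤ n) :
    seqAt μ p = (dg κ lam T p).natAbs := by
  obtain ⟨x, hx, rfl⟩ := hT.exists_node h1 h2
  rw [hμ x hx, dg_eq hT hx, res_eq]

theorem isRes_iff {μ : Fin n → ℕ} {T : PNode → ℕ} (hT : IsTabN n lam T) :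
    IsRes κ lam μ T ↔ ∀ p, 1 ≤ p → p ≤ n → seqAt μ p = (dg κ lam T p).natAbs := by
  refine ⟨fun h p h1 h2 => h.seqAt_eq hT h1 h2, fun h x hx => ?_⟩
  obtain ⟨h1, h2⟩ := hT.1.mapsTo hx
  rw [h _ h1 h2, dg_eq hT hx, res_eq]

theorem isRes_sw_of_natAbs {μ : Fin n → ℕ} {T : PNode → ℕ} (hT : IsTabN n lam T) {r : ℕ}
    (h1 : 1 ≤ r) (h2 : r + 1 ≤ n)
    (h : (dg κ lam T r).natAbs = (dg κ lam T (r + 1)).natAbs) :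
    IsRes κ lam μ (sw r T) ↔ IsRes κ lam μ T := by
  rw [isRes_iff hT, isRes_iff (hT.sw h1 h2)]
  refine forall_congr' fun p => ?_
  have : (dg κ lam (sw r T) p).natAbs = (dg κ lam T p).natAbs := by
    by_cases e1 : p = r
    · rw [e1, dg_sw_left, h]
    by_cases e2 : p = r + 1
    · rw [e2, dg_sw_right, h]
    · rw [dg_sw_ne T e1 e2]
  rw [this]

theorem dg_ne (hP : IsPartitionOf n lam) {T : PNode → ℕ} (hT : IsStdN n lam T) {p q : ℕ}
    (h1 : 1 ≤ p) (h2 : p < q) (h3 : q ≤ p + 2) (h4 : q ≤ n) :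
    dg κ lam T p ≠ dg κ lam T q := by
  obtain ⟨x, hx, rfl⟩ := hT.isTabN.exists_node h1 (by omega)
  obtain ⟨y, hy, rfl⟩ := hT.isTabN.exists_node (p := q) (by omega) h4
  rw [dg_eq hT.isTabN hx, dg_eq hT.isTabN hy]
  exact dgn_ne_of_succ hP hT hx hy h2 h3

variable {F : Type*} [Field F]

open Classical in
/-- Extension by zero of a function on standard tableaux. -/
noncomputable def extend (φ : StdTab n lam → F) (T : PNode → ℕ) : F :=
  if h : IsStdN n lam T then φ ⟨T, h⟩ else 0

theorem extend_of_std (φ : StdTab n lam → F) (T : StdTab n lam) : extend φ T.1 = φ T := by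
  rw [extend, dif_pos T.2]

theorem extend_of_not (φ : StdTab n lam → F) {T : PNode → ℕ} (h : ¬ IsStdN n lam T) :
    extend φ T = 0 := dif_neg h

theorem extend_zero (T : PNode → ℕ) : extend (0 : StdTab n lam → F) T = 0 := by
  unfold extend; split_ifs <;> rfl

theorem extend_add (φ φ' : StdTab n lam → F) (T : PNode → ℕ) :
    extend (φ + φ') T = extend φ T + extend φ' T := by
  unfold extend; split_ifs <;> simp

theorem extend_sub (φ φ' : StdTab n lam → F) (T : PNode → ℕ) :
    extend (φ - φ') T = extend φ T - extend φ' T := by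
  unfold extend; split_ifs <;> simp

variable {O : Type*} [CommRing O] [Algebra O F]

theorem extend_smul (a : O) (φ : StdTab n lam → F) (T : PNode → ℕ) :
    extend (a • φ) T = a • extend φ T := by
  unfold extend; split_ifs <;> simp

theorem extend_inj {f g : Module.End O (StdTab n lam → F)}
    (h : ∀ φ : StdTab n lam → F, ∀ T, IsStdN n lam T → extend (f φ) T = extend (g φ) T) :
    f = g := by
  refine LinearMap.ext fun φ => funext fun T => ?_
  rw [← extend_of_std (f φ) T, ← extend_of_std (g φ) T, h φ T.1 T.2]

variable (O) in
open Classical in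
/-- The idempotents in the seminormal model. -/
noncomputable def semE (κ : ℤ) (ν : Fin n → ℕ) : Module.End O (StdTab n lam → F) where
  toFun φ T := if IsRes κ lam ν T.1 then φ T else 0
  map_add' φ φ' := by funext T; simp only [Pi.add_apply]; split_ifs <;> simp
  map_smul' a φ := by funext T; simp only [Pi.smul_apply, RingHom.id_apply]; split_ifs <;> simp

variable (O) in
/-- The polynomial generators in the seminormal model. -/
noncomputable def semX (κ : ℤ) (z : F) (r : ℕ) : Module.End O (StdTab n lam → F) where
  toFun φ T := if 1 ≤ r ∧ r ≤ n then cVal z (dg κ lam T.1 r) * φ T else 0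
  map_add' φ φ' := by funext T; simp only [Pi.add_apply]; split_ifs <;> ring
  map_smul' a φ := by funext T; simp only [Pi.smul_apply, RingHom.id_apply]; split_ifs <;> simp

variable (O) in
/-- The intertwiners in the seminormal model. -/
noncomputable def semP (κ : ℤ) (z : F) (r : ℕ) : Module.End O (StdTab n lam → F) where
  toFun φ T := if 1 ≤ r ∧ r + 1 ≤ n then
    aVal z (dg κ lam T.1 r) (dg κ lam T.1 (r + 1)) * φ T +
      bVal z (dg κ lam T.1 r) (dg κ lam T.1 (r + 1)) * extend φ (sw r T.1) else 0
  map_add' φ φ' := by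
    funext T; simp only [Pi.add_apply, extend_add]; split_ifs <;> ring
  map_smul' a φ := by
    funext T; simp only [Pi.smul_apply, RingHom.id_apply, extend_smul]; split_ifs <;> simp

open Classical in
theorem extend_semE (ν : Fin n → ℕ) (φ : StdTab n lam → F) (T : PNode → ℕ) :
    extend (semE O κ ν φ) T = if IsRes κ lam ν T then extend φ T else 0 := by
  by_cases h : IsStdN n lam T
  · simp only [extend, dif_pos h]; rfl
  · simp only [extend_of_not _ h, ite_self]

theorem extend_semX {z : F} {r : ℕ} (h1 : 1 ≤ r) (h2 : r ≤ n) (φ : StdTab n lam → F)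
    (T : PNode → ℕ) : extend (semX O κ z r φ) T = cVal z (dg κ lam T r) * extend φ T := by
  by_cases h : IsStdN n lam T
  · simp only [extend, dif_pos h]; exact if_pos ⟨h1, h2⟩
  · simp only [extend_of_not _ h, mul_zero]

theorem semX_zero {z : F} {r : ℕ} (h : r = 0 ∨ n < r) :
    (semX O κ z r : Module.End O (StdTab n lam → F)) = 0 :=
  LinearMap.ext fun _ => funext fun _ => if_neg (by omega)

theorem semP_zero {z : F} {r : ℕ} (h : r = 0 ∨ n ≤ r) :
    (semP O κ z r : Module.End O (StdTab n lam → F)) = 0 :=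
  LinearMap.ext fun _ => funext fun _ => if_neg (by omega)

theorem extend_semP {z : F} {r : ℕ} (h1 : 1 ≤ r) (h2 : r + 1 ≤ n) (φ : StdTab n lam → F)
    (T : PNode → ℕ) : extend (semP O κ z r φ) T =
      aVal z (dg κ lam T r) (dg κ lam T (r + 1)) * extend φ T +
      bVal z (dg κ lam T r) (dg κ lam T (r + 1)) * extend φ (sw r T) := by
  by_cases h : IsStdN n lam T
  · have : ∀ φ : StdTab n lam → F, extend φ T = φ ⟨T, h⟩ := fun φ => dif_pos h
    rw [this, this]; exact if_pos ⟨h1, h2⟩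
  rw [extend_of_not _ h, extend_of_not _ h, mul_zero, zero_add]
  by_cases hs : IsStdN n lam (sw r T)
  · obtain ⟨x, hx, hxr⟩ := hs.isTabN.exists_node (p := r) (by omega) (by omega)
    obtain ⟨y, hy, hyr⟩ := hs.isTabN.exists_node (p := r + 1) (by omega) (by omega)
    have hadj : dg κ lam T r = dg κ lam T (r + 1) + 1 ∨ dg κ lam T r = dg κ lam T (r + 1) - 1 := by
      have ex := dg_eq (κ := κ) hs.isTabN hx
      have ey := dg_eq (κ := κ) hs.isTabN hy
      rw [hxr, dg_sw_left] at ex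
      rw [hyr, dg_sw_right] at ey
      rw [ex, ey]
      by_contra hc
      apply h
      have := isStdN_sw_of_dgn (κ := κ) hs hx hy hxr hyr (by tauto) (by tauto)
      rwa [sw_sw] at this
    rw [bVal_adj z hadj, zero_mul]
  · rw [extend_of_not _ hs, mul_zero]

theorem extend_quivPoly {z : F} {r s : ℕ} (h1 : 1 ≤ r) (h2 : r ≤ n) (h3 : 1 ≤ s) (h4 : s ≤ n)
    (i j : ℕ) (φ : StdTab n lam → F) (T : PNode → ℕ) :
    extend (quivPoly i j (semX O κ z r) (semX O κ z s) φ) T =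
      quivPoly i j (cVal z (dg κ lam T r)) (cVal z (dg κ lam T s)) * extend φ T := by
  unfold quivPoly
  split_ifs <;> simp only [LinearMap.zero_apply, LinearMap.add_apply, Module.End.mul_apply,
    Module.End.one_apply, extend_zero, extend_add, extend_semX h1 h2, extend_semX h3 h4] <;> ring

theorem extend_quivDiff {z : F} {r s : ℕ} (h1 : 1 ≤ r) (h2 : r ≤ n) (h3 : 1 ≤ s) (h4 : s ≤ n)
    (i j : ℕ) (φ : StdTab n lam → F) (T : PNode → ℕ) :
    extend (quivDiff i j (semX O κ z r) (semX O κ z s) φ) T =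
      quivDiff i j (cVal z (dg κ lam T r)) (cVal z (dg κ lam T s)) * extend φ T := by
  unfold quivDiff
  split_ifs <;> simp only [LinearMap.zero_apply, LinearMap.add_apply,
    Module.End.one_apply, extend_zero, extend_add, extend_semX h1 h2, extend_semX h3 h4] <;> ring

theorem semP_semX_far {z : F} {r s : ℕ} (h : s ≠ r) (h' : s ≠ r + 1) :
    (semP O κ z r * semX O κ z s : Module.End O (StdTab n lam → F)) =
      semX O κ z s * semP O κ z r := by
  by_cases hr : 1 ≤ r ∧ r + 1 ≤ n
  swap
  · rw [semP_zero (by omega), zero_mul, mul_zero]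
  by_cases hs : 1 ≤ s ∧ s ≤ n
  swap
  · rw [semX_zero (by omega), zero_mul, mul_zero]
  refine extend_inj fun φ T hT => ?_
  simp only [Module.End.mul_apply, extend_semP hr.1 hr.2, extend_semX hs.1 hs.2, dg_sw_ne T h h']
  ring

theorem semP_semP_far {z : F} {r s : ℕ} (h : r + 1 < s) :
    (semP O κ z r * semP O κ z s : Module.End O (StdTab n lam → F)) =
      semP O κ z s * semP O κ z r := by
  by_cases hr : 1 ≤ r ∧ r + 1 ≤ n
  swap
  · rw [semP_zero (r := r) (by omega), zero_mul, mul_zero]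
  by_cases hs : 1 ≤ s ∧ s + 1 ≤ n
  swap
  · rw [semP_zero (r := s) (by omega), zero_mul, mul_zero]
  refine extend_inj fun φ T hT => ?_
  simp only [Module.End.mul_apply, extend_semP hr.1 hr.2, extend_semP hs.1 hs.2, sw_comm h]
  rw [dg_sw_ne (r := r) (p := s) T (by omega) (by omega),
    dg_sw_ne (r := r) (p := s + 1) T (by omega) (by omega),
    dg_sw_ne (r := s) (p := r) T (by omega) (by omega),
    dg_sw_ne (r := s) (p := r + 1) T (by omega) (by omega)]
  ring

theorem semP_semE {z : F} {r : ℕ} (h1 : 1 ≤ r) (h2 : r + 1 ≤ n) (ν : Fin n → ℕ) :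
    (semP O κ z r * semE O κ ν : Module.End O (StdTab n lam → F)) =
      semE O κ (swapAt ν r) * semP O κ z r := by
  classical
  refine extend_inj fun φ T hT => ?_
  simp only [Module.End.mul_apply, extend_semP h1 h2, extend_semE, isRes_sw h1 h2]
  by_cases h : (dg κ lam T r).natAbs = (dg κ lam T (r + 1)).natAbs
  · have := isRes_sw_of_natAbs (μ := ν) hT.isTabN h1 h2 h
    rw [isRes_sw h1 h2] at this
    simp only [this]
    split_ifs <;> simp
  · rw [aVal_of_ne z h]
    split_ifs <;> simp

open Classical in
theorem extend_ite {T : PNode → ℕ} (hT : IsStdN n lam T) {r : ℕ} (h1 : 1 ≤ r) (h2 : r + 1 ≤ n)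
    {ν : Fin n → ℕ} {φ : StdTab n lam → F} :
    extend ((if seqAt ν r = seqAt ν (r + 1) then semE O κ ν else 0 :
      Module.End O (StdTab n lam → F)) φ) T =
      (if (dg κ lam T r).natAbs = (dg κ lam T (r + 1)).natAbs then 1 else 0) *
        extend (semE O κ ν φ) T := by
  by_cases h : IsRes κ lam ν T
  · rw [← h.seqAt_eq hT.isTabN h1 (by omega), ← h.seqAt_eq hT.isTabN (by omega : 1 ≤ r + 1) h2]
    split_ifs
    · rw [one_mul]
    · rw [LinearMap.zero_apply, extend_zero, zero_mul]
  · have h0 : extend (semE O κ ν φ) T = 0 := by rw [extend_semE, if_neg h]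
    rw [h0, mul_zero]
    split_ifs
    · exact h0
    · rw [LinearMap.zero_apply, extend_zero]

theorem semX_semP {z : F} (hP : IsPartitionOf n lam) (hz : z ≠ 0) (hz2 : (2 : F) ≠ 0) {r : ℕ}
    (h1 : 1 ≤ r) (h2 : r + 1 ≤ n) (ν : Fin n → ℕ) :
    (semX O κ z r * semP O κ z r * semE O κ ν : Module.End O (StdTab n lam → F)) =
      semP O κ z r * semX O κ z (r + 1) * semE O κ ν -
        if seqAt ν r = seqAt ν (r + 1) then semE O κ ν else 0 := by
  classical
  refine extend_inj fun φ T hT => ?_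
  rw [LinearMap.sub_apply, extend_sub, extend_ite hT h1 h2,
    ← aVal_mul_sub hz hz2 (dg_ne hP hT h1 (by omega) (by omega) h2)]
  simp only [Module.End.mul_apply, extend_semP h1 h2, extend_semX h1 (by omega : r ≤ n),
    extend_semX (by omega : 1 ≤ r + 1) h2, dg_sw_right]
  ring

theorem semX'_semP {z : F} (hP : IsPartitionOf n lam) (hz : z ≠ 0) (hz2 : (2 : F) ≠ 0) {r : ℕ}
    (h1 : 1 ≤ r) (h2 : r + 1 ≤ n) (ν : Fin n → ℕ) :
    (semX O κ z (r + 1) * semP O κ z r * semE O κ ν : Module.End O (StdTab n lam → F)) =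
      semP O κ z r * semX O κ z r * semE O κ ν +
        if seqAt ν r = seqAt ν (r + 1) then semE O κ ν else 0 := by
  classical
  refine extend_inj fun φ T hT => ?_
  rw [LinearMap.add_apply, extend_add, extend_ite hT h1 h2,
    ← aVal_mul_sub hz hz2 (dg_ne hP hT h1 (by omega) (by omega) h2)]
  simp only [Module.End.mul_apply, extend_semP h1 h2, extend_semX h1 (by omega : r ≤ n),
    extend_semX (by omega : 1 ≤ r + 1) h2, dg_sw_left]
  ring

theorem semP_sq {z : F} {r : ℕ} (h1 : 1 ≤ r) (h2 : r + 1 ≤ n) (ν : Fin n → ℕ) :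
    (semP O κ z r * semP O κ z r * semE O κ ν : Module.End O (StdTab n lam → F)) =
      quivPoly (seqAt ν r) (seqAt ν (r + 1)) (semX O κ z r) (semX O κ z (r + 1)) *
        semE O κ ν := by
  classical
  refine extend_inj fun φ T hT => ?_
  simp only [Module.End.mul_apply]
  rw [extend_quivPoly h1 (by omega) (by omega) h2, extend_semP h1 h2, extend_semP h1 h2,
    extend_semP h1 h2, dg_sw_left, dg_sw_right, sw_sw, aVal_symm z (dg κ lam T r)]
  have := sq_add_bVal_mul z (dg κ lam T r) (dg κ lam T (r + 1))
  by_cases h : IsRes κ lam ν T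
  · rw [h.seqAt_eq hT.isTabN h1 (by omega), h.seqAt_eq hT.isTabN (by omega) h2, ← this]
    ring
  · rw [extend_semE, if_neg h]
    ring

theorem semP_braid {z : F} (hP : IsPartitionOf n lam) (hz : z ≠ 0) (hz2 : (2 : F) ≠ 0) {r : ℕ}
    (h1 : 1 ≤ r) (h2 : r + 2 ≤ n) (ν : Fin n → ℕ) :
    ((semP O κ z (r + 1) * semP O κ z r * semP O κ z (r + 1) -
      semP O κ z r * semP O κ z (r + 1) * semP O κ z r) * semE O κ ν :
        Module.End O (StdTab n lam → F)) =
      if seqAt ν r = seqAt ν (r + 2) then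
        quivDiff (seqAt ν r) (seqAt ν (r + 1)) (semX O κ z r) (semX O κ z (r + 2)) * semE O κ ν
      else 0 := by
  classical
  refine extend_inj fun φ T hT => ?_
  have hde := dg_ne (κ := κ) hP hT h1 (by omega : r < r + 1) (by omega) (by omega)
  have hef := dg_ne (κ := κ) hP hT (by omega) (by omega : r + 1 < r + 2) (by omega) (by omega)
  have hdf := dg_ne (κ := κ) hP hT h1 (by omega : r < r + 2) (by omega) (by omega)
  have hbr := aVal_braid hz hz2 hde hef hdf
  have hL : extend ((if seqAt ν r = seqAt ν (r + 2) then
        quivDiff (seqAt ν r) (seqAt ν (r + 1)) (semX O κ z r) (semX O κ z (r + 2)) * semE O κ ν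
      else 0 : Module.End O (StdTab n lam → F)) φ) T =
      (if (dg κ lam T r).natAbs = (dg κ lam T (r + 2)).natAbs then
        quivDiff (dg κ lam T r).natAbs (dg κ lam T (r + 1)).natAbs (cVal z (dg κ lam T r))
          (cVal z (dg κ lam T (r + 2))) else 0) * extend (semE O κ ν φ) T := by
    by_cases h : IsRes κ lam ν T
    · rw [← h.seqAt_eq hT.isTabN h1 (by omega), ← h.seqAt_eq hT.isTabN (by omega : 1 ≤ r + 1)
        (by omega), ← h.seqAt_eq hT.isTabN (by omega : 1 ≤ r + 2) (by omega)]
      split_ifs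
      · rw [Module.End.mul_apply, extend_quivDiff h1 (by omega) (by omega) h2]
      · rw [LinearMap.zero_apply, extend_zero, zero_mul]
    · have h0 : extend (semE O κ ν φ) T = 0 := by rw [extend_semE, if_neg h]
      rw [h0, mul_zero]
      split_ifs
      · rw [Module.End.mul_apply, extend_quivDiff h1 (by omega) (by omega) h2, h0, mul_zero]
      · rw [LinearMap.zero_apply, extend_zero]
  rw [hL, ← hbr]
  have h2' : r + 1 + 1 ≤ n := h2
  have h1' : 1 ≤ r + 1 := by omega
  have e0 : ∀ U, dg κ lam (sw (r + 1) U) r = dg κ lam U r := fun U =>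
    dg_sw_ne U (by omega) (by omega)
  have e1 : ∀ U, dg κ lam (sw r U) (r + 1 + 1) = dg κ lam U (r + 1 + 1) := fun U =>
    dg_sw_ne U (by omega) (by omega)
  simp only [Module.End.mul_apply, LinearMap.sub_apply, extend_sub,
    extend_semP h1 (by omega : r + 1 ≤ n), extend_semP h1' h2', dg_sw_left, dg_sw_right, e0, e1,
    sw_sw, sw_braid]
  have hm := aVal_mul_aVal z hde hef hdf
  simp only [show r + 2 = r + 1 + 1 from rfl] at hm ⊢
  simp only [aVal_symm z (dg κ lam T r) (dg κ lam T (r + 1)),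
    aVal_symm z (dg κ lam T (r + 1)) (dg κ lam T (r + 1 + 1))]
  linear_combination (bVal z (dg κ lam T (r + 1)) (dg κ lam T (r + 1 + 1)) *
    extend (semE O κ ν φ) (sw (r + 1) T) - bVal z (dg κ lam T r) (dg κ lam T (r + 1)) *
    extend (semE O κ ν φ) (sw r T)) * hm

theorem semX_semE {z : F} (r : ℕ) (ν : Fin n → ℕ) :
    (semX O κ z r * semE O κ ν : Module.End O (StdTab n lam → F)) =
      semE O κ ν * semX O κ z r := by
  classical
  by_cases hr : 1 ≤ r ∧ r ≤ n
  swap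
  · rw [semX_zero (by omega), zero_mul, mul_zero]
  refine extend_inj fun φ T hT => ?_
  simp only [Module.End.mul_apply, extend_semX hr.1 hr.2, extend_semE]
  split_ifs <;> simp

theorem semX_semX {z : F} (r s : ℕ) :
    (semX O κ z r * semX O κ z s : Module.End O (StdTab n lam → F)) =
      semX O κ z s * semX O κ z r := by
  by_cases hr : 1 ≤ r ∧ r ≤ n
  swap
  · rw [semX_zero (r := r) (by omega), zero_mul, mul_zero]
  by_cases hs : 1 ≤ s ∧ s ≤ n
  swap
  · rw [semX_zero (r := s) (by omega), zero_mul, mul_zero]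
  refine extend_inj fun φ T hT => ?_
  simp only [Module.End.mul_apply, extend_semX hr.1 hr.2, extend_semX hs.1 hs.2]
  ring

theorem semE_semE (ν ν' : Fin n → ℕ) :
    (semE O κ ν * semE O κ ν' : Module.End O (StdTab n lam → F)) =
      if ν = ν' then semE O κ ν else 0 := by
  classical
  refine extend_inj fun φ T hT => ?_
  simp only [Module.End.mul_apply, extend_semE]
  by_cases h : ν = ν'
  · subst h
    rw [if_pos rfl, extend_semE]
    split_ifs <;> rfl
  · rw [if_neg h, LinearMap.zero_apply, extend_zero]
    split_ifs with h1 h2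
    · exact absurd (IsRes.unique hT.isTabN h1 h2) h
    · rfl
    · rfl

theorem exists_isRes (hex : ∀ T, IsStdN n lam T → ∃ L, Red n lam L T) (h0 : IsRes κ lam ν₀ (iniTab lam))
    {T : PNode → ℕ} (hT : IsStdN n lam T) : ∃ μ ∈ cls ν₀, IsRes κ lam μ T := by
  obtain ⟨L, hL⟩ := hex T hT
  rw [hL.eq_tab]
  exact exists_isRes_tab h0 hL.isWord

theorem semE_eq_zero (hex : ∀ T, IsStdN n lam T → ∃ L, Red n lam L T) (h0 : IsRes κ lam ν₀ (iniTab lam))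
    {ν : Fin n → ℕ} (hν : ν ∉ cls ν₀) :
    (semE O κ ν : Module.End O (StdTab n lam → F)) = 0 := by
  classical
  refine extend_inj fun φ T hT => ?_
  rw [extend_semE, LinearMap.zero_apply, extend_zero, if_neg]
  obtain ⟨μ, hμ, hr⟩ := exists_isRes hex h0 hT
  exact fun h => hν (IsRes.unique hT.isTabN hr h ▸ hμ)

theorem sum_semE (hex : ∀ T, IsStdN n lam T → ∃ L, Red n lam L T) (h0 : IsRes κ lam ν₀ (iniTab lam)) :
    ∑ ν ∈ cls ν₀, (semE O κ ν : Module.End O (StdTab n lam → F)) = 1 := by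
  classical
  refine LinearMap.ext fun φ => funext fun T => ?_
  obtain ⟨μ, hμ, hr⟩ := exists_isRes hex h0 T.2
  rw [LinearMap.sum_apply, Finset.sum_apply, Finset.sum_eq_single_of_mem μ hμ]
  · exact if_pos hr
  · exact fun ν _ hne => if_neg fun h => hne (IsRes.unique T.2.isTabN h hr)

variable (O) in
/-- The seminormal representation of the quiver Hecke algebra relations. -/
noncomputable def seminormal (κ : ℤ) {z : F} (hP : IsPartitionOf n lam)
    (hex : ∀ T, IsStdN n lam T → ∃ L, Red n lam L T) (h0 : IsRes κ lam ν₀ (iniTab lam))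
    (hz : z ≠ 0) (hz2 : (2 : F) ≠ 0) : HeckeOps ν₀ (Module.End O (StdTab n lam → F)) where
  e := semE O κ
  x := semX O κ z
  p := semP O κ z
  idem := semE_semE
  support _ h := semE_eq_zero hex h0 h
  total := sum_semE hex h0
  xzero _ h := semX_zero h
  pzero _ h := semP_zero h
  xe := semX_semE
  pe _ h1 h2 ν := semP_semE h1 h2 ν
  xx := semX_semX
  px _ _ h h' := semP_semX_far h h'
  pp _ _ h := semP_semP_far h
  xp _ h1 h2 ν := semX_semP hP hz hz2 h1 h2 ν
  xp' _ h1 h2 ν := semX'_semP hP hz hz2 h1 h2 ν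
  psq _ h1 h2 ν := semP_sq h1 h2 ν
  braid _ h1 h2 ν := semP_braid hP hz hz2 h1 h2 ν

end Seminormal

section InitialVector

variable {n : ℕ} {lam : ℕ → ℕ} {κ : ℤ} {ν₀ : Fin n → ℕ} {F : Type*} [Field F]
  {O : Type*} [CommRing O] [Algebra O F] {z : F}

open Classical in
/-- The indicator function of the initial tableau. -/
noncomputable def iniVec (n : ℕ) (lam : ℕ → ℕ) (F : Type*) [Field F] : StdTab n lam → F :=
  fun T => if T.1 = iniTab lam then 1 else 0

theorem extend_iniVec_self (hP : IsPartitionOf n lam) :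
    extend (iniVec n lam F) (iniTab lam) = 1 := by
  rw [extend, dif_pos (iniTab_isStdN hP), iniVec, if_pos rfl]

theorem extend_iniVec_ne {T : PNode → ℕ} (hT : T ≠ iniTab lam) :
    extend (iniVec n lam F) T = 0 := by
  by_cases h : IsStdN n lam T
  · rw [extend, dif_pos h, iniVec, if_neg hT]
  · exact extend_of_not _ h

variable (hP : IsPartitionOf n lam) (hex : ∀ T, IsStdN n lam T → ∃ L, Red n lam L T)
  (h0 : IsRes κ lam ν₀ (iniTab lam)) (hz : z ≠ 0) (hz2 : (2 : F) ≠ 0)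

/-- A word moving the initial vector to `T` has a subword moving the initial tableau to `T`. -/
theorem exists_sublist_of_extend {L : List ℕ} (hL : IsWord n L) {T : PNode → ℕ}
    (h : extend ((seminormal O κ hP hex h0 hz hz2).psi L (iniVec n lam F)) T ≠ 0) :
    ∃ L' : List ℕ, L'.Sublist L ∧ T = tab lam L' := by
  induction L generalizing T with
  | nil =>
    refine ⟨[], List.Sublist.refl _, ?_⟩
    by_contra hne
    exact h (extend_iniVec_ne hne)
  | cons r L ih =>
    rw [HeckeOps.psi_cons, Module.End.mul_apply] at h
    change extend (semP O κ z r _) T ≠ 0 at h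
    rw [extend_semP hL.head.1 hL.head.2] at h
    by_cases h1 : extend ((seminormal O κ hP hex h0 hz hz2).psi L (iniVec n lam F)) T = 0
    · rw [h1, mul_zero, zero_add] at h
      obtain ⟨L', hs, hT⟩ := ih hL.of_cons (right_ne_zero_of_mul h)
      exact ⟨r :: L', hs.cons_cons r, by rw [tab_cons, ← hT, sw_sw]⟩
    · obtain ⟨L', hs, hT⟩ := ih hL.of_cons h1
      exact ⟨L', hs.cons r, hT⟩

theorem isWord_of_sublist {L L' : List ℕ} (hL : IsWord n L) (h : L'.Sublist L) : IsWord n L' :=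
  fun i hi => hL i (h.subset hi)

theorem eq_or_len_lt_of_extend {L : List ℕ} {T U : PNode → ℕ} (hL : Red n lam L T)
    (h : extend ((seminormal O κ hP hex h0 hz hz2).psi L (iniVec n lam F)) U ≠ 0) :
    U = T ∨ len n lam U < len n lam T := by
  obtain ⟨L', hs, rfl⟩ := exists_sublist_of_extend hP hex h0 hz hz2 hL.isWord h
  by_cases he : L'.length = L.length
  · left
    rw [hs.eq_of_length he, ← hL.eq_tab]
  · right
    have h1 := hs.length_le
    have h2 := len_tab_le hP (isWord_of_sublist hL.isWord hs)
    rw [hL.len_eq hP]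
    omega

theorem extend_psi_ne_zero {L : List ℕ} {T : PNode → ℕ} (hL : Red n lam L T) :
    extend ((seminormal O κ hP hex h0 hz hz2).psi L (iniVec n lam F)) T ≠ 0 := by
  induction hL with
  | nil =>
    rw [HeckeOps.psi_nil, Module.End.one_apply, extend_iniVec_self hP]
    exact one_ne_zero
  | @cons r L T hT hd hL ih =>
    obtain ⟨h1, h2⟩ := hd.range hT.isTabN
    have hlen := hd.len_eq hP hT.isTabN
    have hz0 : extend ((seminormal O κ hP hex h0 hz hz2).psi L (iniVec n lam F)) T = 0 := by
      by_contra hne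
      rcases eq_or_len_lt_of_extend hP hex h0 hz hz2 hL hne with h | h
      · rw [← h] at hlen
        omega
      · omega
    rw [HeckeOps.psi_cons, Module.End.mul_apply]
    change extend (semP O κ z r _) T ≠ 0
    rw [extend_semP h1 h2, hz0, mul_zero, zero_add]
    refine mul_ne_zero ?_ ih
    obtain ⟨x, hx, y, hy, hTx, hTy, hlt⟩ := hd
    have hadj : ∀ (_ : dgn κ y ≤ dgn κ x + 1) (_ : dgn κ x ≤ dgn κ y + 1), False := by
      intro h3 h4
      rw [itab_lt_iff hx hy] at hlt
      rcases adj_of_dgn hP hT hy hx (by omega) h3 h4 with h | h <;>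
        · rw [h.1] at hlt
          simp at hlt
    rw [← hTx, ← hTy, dg_eq hT.isTabN hx, dg_eq hT.isTabN hy]
    have h5 := fun h3 h4 => hadj h3 h4
    apply bVal_ne_zero hz hz2 <;> intro h <;> exact hadj (by omega) (by omega)

theorem linearIndependent_psi (hinj : Function.Injective (algebraMap O F))
    {w : StdTab n lam → List ℕ} (hw : ∀ T, Red n lam (w T) T.1) :
    LinearIndependent O fun T =>
      (seminormal O κ hP hex h0 hz hz2).psi (w T) (iniVec n lam F) := by
  classical
  rw [linearIndependent_iff']
  intro s g hg
  by_contra! hne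
  obtain ⟨T₀, hT₀, hgT₀⟩ := hne
  obtain ⟨T, hT, hmax⟩ := (s.filter fun T => g T ≠ 0).exists_max_image
    (fun T => len n lam T.1) ⟨T₀, by simp [hT₀, hgT₀]⟩
  rw [Finset.mem_filter] at hT
  have h1 := congrFun hg T
  rw [Finset.sum_apply, Finset.sum_eq_single_of_mem T hT.1] at h1
  · rw [Pi.smul_apply, Algebra.smul_def, Pi.zero_apply, mul_eq_zero] at h1
    rcases h1 with h1 | h1
    · exact hT.2 (hinj (h1.trans (map_zero _).symm))
    · exact extend_psi_ne_zero hP hex h0 hz hz2 (hw T) ((extend_of_std _ T).trans h1)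
  · intro U hU hne
    by_cases hgU : g U = 0
    · rw [hgU, zero_smul, Pi.zero_apply]
    by_contra hc
    rcases eq_or_len_lt_of_extend hP hex h0 hz hz2 (hw U) (U := T.1)
      (fun h => hc (by rw [extend_of_std] at h; rw [Pi.smul_apply, h, smul_zero])) with h | h
    · exact hne (Subtype.ext h.symm)
    · exact absurd (hmax U (by simp [hU, hgU])) (not_le.2 h)

theorem semX_iniVec (zO : O) (hzO : algebraMap O F zO = z) (r : ℕ) :
    semX O κ z r (iniVec n lam F) =
      (if 1 ≤ r ∧ r ≤ n then cVal zO (dg κ lam (iniTab lam) r) else 0) • iniVec n lam F := by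
  funext T
  rw [Pi.smul_apply, Algebra.smul_def]
  change (if 1 ≤ r ∧ r ≤ n then _ else _) = _
  split_ifs with h
  · rw [map_cVal, hzO]
    by_cases hT : T.1 = iniTab lam
    · rw [hT]
    · rw [show iniVec n lam F T = 0 from if_neg hT, mul_zero, mul_zero]
  · rw [map_zero, zero_mul]

theorem iniVec_row (hP : IsPartitionOf n lam) {a b : ℕ} (h1 : (a, b) ∈ diag lam)
    (h2 : (a, b + 1) ∈ diag lam) : semP O κ z (itab lam (a, b)) (iniVec n lam F) = 0 := by
  have e : itab lam (a, b + 1) = itab lam (a, b) + 1 := by simp only [itab]; omega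
  have m1 := ((itab_isTab hP).mapsTo h1).1
  have m2 := ((itab_isTab hP).mapsTo h2).2
  rw [e] at m2
  funext T
  refine (extend_of_std _ T).symm.trans ?_
  rw [extend_semP m1 m2, Pi.zero_apply]
  have hs : extend (iniVec n lam F) (sw (itab lam (a, b)) T.1) = 0 := by
    refine extend_iniVec_ne fun h => ?_
    have hT : T.1 = sw (itab lam (a, b)) (iniTab lam) := by rw [← h, sw_sw]
    have hlt := T.2.1.2.1 a b h1 h2
    rw [hT, sw_apply, sw_apply, iniTab_of_mem h1, iniTab_of_mem h2, e] at hlt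
    simp at hlt
  rw [hs, mul_zero, add_zero]
  by_cases hT : T.1 = iniTab lam
  · rw [aVal_of_ne, zero_mul]
    have i1 := dg_eq (κ := κ) (iniTab_isTabN hP) h1
    have i2 := dg_eq (κ := κ) (iniTab_isTabN hP) h2
    rw [iniTab_of_mem h1] at i1
    rw [iniTab_of_mem h2, e] at i2
    rw [hT, i1, i2]
    simp only [dgn]
    push_cast
    omega
  · rw [extend_iniVec_ne hT, mul_zero]

theorem wordProd_mem_Ioc {lo hi : ℕ} {L : List ℕ} (hL : ∀ i ∈ L, lo < i ∧ i + 1 ≤ hi) {p : ℕ}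
    (h : lo < p ∧ p ≤ hi) : lo < wordProd L p ∧ wordProd L p ≤ hi := by
  induction L with
  | nil => exact h
  | cons r L ih =>
    rw [wordProd_cons, sgen_apply]
    have h1 := ih fun i hi => hL i (List.mem_cons_of_mem _ hi)
    have h2 := hL r List.mem_cons_self
    split_ifs <;> omega

/-- No standard tableau obtained by permuting the entries in a Garnir belt has the residue
sequence of the Garnir tableau. -/
theorem not_isRes_garnir (hP : IsPartitionOf n lam) {a c : ℕ} (hg : IsGarnir lam a c)
    {T : PNode → ℕ} (hT : IsStdN n lam T)
    (hbelt : ∀ x ∈ diag lam, goff lam a c < itab lam x →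
      itab lam x ≤ goff lam a c + (lam a - c + 1) + c →
      goff lam a c < T x ∧ T x ≤ goff lam a c + (lam a - c + 1) + c)
    {μ : Fin n → ℕ} (hμ : IsRes κ lam μ (tab lam (garnirWord lam a c)))
    (hμT : IsRes κ lam μ T) : False := by
  have hc := garnir_pos hg
  have hcl := garnir_le hg
  have ha : 1 ≤ a := hg.1.1
  set off := goff lam a c with hoff
  have hrow : ∀ d, c ≤ d → itab lam (a, d) = off + (d - c + 1) := by
    intro d hd
    simp only [hoff, itab, goff]
    omega
  have hbel : ∀ d, itab lam (a + 1, d) = off + (lam a - c + 1) + d := fun d =>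
    itab_garnir_below hg
  have hmr : ∀ d, c ≤ d → d ≤ lam a → (a, d) ∈ diag lam := fun d h1 h2 => ⟨ha, hc.trans h1, h2⟩
  have hmb : ∀ d, 1 ≤ d → d ≤ c → (a + 1, d) ∈ diag lam := fun d h1 h2 =>
    ⟨by simp, h1, h2.trans hg.2.2.2⟩
  -- the residue sequence on the belt
  have hres : ∀ j, 1 ≤ j → j ≤ lam a - c + 1 + c →
      seqAt μ (off + j) = (κ + j - a - 1).natAbs := by
    intro j hj1 hj2
    by_cases hj : j ≤ c
    · have := hμ _ (hmb j hj1 hj)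
      rw [tab_garnirWord a c (hmb j hj1 hj), hbel, if_neg (by omega), if_pos (by omega)] at this
      rw [show off + j = off + (lam a - c + 1) + j - (lam a - c + 1) by omega, this, res]
      congr 1
      push_cast
      ring
    · have hm := hmr (j - 1) (by omega) (by omega)
      have := hμ _ hm
      rw [tab_garnirWord a c hm, hrow _ (by omega), if_pos (by omega)] at this
      rw [show off + j = off + (j - 1 - c + 1) + c by omega, this, res]
      congr 1
      simp only
      omega
  have hTr : ∀ d, c ≤ d → d ≤ lam a → off < T (a, d) ∧ T (a, d) ≤ off + (lam a - c + 1) + c := by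
    intro d h1 h2
    refine hbelt _ (hmr d h1 h2) ?_ ?_ <;> rw [hrow d h1] <;> omega
  have hTb : ∀ d, 1 ≤ d → d ≤ c →
      off < T (a + 1, d) ∧ T (a + 1, d) ≤ off + (lam a - c + 1) + c := by
    intro d h1 h2
    refine hbelt _ (hmb d h1 h2) ?_ ?_ <;> rw [hbel d] <;> omega
  have hAB := hT.1.2.2 a c hg.1 hg.2
  have hA := hTr c le_rfl hcl
  have hB := hTb c hc le_rfl
  have hBlow : off + c + 1 ≤ T (a + 1, c) := by
    have := Finset.card_le_card_of_injOn (s := insert (a, c) ((Finset.Icc 1 c).image (Prod.mk (a + 1))))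
      (t := Finset.Ioc off (T (a + 1, c))) T ?_ ?_
    · rw [Finset.card_insert_of_notMem (by simp), Finset.card_image_of_injective _
        (Prod.mk_right_injective _), Nat.card_Icc, Nat.card_Ioc] at this
      omega
    · intro x hx
      simp only [Finset.coe_insert, Finset.coe_image, Finset.coe_Icc, Set.mem_insert_iff,
        Set.mem_image, Set.mem_Icc] at hx
      simp only [Finset.coe_Ioc, Set.mem_Ioc]
      rcases hx with rfl | ⟨d, hd, rfl⟩
      · omega
      · exact ⟨(hTb d hd.1 hd.2).1, std_le_row hP hT hd.1 hd.2 hg.2⟩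
    · refine hT.1.1.injOn.mono ?_
      intro x hx
      simp only [Finset.coe_insert, Finset.coe_image, Finset.coe_Icc, Set.mem_insert_iff,
        Set.mem_image, Set.mem_Icc] at hx
      rcases hx with rfl | ⟨d, hd, rfl⟩
      · exact hg.1
      · exact hmb d hd.1 hd.2
  have hAup : T (a, c) ≤ off + c := by
    have := Finset.card_le_card_of_injOn
      (s := insert (a + 1, c) ((Finset.Icc c (lam a)).image (Prod.mk a)))
      (t := Finset.Icc (T (a, c)) (off + (lam a - c + 1) + c)) T ?_ ?_
    · rw [Finset.card_insert_of_notMem (by simp), Finset.card_image_of_injective _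
        (Prod.mk_right_injective _), Nat.card_Icc, Nat.card_Icc] at this
      omega
    · intro x hx
      simp only [Finset.coe_insert, Finset.coe_image, Finset.coe_Icc, Set.mem_insert_iff,
        Set.mem_image, Set.mem_Icc] at hx
      simp only [Finset.coe_Icc, Set.mem_Icc]
      rcases hx with rfl | ⟨d, hd, rfl⟩
      · omega
      · exact ⟨std_le_row hP hT hc hd.1 (hmr d hd.1 hd.2), (hTr d hd.1 hd.2).2⟩
    · refine hT.1.1.injOn.mono ?_
      intro x hx
      simp only [Finset.coe_insert, Finset.coe_image, Finset.coe_Icc, Set.mem_insert_iff,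
        Set.mem_image, Set.mem_Icc] at hx
      rcases hx with rfl | ⟨d, hd, rfl⟩
      · exact hg.2
      · exact hmr d hd.1 hd.2
  have rA := hμT _ hg.1
  have rB := hμT _ hg.2
  obtain ⟨jA, hjA⟩ := Nat.exists_eq_add_of_lt hA.1
  obtain ⟨jB, hjB⟩ := Nat.exists_eq_add_of_lt hB.1
  rw [hjA, add_assoc, hres (jA + 1) (by omega) (by omega), res] at rA
  rw [hjB, add_assoc, hres (jB + 1) (by omega) (by omega), res] at rB
  push_cast at rA rB
  omega

theorem semE_iniVec (h0 : IsRes κ lam ν₀ (iniTab lam)) : semE O κ ν₀ (iniVec n lam F) = iniVec n lam F := by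
  classical
  funext T
  change (if _ then _ else _) = _
  split_ifs with h
  · rfl
  · exact (if_neg fun hT : T.1 = iniTab lam => h (hT ▸ h0)).symm

theorem iniVec_garnir {a c : ℕ} (hg : IsGarnir lam a c) :
    (seminormal O κ hP hex h0 hz hz2).psi (garnirWord lam a c) (iniVec n lam F) = 0 := by
  classical
  have hw := garnirWord_isWord hP hg
  funext T
  refine (extend_of_std _ T).symm.trans ?_
  by_contra hne
  obtain ⟨L', hs, hT⟩ := exists_sublist_of_extend hP hex h0 hz hz2 hw hne
  obtain ⟨μ, -, hμ⟩ := exists_isRes_tab h0 hw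
  have he : (seminormal O κ hP hex h0 hz hz2).e ν₀ (iniVec n lam F) = iniVec n lam F :=
    semE_iniVec h0
  rw [← e_psi he h0 hP hw hμ] at hne
  change extend (semE O κ μ _) T.1 ≠ 0 at hne
  rw [extend_semE] at hne
  refine not_isRes_garnir hP hg T.2 (fun x hx h1 h2 => ?_) hμ (by
    by_contra h
    exact hne (if_neg h))
  rw [hT, tab, iniTab_of_mem hx]
  refine wordProd_mem_Ioc (fun i hi => ?_) ⟨h1, h2⟩
  have := hs.subset hi
  rw [garnirWord_eq, List.mem_map] at this
  obtain ⟨j, hj, rfl⟩ := this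
  have := mem_wordW hj
  omega

theorem spechtVec_iniVec (zO : O) (hzO : algebraMap O F zO = z) :
    SpechtVec (seminormal O κ hP hex h0 hz hz2) lam (iniVec n lam F) where
  e_eq := semE_iniVec h0
  x_mem r := ⟨_, semX_iniVec zO hzO r⟩
  row _ _ h1 h2 := iniVec_row hP h1 h2
  garnir _ _ hg := iniVec_garnir hP hex h0 hz hz2 hg

end InitialVector

section BaseChange

namespace HeckeOps

variable {n : ℕ} {ν₀ : Fin n → ℕ}

/-- Operators that map to operators satisfying the relations under an injective ring
homomorphism satisfy the relations. -/
def ofInjective {A B : Type*} [Ring A] [Ring B] (f : B →+* A) (hf : Function.Injective f)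
    (h : HeckeOps ν₀ A) (e : (Fin n → ℕ) → B) (x p : ℕ → B) (he : ∀ ν, f (e ν) = h.e ν)
    (hx : ∀ r, f (x r) = h.x r) (hp : ∀ r, f (p r) = h.p r) : HeckeOps ν₀ B where
  e := e
  x := x
  p := p
  idem ν ν' := hf (by rw [map_mul, he, he, h.idem]; split_ifs <;> simp [he])
  support ν hν := hf (by rw [he, h.support ν hν, map_zero])
  total := hf (by simp only [map_sum, he, h.total, map_one])
  xzero r hr := hf (by rw [hx, h.xzero r hr, map_zero])
  pzero r hr := hf (by rw [hp, h.pzero r hr, map_zero])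
  xe r ν := hf (by simp only [map_mul, hx, he, h.xe])
  pe r h1 h2 ν := hf (by simp only [map_mul, hp, he, h.pe r h1 h2])
  xx r s := hf (by rw [map_mul, map_mul, hx, hx, h.xx])
  px r s h1 h2 := hf (by rw [map_mul, map_mul, hx, hp, h.px r s h1 h2])
  pp r s h1 := hf (by rw [map_mul, map_mul, hp, hp, h.pp r s h1])
  xp r h1 h2 ν := hf (by
    simp only [map_mul, map_sub, hx, hp, he, h.xp r h1 h2]; split_ifs <;> simp [he])
  xp' r h1 h2 ν := hf (by
    simp only [map_mul, map_add, hx, hp, he, h.xp' r h1 h2]; split_ifs <;> simp [he])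
  psq r h1 h2 ν := hf (by
    simp only [map_mul, hx, hp, he, h.psq r h1 h2, map_quivPoly])
  braid r h1 h2 ν := hf (by
    simp only [map_mul, map_sub, hp, he, h.braid r h1 h2]
    split_ifs <;> simp [he, hx, map_quivDiff])

end HeckeOps

variable {ι O M k : Type*} [CommRing O] [AddCommGroup M] [Module O M] [CommRing k]

/-- The ring of endomorphisms preserving a submodule. -/
def stabilizer (L : Submodule O M) : Subring (Module.End O M) where
  carrier := {f | ∀ y ∈ L, f y ∈ L}
  mul_mem' hf hg y hy := hf _ (hg y hy)
  one_mem' _ hy := hy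
  add_mem' hf hg y hy := L.add_mem (hf y hy) (hg y hy)
  zero_mem' _ _ := L.zero_mem
  neg_mem' hf y hy := L.neg_mem (hf y hy)

/-- Restriction of endomorphisms preserving a submodule. -/
def restrictHom (L : Submodule O M) : stabilizer L →+* Module.End O L where
  toFun f := f.1.restrict f.2
  map_one' := rfl
  map_mul' _ _ := rfl
  map_zero' := rfl
  map_add' _ _ := rfl

variable [Fintype ι] [DecidableEq ι]

/-- Base change of the endomorphisms preserving the span of a linearly independent family. -/
noncomputable def specialise {v : ι → M} (hv : LinearIndependent O v) (φ : O →+* k) :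
    stabilizer (Submodule.span O (Set.range v)) →+* Module.End k (ι → k) :=
  (Matrix.toLinAlgEquiv' (R := k) (n := ι)).toRingEquiv.toRingHom.comp
    (φ.mapMatrix.comp
      ((LinearMap.toMatrixAlgEquiv (Module.Basis.span hv)).toRingEquiv.toRingHom.comp
        (restrictHom _)))

theorem specialise_single {v : ι → M} (hv : LinearIndependent O v) (φ : O →+* k)
    (s : stabilizer (Submodule.span O (Set.range v))) {i j : ι} {a : O}
    (h : s.1 (v i) = a • v j) :
    specialise hv φ s (Pi.single i 1) = φ a • Pi.single j 1 := by
  have key : restrictHom _ s (Module.Basis.span hv i) = a • Module.Basis.span hv j := by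
    apply Subtype.ext
    change s.1 (Module.Basis.span hv i : M) = a • (Module.Basis.span hv j : M)
    rw [Module.Basis.span_apply, Module.Basis.span_apply, h]
  change Matrix.toLin' _ _ = _
  rw [Matrix.toLin'_apply, Matrix.mulVec_single_one]
  funext l
  change φ (LinearMap.toMatrixAlgEquiv (Module.Basis.span hv) (restrictHom _ s) l i) = _
  rw [LinearMap.toMatrixAlgEquiv_apply, key, map_smul, Module.Basis.repr_self]
  rw [Finsupp.smul_apply, Finsupp.single_apply, Pi.smul_apply, Pi.single_apply]
  by_cases hl : j = l
  · simp [hl]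
  · simp [hl, Ne.symm hl]

end BaseChange

section Independence

variable {n : ℕ} {lam : ℕ → ℕ} {κ : ℤ} {ν₀ : Fin n → ℕ}

theorem finite_stdTab (hP : IsPartitionOf n lam) : Finite (StdTab n lam) := by
  refine Finite.of_injective
    (fun T : StdTab n lam => fun x : diagF n lam => (⟨T.1 x, ?_⟩ : Fin (n + 1))) ?_
  · have := T.2.1.1.mapsTo ((mem_diagF hP).1 x.2)
    exact Nat.lt_succ_of_le this.2
  · intro T U h
    refine Subtype.ext (funext fun x => ?_)
    by_cases hx : x ∈ diag lam
    · have := congrFun h ⟨x, (mem_diagF hP).2 hx⟩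
      simpa using this
    · rw [T.2.2 x hx, U.2.2 x hx]

namespace HeckeOps

section Stable

variable {O M : Type*} [CommRing O] [AddCommGroup M] [Module O M]

theorem stdSpan_eq (hP : IsPartitionOf n lam) (h : HeckeOps ν₀ (Module.End O M)) {m : M}
    (hex : ∀ T, IsStdN n lam T → ∃ L, Red n lam L T)
    (hm : SpechtVec h lam m) (h0 : IsRes κ lam ν₀ (iniTab lam))
    {w : StdTab n lam → List ℕ} (hw : ∀ T, Red n lam (w T) T.1) :
    stdSpan h lam m = Submodule.span O (Set.range fun T => h.psi (w T) m) := by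
  refine congrArg _ (Set.ext fun v => ⟨?_, ?_⟩)
  · rintro ⟨L, T, hL, rfl⟩
    exact ⟨⟨T, hL.isStdN hP⟩, psi_eq_of_red hP hex hm h0 (hw _) hL⟩
  · rintro ⟨T, rfl⟩
    exact ⟨w T, T.1, hw T, rfl⟩

/-- The operators on a module preserve the span of the standard vectors. -/
def ofStable (h : HeckeOps ν₀ (Module.End O M)) {L : Submodule O M}
    (he : ∀ ν, h.e ν ∈ stabilizer L) (hx : ∀ r, h.x r ∈ stabilizer L)
    (hp : ∀ r, h.p r ∈ stabilizer L) : HeckeOps ν₀ (stabilizer L) :=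
  ofInjective (stabilizer L).subtype Subtype.coe_injective h (fun ν => ⟨_, he ν⟩)
    (fun r => ⟨_, hx r⟩) (fun r => ⟨_, hp r⟩) (fun _ => rfl) (fun _ => rfl) (fun _ => rfl)

end Stable

end HeckeOps

/-- Vectors annihilated by the relations of the Specht module give rise to a homomorphism. -/
theorem lift_apply_eq_zero {k : Type} [Field k] {V : Type*} [AddCommGroup V] [Module k V]
    (h : HeckeOps ν₀ (Module.End k V)) {v : V} (hm : SpechtVec h lam v)
    (hx : ∀ r, h.x r v = 0) {a : Alg k ν₀} (ha : a ∈ spechtIdeal k ν₀ n lam) :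
    h.lift (k := k) a v = 0 := by
  induction ha using Submodule.span_induction with
  | mem a ha =>
    rcases ha with ((rfl | ⟨i, -, -, rfl⟩) | ⟨r, c, h1, h2, rfl⟩) | ⟨r, c, h1, rfl⟩
    · simp [hm.e_eq]
    · simp [hm.e_eq, hx]
    · simp [hm.e_eq, hm.row r c h1 h2]
    · rw [map_mul, Module.End.mul_apply, HeckeOps.lift_Ee, hm.e_eq, HeckeOps.lift_psiW,
        hm.garnir r c h1]
  | zero => simp
  | add a b _ _ ha hb => rw [map_add, LinearMap.add_apply, ha, hb, add_zero]
  | smul a b _ hb => rw [smul_eq_mul, map_mul, Module.End.mul_apply, hb, map_zero]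

open Polynomial in
/-- Operators over the field `k` for which the standard vectors are the coordinate vectors. -/
theorem exists_spechtVec (k : Type) [Field k] (hP : IsPartitionOf n lam)
    (h0 : IsRes κ lam ν₀ (iniTab lam)) {w : StdTab n lam → List ℕ}
    (hw : ∀ T, Red n lam (w T) T.1) [DecidableEq (StdTab n lam)] :
    ∃ (h : HeckeOps ν₀ (Module.End k (StdTab n lam → k))) (v : StdTab n lam → k),
      SpechtVec h lam v ∧ (∀ r, h.x r v = 0) ∧ ∀ T, h.psi (w T) v = Pi.single T 1 := by
  have := finite_stdTab (n := n) hP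
  have := Fintype.ofFinite (StdTab n lam)
  have hex : ∀ T, IsStdN n lam T → ∃ L, Red n lam L T := fun T hT => ⟨_, hw ⟨T, hT⟩⟩
  have hinj : Function.Injective (algebraMap ℤ[X] (FractionRing ℤ[X])) :=
    IsFractionRing.injective _ _
  have hz : algebraMap ℤ[X] (FractionRing ℤ[X]) X ≠ 0 := fun h =>
    X_ne_zero (hinj (h.trans (map_zero _).symm))
  have hz2 : (2 : FractionRing ℤ[X]) ≠ 0 := by
    intro h
    have : (2 : ℤ[X]) = 0 := hinj (by rw [map_ofNat, h, map_zero])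
    exact two_ne_zero this
  set H := seminormal ℤ[X] κ hP hex h0 hz hz2 with hH
  set m := iniVec n lam (FractionRing ℤ[X])
  have hm : SpechtVec H lam m := spechtVec_iniVec hP hex h0 hz hz2 X rfl
  have hli : LinearIndependent ℤ[X] fun T => H.psi (w T) m :=
    linearIndependent_psi hP hex h0 hz hz2 hinj hw
  have hL := HeckeOps.stdSpan_eq hP H hex hm h0 hw
  have hst : ∀ f : Module.End ℤ[X] (StdTab n lam → FractionRing ℤ[X]),
      (∀ v ∈ stdSpan H lam m, f v ∈ stdSpan H lam m) →
      f ∈ stabilizer (Submodule.span ℤ[X] (Set.range fun T => H.psi (w T) m)) := fun f hf => by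
    rw [← hL]
    exact hf
  set S := H.ofStable (fun ν => hst _ fun _ => e_mem_stdSpan hP hm h0 ν)
    (fun r => hst _ fun _ => x_mem_stdSpan hP hex hm h0 r)
    (fun r => hst _ fun _ => p_mem_stdSpan hP hex hm h0 r)
  have hpsi : ∀ L, (S.psi L).1 = H.psi L := fun L => by
    induction L with
    | nil => rfl
    | cons r L ih =>
      rw [HeckeOps.psi_cons, HeckeOps.psi_cons, ← ih]
      rfl
  let φ : ℤ[X] →+* k := (Int.castRingHom k).comp constantCoeff
  have hφ : φ X = 0 := by simp [φ]
  let t : StdTab n lam := ⟨iniTab lam, iniTab_isStdN hP⟩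
  have ht : w t = [] := by
    rw [← List.length_eq_zero_iff, ← (hw t).len_eq hP, len_iniTab hP]
  have hmt : H.psi (w t) m = m := by rw [ht]; rfl
  let g := specialise hli φ
  have key : ∀ (s : stabilizer (Submodule.span ℤ[X] (Set.range fun T => H.psi (w T) m)))
      {U : StdTab n lam} {a : ℤ[X]}, s.1 m = a • H.psi (w U) m →
      g s (Pi.single t 1) = φ a • Pi.single U 1 := fun s U a h =>
    specialise_single hli φ s (by simp only [hmt]; exact h)
  have key0 : ∀ s : stabilizer (Submodule.span ℤ[X] (Set.range fun T => H.psi (w T) m)),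
      s.1 m = 0 → g s (Pi.single t 1) = 0 := fun s h => by
    rw [key s (U := t) (a := 0) (by rw [h, zero_smul]), map_zero, zero_smul]
  have hx : ∀ r, (S.map g).x r (Pi.single t 1) = 0 := fun r => by
    change g (S.x r) _ = 0
    have h1 : H.x r m = (if 1 ≤ r ∧ r ≤ n then
        cVal (Polynomial.X : ℤ[X]) (dg κ lam (iniTab lam) r) else 0) • m :=
      semX_iniVec _ rfl r
    rw [key (S.x r) (U := t) (by rw [hmt]; exact h1)]
    split_ifs
    · rw [map_cVal, hφ, cVal_zero_left, zero_smul]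
    · rw [map_zero, zero_smul]
  refine ⟨S.map g, Pi.single t 1, ⟨?_, fun r => ⟨0, ?_⟩, fun a b h1 h2 => ?_, fun a b h1 => ?_⟩,
    hx, fun T => ?_⟩
  · refine (key (S.e ν₀) (U := t) (a := 1) ?_).trans (by rw [map_one, one_smul])
    rw [hmt, one_smul]
    exact hm.e_eq
  · rw [hx, zero_smul]
  · exact key0 (S.p _) (hm.row a b h1 h2)
  · rw [HeckeOps.map_psi]
    exact key0 _ (by rw [hpsi]; exact hm.garnir a b h1)
  · rw [HeckeOps.map_psi, key (S.psi (w T)) (U := T) (a := 1) (by rw [hpsi, one_smul]),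
      map_one, one_smul]

theorem linearIndependent_psiW (k : Type) [Field k] (hP : IsPartitionOf n lam)
    (h0 : IsRes κ lam ν₀ (iniTab lam)) {w : StdTab n lam → List ℕ}
    (hw : ∀ T, Red n lam (w T) T.1) :
    LinearIndependent k fun T => psiW k ν₀ (w T) • mbar k ν₀ n lam := by
  classical
  obtain ⟨h, v, hv, hx, hpsi⟩ := exists_spechtVec k hP h0 hw
  rw [linearIndependent_iff']
  intro s c hc T hT
  have hmem : ∑ U ∈ s, c U • psiW k ν₀ (w U) ∈ spechtIdeal k ν₀ n lam := by
    rw [← Submodule.Quotient.mk_eq_zero, ← hc, ← Submodule.mkQ_apply, map_sum]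
    refine Finset.sum_congr rfl fun U _ => ?_
    rw [Submodule.mkQ_apply]
    change _ = Submodule.Quotient.mk (c U • (psiW k ν₀ (w U) * 1))
    rw [mul_one]
  have h1 := lift_apply_eq_zero h hv hx hmem
  rw [map_sum, LinearMap.sum_apply] at h1
  have h2 := congrFun h1 T
  simp only [map_smul, LinearMap.smul_apply, HeckeOps.lift_psiW, hpsi, Finset.sum_apply,
    Pi.smul_apply, Pi.single_apply, smul_eq_mul, mul_ite, mul_one, mul_zero, Pi.zero_apply,
    Finset.sum_ite_eq, if_pos hT] at h2
  exact h2

end Independence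

section SpechtModule

variable {n : ℕ} {lam : ℕ → ℕ} {κ : ℤ} {ν₀ : Fin n → ℕ} (k : Type) [Field k]

/-- The generators of the quiver Hecke algebra acting on its Specht module. -/
noncomputable def spechtOps (ν₀ : Fin n → ℕ) (lam : ℕ → ℕ) :
    HeckeOps ν₀ (Module.End k (Specht k ν₀ n lam)) :=
  (HeckeOps.ofAlg k ν₀).map (Algebra.lsmul k k (Specht k ν₀ n lam)).toRingHom

theorem spechtOps_psi (L : List ℕ) (v : Specht k ν₀ n lam) :
    (spechtOps k ν₀ lam).psi L v = psiW k ν₀ L • v := by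
  rw [spechtOps, HeckeOps.map_psi]
  rfl

theorem smul_mbar (a : Alg k ν₀) : a • mbar k ν₀ n lam = Submodule.Quotient.mk a := by
  change Submodule.Quotient.mk (a * 1) = _
  rw [mul_one]

theorem smul_mbar_eq_zero {a : Alg k ν₀} (ha : a ∈ pmSet k ν₀ n lam ∪ gSet k ν₀ lam) :
    a • mbar k ν₀ n lam = 0 := by
  rw [smul_mbar, Submodule.Quotient.mk_eq_zero]
  exact Submodule.subset_span ha

theorem Ee_smul_mbar : Ee k ν₀ ν₀ • mbar k ν₀ n lam = mbar k ν₀ n lam := by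
  have := smul_mbar_eq_zero k (a := 1 - Ee k ν₀ ν₀) (lam := lam) (.inl (.inl (.inl rfl)))
  rw [sub_smul, one_smul, sub_eq_zero] at this
  exact this.symm

theorem spechtVec_mbar : SpechtVec (spechtOps k ν₀ lam) lam (mbar k ν₀ n lam) where
  e_eq := Ee_smul_mbar k
  x_mem r := by
    refine ⟨0, Eq.trans ?_ (zero_smul k (mbar k ν₀ n lam)).symm⟩
    by_cases hr : 1 ≤ r ∧ r ≤ n
    · have := smul_mbar_eq_zero k (ν₀ := ν₀) (lam := lam)
        (.inl (.inl (.inr ⟨r, hr.1, hr.2, rfl⟩)))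
      rwa [mul_smul, Ee_smul_mbar] at this
    · rw [(spechtOps k ν₀ lam).xzero r (by omega), LinearMap.zero_apply]
  row a b h1 h2 := by
    have := smul_mbar_eq_zero k (ν₀ := ν₀) (lam := lam) (.inl (.inr ⟨a, b, h1, h2, rfl⟩))
    rwa [mul_smul, Ee_smul_mbar] at this
  garnir a b h1 := by
    have := smul_mbar_eq_zero k (ν₀ := ν₀) (lam := lam) (.inr ⟨a, b, h1, rfl⟩)
    rwa [mul_smul, Ee_smul_mbar, ← spechtOps_psi] at this

theorem span_psiW (hP : IsPartitionOf n lam) (h0 : IsRes κ lam ν₀ (iniTab lam))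
    {w : StdTab n lam → List ℕ} (hw : ∀ T, Red n lam (w T) T.1) :
    Submodule.span k (Set.range fun T => psiW k ν₀ (w T) • mbar k ν₀ n lam) = ⊤ := by
  have hex : ∀ T, IsStdN n lam T → ∃ L, Red n lam L T := fun T hT => ⟨_, hw ⟨T, hT⟩⟩
  have hm := spechtVec_mbar k (ν₀ := ν₀) (lam := lam)
  have hspan := HeckeOps.stdSpan_eq hP _ hex hm h0 hw
  simp only [spechtOps_psi] at hspan
  rw [← hspan, eq_top_iff]
  rintro v -
  obtain ⟨a, rfl⟩ := Submodule.Quotient.mk_surjective _ v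
  rw [← smul_mbar]
  exact HeckeOps.smul_mem_of_generators _ (fun ν _ => e_mem_stdSpan hP hm h0 ν)
    (fun r _ => x_mem_stdSpan hP hex hm h0 r) (fun r _ => p_mem_stdSpan hP hex hm h0 r) a
    (Submodule.subset_span ⟨[], _, Red.nil, rfl⟩)

end SpechtModule

section Degrees

variable {κ : ℤ}

theorem bInf_eq (i : ℕ) (e : ℤ) :
    BInf i i / 2 * (-2 * (if e.natAbs = i then 1 else 0) + (if (e + 1).natAbs = i then 1 else 0) +
      (if (e - 1).natAbs = i then 1 else 0)) = -BInf i e.natAbs := by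
  rw [BInf, BInf, if_pos rfl]
  by_cases hi : i = 0
  · rw [if_pos hi]
    split_ifs <;> omega
  · rw [if_neg hi]
    split_ifs <;> omega

open Classical in
/-- The contribution of a node to the degree of `A` in the diagram `S`. -/
noncomputable def nodeWt (κ : ℤ) (S : Set PNode) (A w : PNode) : ℤ :=
  (if w ∈ addBelow (res κ) S (res κ A) A then 1 else 0) -
    (if w ∈ remBelow (res κ) S (res κ A) A then 1 else 0)

theorem nodeWt_congr {S S' : Set PNode} {A w : PNode}
    (hadd : w ∈ addBelow (res κ) S (res κ A) A ↔ w ∈ addBelow (res κ) S' (res κ A) A)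
    (hrem : w ∈ remBelow (res κ) S (res κ A) A ↔ w ∈ remBelow (res κ) S' (res κ A) A) :
    nodeWt κ S A w = nodeWt κ S' A w := by
  unfold nodeWt
  by_cases h1 : w ∈ addBelow (res κ) S (res κ A) A <;>
    by_cases h2 : w ∈ remBelow (res κ) S (res κ A) A
  · rw [if_pos h1, if_pos h2, if_pos (hadd.1 h1), if_pos (hrem.1 h2)]
  · rw [if_pos h1, if_neg h2, if_pos (hadd.1 h1), if_neg (mt hrem.2 h2)]
  · rw [if_neg h1, if_pos h2, if_neg (mt hadd.2 h1), if_pos (hrem.1 h2)]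
  · rw [if_neg h1, if_neg h2, if_neg (mt hadd.2 h1), if_neg (mt hrem.2 h2)]

theorem dA_eq_sum {S : Set PNode} {N : ℕ}
    (hS : ∀ w ∈ S, w.1 ≤ N ∧ w.2 ≤ N) (A : PNode) :
    dA (res κ) S A = BInf (res κ A) (res κ A) / 2 *
      ∑ w ∈ Finset.range (N + 2) ×ˢ Finset.range (N + 2), nodeWt κ S A w := by
  classical
  have hcard : ∀ P : Set PNode, (∀ w ∈ P, w.1 ≤ N + 1 ∧ w.2 ≤ N + 1) →
      (P.ncard : ℤ) = ∑ w ∈ Finset.range (N + 2) ×ˢ Finset.range (N + 2),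
        if w ∈ P then 1 else 0 := by
    intro P hPb
    rw [Finset.sum_boole, ← Set.ncard_coe_finset]
    congr 2
    ext w
    simp only [Finset.coe_filter, Finset.mem_product, Finset.mem_range, Set.mem_ofPred_eq]
    exact ⟨fun h => ⟨by have := hPb w h; omega, h⟩, fun h => h.2⟩
  have hadd : ∀ w ∈ addBelow (res κ) S (res κ A) A, w.1 ≤ N + 1 ∧ w.2 ≤ N + 1 := by
    rintro w ⟨-, -, -, -, h1, h2, -⟩
    constructor
    · rcases h1 with h1 | h1
      · omega
      · have := (hS _ h1).1
        simp only at this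
        omega
    · rcases h2 with h2 | h2
      · omega
      · have := (hS _ h2).2
        simp only at this
        omega
  have hrem : ∀ w ∈ remBelow (res κ) S (res κ A) A, w.1 ≤ N + 1 ∧ w.2 ≤ N + 1 := by
    rintro w ⟨h, -⟩
    have := hS w h
    omega
  simp only [nodeWt]
  rw [dA, hcard _ hadd, hcard _ hrem, Finset.sum_sub_distrib]

/-- The effect on the degree of `x` of adding the node `(a + 1, b + 1)` to a diagram. -/
theorem dA_insert {S : Set PNode} {N : ℕ} (hS : ∀ w ∈ S, w.1 ≤ N ∧ w.2 ≤ N)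
    (hS0 : ∀ w ∈ S, 1 ≤ w.2)
    (hrow : ∀ a b, 1 ≤ b → (a, b + 1) ∈ S → (a, b) ∈ S)
    (hcol : ∀ a b, 1 ≤ a → (a + 1, b) ∈ S → (a, b) ∈ S)
    {x : PNode} {a b : ℕ} (ha : 1 ≤ a) (hxa : x.1 ≤ a) (hy : (a + 1, b + 1) ∉ S)
    (hup : (a, b + 1) ∈ S) (hleft : b = 0 ∨ (a + 1, b) ∈ S)
    (hx : x.1 = a → (a, b + 2) ∈ S) :
    dA (res κ) (insert (a + 1, b + 1) S) x =
      dA (res κ) S x - BInf (res κ x) (res κ (a + 1, b + 1)) := by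
  have hN := hS _ hup
  simp only at hN
  have hLN : a + 1 ≤ N + 1 := by omega
  have hR : (a + 1, b + 2) ∉ S := fun h => hy (hrow _ _ (by omega) h)
  have hB : (a + 2, b + 1) ∉ S := fun h => hy (hcol _ _ (by omega) h)
  have hS1 : ∀ w ∈ insert ((a + 1, b + 1) : PNode) S, w.1 ≤ N + 1 ∧ w.2 ≤ N + 1 := by
    rintro w (rfl | h)
    · simp only
      omega
    · have := hS w h
      omega
  have hL0 : b = 0 → (a + 1, b) ∉ S := fun h hc => by
    have := hS0 _ hc
    simp only at this
    omega
  have r0 : res κ (a + 1, b + 1) = (κ + b - a).natAbs := by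
    unfold res; push_cast; congr 1; ring
  have r1 : res κ (a + 1, b + 2) = (κ + b - a + 1).natAbs := by
    unfold res; push_cast; congr 1; ring
  have r2 : res κ (a, b + 1) = (κ + b - a + 1).natAbs := by
    unfold res; push_cast; congr 1; ring
  have r3 : res κ (a + 2, b + 1) = (κ + b - a - 1).natAbs := by
    unfold res; push_cast; congr 1; ring
  have r4 : res κ (a + 1, b) = (κ + b - a - 1).natAbs := by
    unfold res; push_cast; congr 1; ring
  rw [dA_eq_sum hS1, dA_eq_sum (N := N + 1) (fun w h => by have := hS w h; omega), eq_comm,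
    sub_eq_add_neg, r0, ← bInf_eq, ← mul_add]
  congr 1
  rw [← eq_sub_iff_add_eq', ← Finset.sum_sub_distrib]
  have hsub : ({(a + 1, b + 1), (a + 1, b + 2), (a, b + 1), (a + 2, b + 1), (a + 1, b)} :
      Finset PNode) ⊆ Finset.range (N + 1 + 2) ×ˢ Finset.range (N + 1 + 2) := by
    intro w hw
    simp only [Finset.mem_insert, Finset.mem_singleton] at hw
    rw [Finset.mem_product, Finset.mem_range, Finset.mem_range]
    rcases hw with rfl | rfl | rfl | rfl | rfl <;> simp only <;> omega
  rw [← Finset.sum_subset hsub]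
  · rw [Finset.sum_insert (by simp), Finset.sum_insert (by simp), Finset.sum_insert (by simp),
      Finset.sum_insert (by simp), Finset.sum_singleton]
    have w0 : nodeWt κ (insert (a + 1, b + 1) S) x (a + 1, b + 1) - nodeWt κ S x (a + 1, b + 1) =
        -2 * (if (κ + b - a).natAbs = res κ x then 1 else 0) := by
      simp [nodeWt, addBelow, remBelow, r0, hy, hR, hB, hup, hleft, Nat.lt_succ_of_le hxa]
      split_ifs <;> norm_num
    have w1 : (nodeWt κ (insert (a + 1, b + 1) S) x (a + 1, b + 2) -
        nodeWt κ S x (a + 1, b + 2)) + (nodeWt κ (insert (a + 1, b + 1) S) x (a, b + 1) -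
        nodeWt κ S x (a, b + 1)) = (if (κ + b - a + 1).natAbs = res κ x then 1 else 0) := by
      by_cases hc : (a, b + 2) ∈ S
      · simp [nodeWt, addBelow, remBelow, r1, r2, hy, hR, hup, hc, Nat.lt_succ_of_le hxa]
      · have : x.1 < a := lt_of_le_of_ne hxa fun h => hc (hx h)
        simp [nodeWt, addBelow, remBelow, r1, r2, hy, hR, hup, hc, this,
          Nat.lt_succ_of_le hxa]
        omega
    have w2 : (nodeWt κ (insert (a + 1, b + 1) S) x (a + 2, b + 1) -
        nodeWt κ S x (a + 2, b + 1)) + (nodeWt κ (insert (a + 1, b + 1) S) x (a + 1, b) -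
        nodeWt κ S x (a + 1, b)) = (if (κ + b - a - 1).natAbs = res κ x then 1 else 0) := by
      have hxa2 : x.1 < a + 2 := by omega
      rcases hleft with rfl | hl
      · have hL := hL0 rfl
        simp [nodeWt, addBelow, remBelow, r3, r4, hy, hB, hxa2, hL,
          Nat.lt_succ_of_le hxa]
      · by_cases hc : (a + 2, b) ∈ S
        · simp [nodeWt, addBelow, remBelow, r3, r4, hy, hB, hc, hl, hxa2,
            Nat.lt_succ_of_le hxa]
        · have hb : b ≠ 0 := fun h => hL0 h hl
          simp [nodeWt, addBelow, remBelow, r3, r4, hy, hB, hc, hl, hxa2, hb,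
            Nat.lt_succ_of_le hxa]
    linarith
  · intro w _ hw
    obtain ⟨c, d⟩ := w
    simp only [Finset.mem_insert, Finset.mem_singleton, Prod.mk.injEq, not_or] at hw
    rw [sub_eq_zero]
    have h1 : ¬(c = a + 1 ∧ d = b + 1) := by omega
    have h2 : ¬(c + 1 = a + 1 ∧ d = b + 1) := by omega
    have h3 : ¬(c = a + 1 ∧ d + 1 = b + 1) := by omega
    have h4 : ¬(c - 1 = a + 1 ∧ d = b + 1) := by omega
    have h5 : ¬(c = a + 1 ∧ d - 1 = b + 1) := by omega
    have hadd : (c, d) ∈ addBelow (res κ) (insert (a + 1, b + 1) S) (res κ x) x ↔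
        (c, d) ∈ addBelow (res κ) S (res κ x) x := by
      simp only [addBelow, Set.mem_ofPred_eq, Set.mem_insert_iff, Prod.mk.injEq, h1, h4, h5,
        false_or]
    have hrem : (c, d) ∈ remBelow (res κ) (insert (a + 1, b + 1) S) (res κ x) x ↔
        (c, d) ∈ remBelow (res κ) S (res κ x) x := by
      simp only [remBelow, Set.mem_ofPred_eq, Set.mem_insert_iff, Prod.mk.injEq, h1, h2, h3,
        false_or]
    exact nodeWt_congr hadd hrem

end Degrees

section DegreeChange

variable {n : ℕ} {lam : ℕ → ℕ} {κ : ℤ}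

theorem dA_congr {S S' : Set PNode} {A : PNode} (h : ∀ w : PNode, A.1 ≤ w.1 → (w ∈ S ↔ w ∈ S')) :
    dA (res κ) S A = dA (res κ) S' A := by
  have h1 : addBelow (res κ) S (res κ A) A = addBelow (res κ) S' (res κ A) A := by
    ext w
    simp only [addBelow, Set.mem_ofPred_eq]
    by_cases hw : A.1 < w.1
    · rw [h w hw.le, h (w.1 - 1, w.2) (Nat.le_sub_one_of_lt hw), h (w.1, w.2 - 1) hw.le]
    · simp only [hw, and_false]
  have h2 : remBelow (res κ) S (res κ A) A = remBelow (res κ) S' (res κ A) A := by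
    ext w
    simp only [remBelow, Set.mem_ofPred_eq]
    by_cases hw : A.1 < w.1
    · rw [h w hw.le, h (w.1 + 1, w.2) (hw.le.trans (Nat.le_succ _)), h (w.1, w.2 + 1) hw.le]
    · simp only [hw, and_false]
  rw [dA, dA, h1, h2]

theorem degP_iniTab (hP : IsPartitionOf n lam) :
    degP n lam κ (iniTab lam) = degP n lam κ (itab lam) := by
  unfold degP
  refine Finset.sum_congr rfl fun z hz => ?_
  rw [iniTab_of_mem ((mem_diagF hP).1 hz)]
  refine dA_congr fun w _ => and_congr_right fun hw => ?_
  rw [iniTab_of_mem hw]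

/-- The degree of a standard tableau changes by `-(α_i, α_j)` when the entries `r`, `r + 1` in
nodes of residues `i`, `j` are exchanged. -/
theorem degP_sw (hP : IsPartitionOf n lam) {T : PNode → ℕ} (hT : IsStdN n lam T) {r : ℕ}
    {x y : PNode} (hx : x ∈ diag lam) (hy : y ∈ diag lam) (hTx : T x = r + 1) (hTy : T y = r)
    (hlt : itab lam x < itab lam y) :
    degP n lam κ T = degP n lam κ (sw r T) - BInf (res κ x) (res κ y) := by
  have hU : IsStdN n lam (sw r T) := Desc.isStdN_sw hT ⟨x, hx, y, hy, hTx, hTy, hlt⟩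
  have hUx : sw r T x = r := sw_right hTx
  have hUy : sw r T y = r + 1 := sw_left hTy
  have hne : x ≠ y := fun h => by subst h; omega
  have hxy : x.1 < y.1 ∧ y.2 < x.2 := by
    have h1 := (itab_lt_iff hx hy).1 hlt
    by_contra hc
    have := std_lt hP hT hx hy (by omega) (by omega) hne
    omega
  have hnm : ∀ w, T w = r → w ∈ diag lam → w = y := fun w h hw =>
    hT.isTabN.inj hw hy (h.trans hTy.symm)
  have hnx : ∀ w, T w = r + 1 → w ∈ diag lam → w = x := fun w h hw =>
    hT.isTabN.inj hw hx (h.trans hTx.symm)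
  have hr1 : 1 ≤ r := (Desc.range hT.isTabN ⟨x, hx, y, hy, hTx, hTy, hlt⟩).1
  have key : dA (res κ) {w | w ∈ diag lam ∧ T w ≤ T x} x =
      dA (res κ) {w | w ∈ diag lam ∧ sw r T w ≤ sw r T x} x - BInf (res κ x) (res κ y) := by
    obtain ⟨a, b⟩ := y
    obtain ⟨a, rfl⟩ : ∃ a', a = a' + 1 := ⟨a - 1, by have := hy.1; simp only at this; omega⟩
    obtain ⟨b, rfl⟩ : ∃ b', b = b' + 1 := ⟨b - 1, by have := hy.2.1; simp only at this; omega⟩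
    have hset : {w | w ∈ diag lam ∧ T w ≤ T x} =
        insert ((a + 1, b + 1) : PNode) {w | w ∈ diag lam ∧ sw r T w ≤ sw r T x} := by
      ext w
      rw [Set.mem_insert_iff, Set.mem_ofPred_eq, Set.mem_ofPred_eq, hTx, hUx]
      constructor
      · rintro ⟨hw, h⟩
        by_cases hw1 : T w = r
        · exact .inl (hnm w hw1 hw)
        · refine .inr ⟨hw, ?_⟩
          rw [sw_apply, if_neg hw1]
          split_ifs <;> omega
      · rintro (rfl | ⟨hw, h⟩)
        · exact ⟨hy, by omega⟩
        · rw [sw_apply] at h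
          refine ⟨hw, ?_⟩
          split_ifs at h <;> omega
    have ha1 : 1 ≤ a := by
      have := hx.1
      simp only at hxy
      omega
    have hmem : ∀ w ∈ diag lam, w.1 ≤ a + 1 → w.2 ≤ b + 1 → w ≠ (a + 1, b + 1) →
        w ∈ {w | w ∈ diag lam ∧ sw r T w ≤ sw r T x} := fun w hw h1 h2 h3 => by
      have := std_lt hP hU hw hy h1 h2 h3
      exact ⟨hw, by omega⟩
    rw [hset]
    refine dA_insert (N := n) ?_ ?_ ?_ ?_ ha1 (by simp only at hxy; omega) ?_ ?_ ?_ ?_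
    · rintro w ⟨hw, -⟩
      have := (mem_diagF hP).2 hw
      simp only [diagF, Finset.mem_filter, Finset.mem_product, Finset.mem_Icc] at this
      omega
    · rintro w ⟨hw, -⟩
      exact hw.2.1
    · rintro c d hd ⟨hw, h⟩
      have hw' := diag_of_le hP hw (x := (c, d)) hw.1 hd le_rfl (Nat.le_succ _)
      exact ⟨hw', (std_le hP hU hw' hw le_rfl (Nat.le_succ _)).trans h⟩
    · rintro c d hd ⟨hw, h⟩
      have hw' := diag_of_le hP hw (x := (c, d)) hd hw.2.1 (Nat.le_succ _) le_rfl
      exact ⟨hw', (std_le hP hU hw' hw (Nat.le_succ _) le_rfl).trans h⟩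
    · rintro ⟨-, h⟩
      omega
    · exact hmem _ (diag_of_le hP hy (x := (a, b + 1)) ha1 (Nat.succ_pos b) (Nat.le_succ _) le_rfl)
        (Nat.le_succ _) le_rfl (by simp)
    · rcases Nat.eq_zero_or_pos b with h | h
      · exact .inl h
      · exact .inr (hmem _ (diag_of_le hP hy (x := (a + 1, b)) (Nat.succ_pos a) h le_rfl
          (Nat.le_succ _)) le_rfl (Nat.le_succ _) (by simp))
    · intro h
      simp only at hxy
      have hw := diag_of_le hP hx (x := (a, b + 2)) ha1 (Nat.succ_pos _) h.ge hxy.2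
      exact ⟨hw, std_le hP hU hw hx h.ge hxy.2⟩
  have key' : dA (res κ) {w | w ∈ diag lam ∧ T w ≤ T y} y =
      dA (res κ) {w | w ∈ diag lam ∧ sw r T w ≤ sw r T y} y := by
    refine dA_congr fun w hw => and_congr_right fun hw' => ?_
    have : T w ≠ r + 1 := fun h => by
      rw [hnx w h hw'] at hw
      omega
    rw [hTy, hUy, sw_apply]
    split_ifs <;> omega
  unfold degP
  rw [← Finset.add_sum_erase _ _ ((mem_diagF hP).2 hx),
    ← Finset.add_sum_erase (diagF n lam) _ ((mem_diagF hP).2 hx), key, sub_add_eq_add_sub]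
  congr 2
  refine Finset.sum_congr rfl fun z hz => ?_
  obtain ⟨hzx, hz⟩ := Finset.mem_erase.1 hz
  have hz := (mem_diagF hP).1 hz
  by_cases hzy : z = y
  · rw [hzy, key']
  · have h1 : T z ≠ r := fun h => hzy (hnm z h hz)
    have h2 : T z ≠ r + 1 := fun h => hzx (hnx z h hz)
    refine dA_congr fun w _ => and_congr_right fun _ => ?_
    rw [sw_ne rfl h1 h2, sw_apply]
    split_ifs <;> omega

end DegreeChange

section GradedDimension

/-- If a projection acts diagonally on a basis which is homogeneous for a grading, the graded
components of its image are spanned by the basis vectors they contain. -/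
theorem finrank_range_inf_eq_ncard {k V ι : Type*} [Field k] [AddCommGroup V] [Module k V]
    [Finite ι] {v : ι → V} (hli : LinearIndependent k v) (hsp : Submodule.span k (Set.range v) = ⊤)
    {G : ℤ → Submodule k V} (hG : DirectSum.IsInternal G) {d : ι → ℤ} (hd : ∀ i, v i ∈ G (d i))
    {f : V →ₗ[k] V} {p : ι → Prop} (hp : ∀ i, p i → f (v i) = v i) (hp' : ∀ i, ¬ p i → f (v i) = 0)
    (D : ℤ) : Module.finrank k ↥(LinearMap.range f ⊓ G D) = Set.ncard {i | p i ∧ d i = D} := by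
  classical
  have := Fintype.ofFinite ι
  have hw : ∀ u, ∃ c : ι → k, u = ∑ i, c i • v i := fun u => by
    have hu : u ∈ Submodule.span k (Set.range v) := hsp ▸ Submodule.mem_top
    obtain ⟨c, hc⟩ := (Submodule.mem_span_range_iff_exists_fun k).1 hu
    exact ⟨c, hc.symm⟩
  have hspan : LinearMap.range f ⊓ G D =
      Submodule.span k (Set.range fun i : {i // p i ∧ d i = D} => v i.1) := by
    refine le_antisymm ?_ (Submodule.span_le.2 ?_)
    · rintro _ ⟨⟨u, rfl⟩, h2⟩
      obtain ⟨c, rfl⟩ := hw u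
      have hf : f (∑ i, c i • v i) = ∑ i, (if p i then c i else 0) • v i := by
        rw [map_sum]
        refine Finset.sum_congr rfl fun i _ => ?_
        rw [map_smul]
        split_ifs with h
        · rw [hp i h]
        · rw [hp' i h, smul_zero, zero_smul]
      set c' : ι → k := fun i => if p i then c i else 0 with hc'
      have hsplit : ∑ i, c' i • v i = ∑ i with d i = D, c' i • v i +
          ∑ i with ¬ d i = D, c' i • v i := (Finset.sum_filter_add_sum_filter_not _ _ _).symm
      have h3 : ∑ i with d i = D, c' i • v i ∈ G D := Submodule.sum_mem _ fun i hi =>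
        Submodule.smul_mem _ _ ((Finset.mem_filter.1 hi).2 ▸ hd i)
      have h4 : ∑ i with ¬ d i = D, c' i • v i ∈ ⨆ j, ⨆ _ : j ≠ D, G j :=
        Submodule.sum_mem _ fun i hi => Submodule.smul_mem _ _
          (Submodule.mem_iSup_of_mem (d i)
            (Submodule.mem_iSup_of_mem (Finset.mem_filter.1 hi).2 (hd i)))
      change f _ ∈ G D at h2
      rw [hf, hsplit] at h2
      have h5 : ∑ i with ¬ d i = D, c' i • v i = 0 :=
        Submodule.disjoint_def.1 (hG.submodule_iSupIndep D) _
          ((Submodule.add_mem_iff_right _ h3).1 h2) h4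
      rw [hf, hsplit, h5, add_zero]
      refine Submodule.sum_mem _ fun i hi => ?_
      simp only [hc']
      split_ifs with h
      · exact Submodule.smul_mem _ _ (Submodule.subset_span
          ⟨⟨i, h, (Finset.mem_filter.1 hi).2⟩, rfl⟩)
      · rw [zero_smul]
        exact Submodule.zero_mem _
    · rintro _ ⟨⟨i, h1, h2⟩, rfl⟩
      exact ⟨⟨v i, hp i h1⟩, h2 ▸ hd i⟩
  rw [hspan]
  exact (finrank_span_eq_card (hli.comp _ Subtype.val_injective)).trans
    Nat.card_eq_fintype_card.symm

variable {n : ℕ} {lam : ℕ → ℕ} {κ : ℤ} {ν₀ : Fin n → ℕ} {k : Type} [Field k]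

theorem Ee_smul_psiW (hP : IsPartitionOf n lam) (h0 : IsRes κ lam ν₀ (iniTab lam))
    {L : List ℕ} {T : PNode → ℕ} (hL : Red n lam L T) {μ : Fin n → ℕ} (hμ : IsRes κ lam μ T) :
    Ee k ν₀ μ • (psiW k ν₀ L • mbar k ν₀ n lam) = psiW k ν₀ L • mbar k ν₀ n lam := by
  have := e_psi (h := spechtOps k ν₀ lam) (spechtVec_mbar k).e_eq h0 hP hL.isWord
    (hL.eq_tab ▸ hμ)
  rw [spechtOps_psi] at this
  exact this

theorem exists_isRes_of_red (h0 : IsRes κ lam ν₀ (iniTab lam)) {L : List ℕ} {T : PNode → ℕ}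
    (hL : Red n lam L T) : ∃ μ : Fin n → ℕ, IsRes κ lam μ T := by
  obtain ⟨μ, -, hμ⟩ := exists_isRes_tab h0 hL.isWord
  exact ⟨μ, hL.eq_tab ▸ hμ⟩

theorem Ee_smul_psiW_eq_zero (hP : IsPartitionOf n lam) (h0 : IsRes κ lam ν₀ (iniTab lam))
    {L : List ℕ} {T : PNode → ℕ} (hL : Red n lam L T) {μ : Fin n → ℕ} (hμ : ¬ IsRes κ lam μ T) :
    Ee k ν₀ μ • (psiW k ν₀ L • mbar k ν₀ n lam) = 0 := by
  obtain ⟨μ', hμ'⟩ := exists_isRes_of_red h0 hL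
  have hne : μ ≠ μ' := fun h => hμ (h ▸ hμ')
  have hz : Ee k ν₀ μ * Ee k ν₀ μ' = 0 := by
    rw [Ee, Ee, ← map_mul]
    exact (RingQuot.mkAlgHom_rel k (Rel.idem μ μ')).trans (by rw [if_neg hne, map_zero])
  rw [← Ee_smul_psiW hP h0 hL hμ', ← mul_smul (Ee k ν₀ μ), hz]
  exact zero_smul _ (psiW k ν₀ L • mbar k ν₀ n lam)

theorem psiW_smul_mbar_mem (hP : IsPartitionOf n lam) (h0 : IsRes κ lam ν₀ (iniTab lam))
    {GA : ℤ → Submodule k (Alg k ν₀)} {GM : ℤ → Submodule k (Specht k ν₀ n lam)}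
    (hp : ∀ s : ℕ, ∀ ν : Fin n → ℕ, 1 ≤ s → s + 1 ≤ n →
      Pe k ν₀ s * Ee k ν₀ ν ∈ GA (-(BInf (seqAt ν s) (seqAt ν (s + 1)))))
    (hsmul : ∀ (i j : ℤ) (a : Alg k ν₀) (v : Specht k ν₀ n lam),
      a ∈ GA i → v ∈ GM j → a • v ∈ GM (i + j))
    (hm : mbar k ν₀ n lam ∈ GM 0) {L : List ℕ} {T : PNode → ℕ} (hL : Red n lam L T) :
    psiW k ν₀ L • mbar k ν₀ n lam ∈ GM (degP n lam κ T - degP n lam κ (itab lam)) := by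
  induction hL with
  | nil =>
    rw [degP_iniTab hP, sub_self]
    have : psiW k ν₀ [] • mbar k ν₀ n lam = mbar k ν₀ n lam := one_smul _ _
    rwa [this]
  | @cons r L T hT hd hL ih =>
    obtain ⟨h1, h2⟩ := hd.range hT.isTabN
    obtain ⟨x, hx, y, hy, hTx, hTy, hlt⟩ := hd
    obtain ⟨μ, hμ⟩ := exists_isRes_of_red h0 hL
    have e1 := hμ x hx
    have e2 := hμ y hy
    rw [sw_right hTx] at e1
    rw [sw_left hTy] at e2
    have hstep : psiW k ν₀ (r :: L) • mbar k ν₀ n lam =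
        (Pe k ν₀ r * Ee k ν₀ μ) • (psiW k ν₀ L • mbar k ν₀ n lam) := by
      rw [mul_smul, Ee_smul_psiW hP h0 hL hμ, ← mul_smul, psiW, List.map_cons, List.prod_cons]
      rfl
    have hmem := hsmul _ _ _ _ (hp r μ h1 h2) ih
    rw [e1, e2] at hmem
    rw [hstep, degP_sw hP hT hx hy hTx hTy hlt]
    convert hmem using 2
    ring

end GradedDimension

end SpechtBasis

/-- (Basis theorem for Specht modules in type `C_∞`.)  Let `λ` be a
partition of `n` with charge `κ`, `β` its content (encoded by the residue sequence `ν₀`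
of `t^λ`) and `S^λ` the Specht module over `R(β)`.  Then, for any fixed choice `wrd` of
reduced expressions of the `w^T`:
the set `{ψ_{w^T} m̄^λ : T standard}` is a `k`-basis of `S^λ`; moreover (with respect to
the grading of `R(β)` and the induced grading of `S^λ` with `m̄^λ` in degree `0`) each
`ψ_{w^T} m̄^λ` lies in `e(res T) S^λ` and is homogeneous of degree `deg T − deg t^λ`,
and for every `ν ∈ I^β` the degree-`d` component of `e(ν)S^λ` has dimension the number
of standard `λ`-tableaux `T` with `res T = ν` and `deg T − deg t^λ = d`. -/
theorem stmt19 (k : Type) [Field k] (n : ℕ) (κ : ℤ) (lam : ℕ → ℕ)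
    (hP : IsPartitionOf n lam)
    (ν₀ : Fin n → ℕ)
    (hν₀ : ∀ x ∈ PT.diag lam, seqAt ν₀ (PT.itab lam x) = PT.res κ x)
    (wrd : (PNode → ℕ) → List ℕ)
    (hwrd : ∀ T : PNode → ℕ, IsStdN n lam T → RedWordFor n lam T (wrd T)) :
    (LinearIndependent k
        (fun T : {T : PNode → ℕ // IsStdN n lam T} =>
          psiW k ν₀ (wrd T.1) • mbar k ν₀ n lam) ∧
      Submodule.span k
        (Set.range (fun T : {T : PNode → ℕ // IsStdN n lam T} =>
          psiW k ν₀ (wrd T.1) • mbar k ν₀ n lam)) = ⊤) ∧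
    (∀ GA : ℤ → Submodule k (Alg k ν₀), ∀ GM : ℤ → Submodule k (Specht k ν₀ n lam),
      DirectSum.IsInternal GA → DirectSum.IsInternal GM →
      (1 : Alg k ν₀) ∈ GA 0 →
      (∀ ν : Fin n → ℕ, Ee k ν₀ ν ∈ GA 0) →
      (∀ r : ℕ, ∀ ν : Fin n → ℕ, 1 ≤ r → r ≤ n →
        Xe k ν₀ r * Ee k ν₀ ν ∈ GA (BInf (seqAt ν r) (seqAt ν r))) →
      (∀ s : ℕ, ∀ ν : Fin n → ℕ, 1 ≤ s → s + 1 ≤ n →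
        Pe k ν₀ s * Ee k ν₀ ν ∈ GA (-(BInf (seqAt ν s) (seqAt ν (s + 1))))) →
      (∀ (i j : ℤ) (a b : Alg k ν₀), a ∈ GA i → b ∈ GA j → a * b ∈ GA (i + j)) →
      (∀ (i j : ℤ) (a : Alg k ν₀) (v : Specht k ν₀ n lam),
        a ∈ GA i → v ∈ GM j → a • v ∈ GM (i + j)) →
      mbar k ν₀ n lam ∈ GM 0 →
      (∀ T : PNode → ℕ, IsStdN n lam T →
        (psiW k ν₀ (wrd T) • mbar k ν₀ n lam ∈
          GM (degP n lam κ T - degP n lam κ (PT.itab lam)) ∧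
        ∀ μ : Fin n → ℕ, (∀ x ∈ PT.diag lam, seqAt μ (T x) = PT.res κ x) →
          Ee k ν₀ μ • (psiW k ν₀ (wrd T) • mbar k ν₀ n lam) =
            psiW k ν₀ (wrd T) • mbar k ν₀ n lam)) ∧
      (∀ μ : Fin n → ℕ, ∀ d : ℤ,
        Module.finrank k
          ↥(Submodule.span k
              {v : Specht k ν₀ n lam | ∃ u : Specht k ν₀ n lam, v = Ee k ν₀ μ • u} ⊓
            GM d) =
        Set.ncard {T : PNode → ℕ | IsStdN n lam T ∧
          (∀ x ∈ PT.diag lam, seqAt μ (T x) = PT.res κ x) ∧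
          degP n lam κ T - degP n lam κ (PT.itab lam) = d})) := by
  have hIni : SpechtBasis.IsRes κ lam ν₀ (SpechtBasis.iniTab lam) := SpechtBasis.isRes_iniTab.2 hν₀
  have hred : ∀ T, IsStdN n lam T → SpechtBasis.Red n lam (wrd T) T := fun T hT =>
    SpechtBasis.red_of_redWordFor hP hT (hwrd T hT)
  have hli := SpechtBasis.linearIndependent_psiW k hP hIni (w := fun T => wrd T.1)
    fun T => hred T.1 T.2
  have hsp := SpechtBasis.span_psiW k hP hIni (w := fun T => wrd T.1) fun T => hred T.1 T.2
  refine ⟨⟨hli, hsp⟩, ?_⟩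
  intro GA GM _ hGM _ _ _ hp _ hsmul hm
  have hdeg : ∀ T, IsStdN n lam T → psiW k ν₀ (wrd T) • mbar k ν₀ n lam ∈
      GM (degP n lam κ T - degP n lam κ (PT.itab lam)) := fun T hT =>
    SpechtBasis.psiW_smul_mbar_mem hP hIni hp hsmul hm (hred T hT)
  refine ⟨fun T hT => ⟨hdeg T hT, fun μ hμ =>
    SpechtBasis.Ee_smul_psiW hP hIni (hred T hT) hμ⟩, fun μ d => ?_⟩
  have := SpechtBasis.finite_stdTab hP
  have hrange : Submodule.span k
      {v : Specht k ν₀ n lam | ∃ u : Specht k ν₀ n lam, v = Ee k ν₀ μ • u} =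
      LinearMap.range (Algebra.lsmul k k (Specht k ν₀ n lam) (Ee k ν₀ μ)) := by
    rw [← Submodule.span_eq (LinearMap.range _)]
    congr 1
    ext v
    exact ⟨fun ⟨u, hu⟩ => ⟨u, hu.symm⟩, fun ⟨u, hu⟩ => ⟨u, hu.symm⟩⟩
  rw [hrange, SpechtBasis.finrank_range_inf_eq_ncard hli hsp hGM (fun T => hdeg T.1 T.2)
    (p := fun T => SpechtBasis.IsRes κ lam μ T.1)
    (fun T hT => SpechtBasis.Ee_smul_psiW hP hIni (hred T.1 T.2) hT)
    (fun T hT => SpechtBasis.Ee_smul_psiW_eq_zero hP hIni (hred T.1 T.2) hT) d,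
    ← Set.ncard_image_of_injective _ Subtype.val_injective]
  congr 2
  ext T
  constructor
  · rintro ⟨T, ⟨h1, h2⟩, rfl⟩
    exact ⟨T.2, h1, h2⟩
  · rintro ⟨h1, h2, h3⟩
    exact ⟨⟨T, h1⟩, ⟨h2, h3⟩, rfl⟩
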